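/- Fix 1/2 < η < 3/5 and set γ = (3 − 5η)/(2(1 − η)). Call a prime p good if p ∤ D_A and ord(A,p) ≥ p^η, and for an integer N let N_G denote the product of the maximal prime powers p^a exactly dividing N over the good primes p dividing N. Then there is a constant C > 0 such that for all sufficiently large x, the number of integers N ≤ x with N_G ≤ exp((log x)^{γ/2}) is at most C·x/(log x)^{γ/2}. -/

import Mathlib

open Matrix Finset

/-- `matOrd A N` is the order of `A` modulo `N`: the least `k ≥ 1`
with `A^k ≡ I (mod N)`. -/
noncomputable def matOrd (A : Matrix (Fin 2) (Fin 2) ℤ) (N : ℕ) : ℕ :=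
  sInf {k | 0 < k ∧ ∀ i j, (N : ℤ) ∣ (A ^ k - 1) i j}

/-- A prime `p` is *good* (for the exponent `η`) if `p ∤ D_A` and
`ord(A,p) ≥ p^η`. -/
def GoodPrime (A : Matrix (Fin 2) (Fin 2) ℤ) (η : ℝ) (p : ℕ) : Prop :=
  ¬ (p ∣ (4 * (A.trace ^ 2 - 4)).natAbs) ∧ (p : ℝ) ^ η ≤ (matOrd A p : ℝ)

open Classical in
/-- `N_G`: the product of the maximal prime powers `p^a ∥ N` over the good
primes `p` dividing `N`. -/
noncomputable def goodPart (A : Matrix (Fin 2) (Fin 2) ℤ) (η : ℝ) (N : ℕ) : ℕ :=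
  ∏ p ∈ N.primeFactors.filter (GoodPrime A η), p ^ (N.factorization p)

section Part0
open Matrix Finset

namespace FI
open scoped ArithmeticFunction.vonMangoldt ArithmeticFunction.Moebius ArithmeticFunction.zeta

/-! ### Mertens estimates -/

lemma sum_log_eq (N : ℕ) :
    ∑ n ∈ Ioc 0 N, Real.log n = ∑ d ∈ Ioc 0 N, Λ d * ((N / d : ℕ) : ℝ) := by
  have h := ArithmeticFunction.sum_Ioc_mul_zeta_eq_sum (R := ℝ) Λ N
  rw [ArithmeticFunction.vonMangoldt_mul_zeta] at h
  simpa [ArithmeticFunction.log_apply] using h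

lemma sum_log_le (N : ℕ) : ∑ n ∈ Ioc 0 N, Real.log n ≤ N * Real.log N := by
  calc ∑ n ∈ Ioc 0 N, Real.log n ≤ ∑ n ∈ Ioc 0 N, Real.log N := by
        apply sum_le_sum
        intro n hn
        rw [mem_Ioc] at hn
        apply Real.log_le_log
        · exact_mod_cast hn.1
        · exact_mod_cast hn.2
    _ = N * Real.log N := by simp

lemma le_sum_log (N : ℕ) : N * Real.log N - N ≤ ∑ n ∈ Ioc 0 N, Real.log n := by
  induction N with
  | zero => simp
  | succ n ih =>
    have h1 : Ioc 0 (n+1) = insert (n+1) (Ioc 0 n) := by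
      ext k; simp only [mem_Ioc, mem_insert]; omega
    rw [h1, sum_insert (by simp)]
    rcases Nat.eq_zero_or_pos n with h0 | h0
    · subst h0; simp
    have hn : (0:ℝ) < n := by exact_mod_cast h0
    have h2 : Real.log ((n+1:ℕ):ℝ) - Real.log n ≤ 1 / n := by
      have : Real.log (((n+1:ℕ):ℝ) / n) ≤ ((n+1:ℕ):ℝ)/n - 1 := Real.log_le_sub_one_of_pos (by positivity)
      rw [Real.log_div (by positivity) (by positivity)] at this
      have h3 : ((n+1:ℕ):ℝ)/n - 1 = 1 / n := by push_cast; field_simp; ring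
      linarith
    have h4 : (n:ℝ) * (Real.log ((n+1:ℕ):ℝ) - Real.log n) ≤ 1 := by
      calc (n:ℝ) * (Real.log ((n+1:ℕ):ℝ) - Real.log n) ≤ n * (1/n) := by gcongr
        _ = 1 := by field_simp
    push_cast at *
    nlinarith

lemma mertens_lower {N : ℕ} (hN : 1 ≤ N) : Real.log N - 1 ≤ ∑ n ∈ Ioc 0 N, Λ n / n := by
  have h1 := le_sum_log N
  rw [sum_log_eq] at h1
  have hN' : (0:ℝ) < N := by exact_mod_cast hN
  have h2 : ∑ d ∈ Ioc 0 N, Λ d * ((N / d : ℕ) : ℝ) ≤ N * ∑ n ∈ Ioc 0 N, Λ n / n := by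
    rw [mul_sum]
    apply sum_le_sum
    intro d hd
    have : ((N / d : ℕ) : ℝ) ≤ (N:ℝ) / d := Nat.cast_div_le
    calc Λ d * ((N / d : ℕ) : ℝ) ≤ Λ d * ((N:ℝ) / d) := by
          apply mul_le_mul_of_nonneg_left this ArithmeticFunction.vonMangoldt_nonneg
      _ = _ := by ring
  have h3 : (N:ℝ) * (Real.log N - 1) ≤ N * ∑ n ∈ Ioc 0 N, Λ n / n := by linarith
  exact le_of_mul_le_mul_left h3 hN'

lemma psi_nat_le (N : ℕ) : ∑ n ∈ Ioc 0 N, Λ n ≤ 6 * N := by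
  have h := Chebyshev.psi_le_const_mul_self (x := (N:ℝ)) (by positivity)
  have h2 : Chebyshev.psi (N:ℝ) = ∑ n ∈ Ioc 0 N, Λ n := by
    rw [Chebyshev.psi, Nat.floor_natCast]
  rw [h2] at h
  have h3 : Real.log 4 ≤ 2 := by
    have : Real.log 4 = 2 * Real.log 2 := by
      rw [show (4:ℝ) = 2^2 by norm_num, Real.log_pow]; norm_num
    have := Real.log_two_lt_d9
    linarith
  have : (Real.log 4 + 4) * (N:ℝ) ≤ 6 * N := by gcongr; linarith
  linarith

lemma mertens_upper {N : ℕ} (hN : 1 ≤ N) : ∑ n ∈ Ioc 0 N, Λ n / n ≤ Real.log N + 6 := by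
  have h1 := sum_log_le N
  rw [sum_log_eq] at h1
  have hN' : (0:ℝ) < N := by exact_mod_cast hN
  have h2 : N * ∑ n ∈ Ioc 0 N, Λ n / n ≤
      ∑ d ∈ Ioc 0 N, Λ d * ((N / d : ℕ) : ℝ) + ∑ d ∈ Ioc 0 N, Λ d := by
    rw [mul_sum, ← sum_add_distrib]
    apply sum_le_sum
    intro d hd
    have hd0 : 0 < d := (mem_Ioc.1 hd).1
    have h5 : (N:ℝ) / d ≤ ((N / d : ℕ) : ℝ) + 1 := by
      rw [div_le_iff₀ (by exact_mod_cast hd0)]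
      have := Nat.lt_div_mul_add (a := N) hd0
      have h6 : N ≤ (N / d + 1) * d := by nlinarith
      exact_mod_cast h6
    calc (N:ℝ) * (Λ d / d) = Λ d * ((N:ℝ)/d) := by ring
      _ ≤ Λ d * (((N / d : ℕ) : ℝ) + 1) :=
          mul_le_mul_of_nonneg_left h5 ArithmeticFunction.vonMangoldt_nonneg
      _ = _ := by ring
  have h3 := psi_nat_le N
  have h4 : (N:ℝ) * ∑ n ∈ Ioc 0 N, Λ n / n ≤ N * (Real.log N + 6) := by linarith
  exact le_of_mul_le_mul_left h4 hN'

noncomputable def npL (n : ℕ) : ℝ := if n.Prime then 0 else Λ n / n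

lemma npL_nonneg (n : ℕ) : 0 ≤ npL n := by
  unfold npL
  split_ifs
  · exact le_rfl
  · exact div_nonneg ArithmeticFunction.vonMangoldt_nonneg (by positivity)

lemma summable_log_div_sq : Summable (fun n : ℕ => Real.log n / (n:ℝ)^2) := by
  have h : Summable (fun n : ℕ => 2 * (1 / (n:ℝ) ^ (3/2:ℝ))) :=
    (Real.summable_one_div_nat_rpow.2 (by norm_num)).mul_left 2
  refine Summable.of_nonneg_of_le (fun n => ?_) (fun n => ?_) h
  · apply div_nonneg (Real.log_natCast_nonneg n) (by positivity)
  · rcases Nat.eq_zero_or_pos n with h0 | h0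
    · subst h0; simp
    have hn : (0:ℝ) < n := by exact_mod_cast h0
    have h1 := Real.log_le_rpow_div (x := (n:ℝ)) hn.le (ε := 1/2) (by norm_num)
    have h2 : (n:ℝ)^2 = (n:ℝ)^(3/2:ℝ) * (n:ℝ)^(1/2:ℝ) := by
      rw [← Real.rpow_add hn]; norm_num
    rw [h2, div_le_iff₀ (by positivity)]
    calc Real.log n ≤ (n:ℝ)^(1/2:ℝ) / (1/2) := h1
      _ = _ := by field_simp

lemma summable_npL : Summable npL := by
  obtain ⟨C, hC⟩ : ∃ C, ∀ s : Finset ℕ, ∑ n ∈ s, Real.log n / (n:ℝ)^2 ≤ C := by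
    refine ⟨_, fun s => summable_log_div_sq.sum_le_tsum s (fun n _ => ?_)⟩
    apply div_nonneg (Real.log_natCast_nonneg n) (by positivity)
  have hC0 : 0 ≤ C := by simpa using hC ∅
  have key : ∀ N : ℕ, ∑ n ∈ Ioc 0 N, npL n ≤ 4 * C := by
    intro N
    have h1 : ∑ n ∈ Ioc 0 N, npL n = ∑ n ∈ Ioc 0 ⌊(N:ℝ)⌋₊ with IsPrimePow n, npL n := by
      rw [Nat.floor_natCast, sum_filter]
      apply sum_congr rfl
      intro n _
      split_ifs with h
      · rfl
      · unfold npL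
        rw [ArithmeticFunction.vonMangoldt_eq_zero_iff.2 h]; simp
    rw [h1, Chebyshev.sum_PrimePow_eq_sum_sum _ (by positivity)]
    calc _ ≤ ∑ k ∈ Icc 1 ⌊Real.log N / Real.log 2⌋₊, C * (2 * (1/2:ℝ)^(k-1)) := by
          apply sum_le_sum
          intro k hk
          rw [mem_Icc] at hk
          rcases Nat.lt_or_ge k 2 with h2 | h2
          · have : k = 1 := by omega
            subst this
            rw [sum_eq_zero]
            · positivity
            · intro p hp
              rw [mem_filter] at hp
              simp [npL, hp.2]
          · calc _ ≤ ∑ p ∈ Ioc 0 ⌊(N:ℝ) ^ ((1 : ℝ) / k)⌋₊ with p.Prime,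
                (Real.log p / (p:ℝ)^2) * (2 * (1/2:ℝ)^(k-1)) := by
                  apply sum_le_sum
                  intro p hp
                  rw [mem_filter] at hp
                  have hp2 : (2:ℝ) ≤ p := by exact_mod_cast hp.2.two_le
                  have e1 : npL (p^k) = Real.log p / (p:ℝ)^k := by
                    unfold npL
                    rw [if_neg (Nat.Prime.not_prime_pow h2),
                      ArithmeticFunction.vonMangoldt_apply_pow (by omega),
                      ArithmeticFunction.vonMangoldt_apply_prime hp.2]
                    push_cast; rfl
                  rw [e1]
                  obtain ⟨j, rfl⟩ := Nat.exists_eq_add_of_le h2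
                  have e2 : (1/2:ℝ)^(2+j-1) = (1/2) * (1/2)^j := by
                    rw [show 2+j-1 = j+1 by omega, pow_succ]; ring
                  rw [e2, pow_add, div_mul_eq_div_div, div_eq_mul_inv (_/_)]
                  apply mul_le_mul_of_nonneg_left
                  · rw [← inv_pow]
                    have : ((p:ℝ))⁻¹ ≤ 1/2 := by rw [one_div]; gcongr
                    calc _ ≤ (1/2:ℝ)^j := by gcongr
                      _ = _ := by ring
                  · apply div_nonneg (Real.log_natCast_nonneg p) (by positivity)
              _ = (∑ p ∈ Ioc 0 ⌊(N:ℝ) ^ ((1 : ℝ) / k)⌋₊ with p.Prime, Real.log p / (p:ℝ)^2) * (2 * (1/2:ℝ)^(k-1)) := by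
                  rw [sum_mul]
              _ ≤ C * (2 * (1/2:ℝ)^(k-1)) := by gcongr; exact hC _
      _ ≤ 4 * C := by
          rw [← mul_sum, ← mul_sum]
          have : ∑ k ∈ Icc 1 ⌊Real.log N / Real.log 2⌋₊, (1/2:ℝ)^(k-1) ≤ 2 := by
            have e : Icc 1 ⌊Real.log N / Real.log 2⌋₊ = (range ⌊Real.log N / Real.log 2⌋₊).image (· + 1) := by
              ext k; simp only [mem_Icc, mem_image, mem_range]
              constructor
              · intro h; exact ⟨k-1, by omega, by omega⟩
              · rintro ⟨j, h, rfl⟩; omega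
            rw [e, sum_image (by intro a _ b _ h; simpa using h)]
            simpa using sum_geometric_two_le ⌊Real.log N / Real.log 2⌋₊
          nlinarith
  apply summable_of_sum_range_le (c := 4 * C) npL_nonneg
  intro n
  calc _ ≤ ∑ i ∈ Ioc 0 n, npL i := by
        rw [← sum_subset (s₁ := (range n).filter (fun i => i ≠ 0)) (s₂ := range n) (filter_subset _ _)]
        · apply sum_le_sum_of_subset_of_nonneg
          · intro i hi; simp at hi ⊢; omega
          · intros; exact npL_nonneg _
        · intro i hi h2
          simp at hi h2
          have := h2 hi
          subst this; simp [npL]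
    _ ≤ _ := key n


/-- Mertens for primes on `Ioc y Y`. -/
lemma mertens_primes : ∃ C : ℝ, 0 < C ∧ ∀ y Y : ℕ, 1 ≤ y → y ≤ Y →
    |∑ p ∈ Ioc y Y with p.Prime, Real.log p / p - (Real.log Y - Real.log y)| ≤ C := by
  refine ⟨7 + ∑' n, npL n, by have h0 : 0 ≤ ∑' n, npL n := tsum_nonneg npL_nonneg; linarith, fun y Y hy hyY => ?_⟩
  have h1 : ∑ p ∈ Ioc y Y with p.Prime, Real.log p / p =
      ∑ n ∈ Ioc y Y, Λ n / n - ∑ n ∈ Ioc y Y, npL n := by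
    rw [← sum_sub_distrib, sum_filter]
    apply sum_congr rfl
    intro n _
    unfold npL
    split_ifs with h
    · rw [ArithmeticFunction.vonMangoldt_apply_prime h]; ring
    · ring
  have h2 : ∑ n ∈ Ioc y Y, Λ n / n = ∑ n ∈ Ioc 0 Y, Λ n / (n:ℝ) - ∑ n ∈ Ioc 0 y, Λ n / (n:ℝ) := by
    rw [← Ioc_union_Ioc_eq_Ioc (Nat.zero_le y) hyY, sum_union (Ioc_disjoint_Ioc_of_le le_rfl)]
    ring
  have h3 : ∑ n ∈ Ioc y Y, npL n ≤ ∑' n, npL n := summable_npL.sum_le_tsum _ (fun n _ => npL_nonneg n)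
  have h4 : 0 ≤ ∑ n ∈ Ioc y Y, npL n := sum_nonneg (fun n _ => npL_nonneg n)
  have a1 := mertens_lower hy
  have a2 := mertens_upper hy
  have a3 := mertens_lower (hy.trans hyY)
  have a4 := mertens_upper (hy.trans hyY)
  rw [h1, h2, abs_le]
  constructor <;> linarith

lemma mertens_L : ∀ y Y : ℕ, 1 ≤ y → y ≤ Y →
    |∑ n ∈ Ioc y Y, Λ n / n - (Real.log Y - Real.log y)| ≤ 7 := by
  intro y Y hy hyY
  have h2 : ∑ n ∈ Ioc y Y, Λ n / n = ∑ n ∈ Ioc 0 Y, Λ n / (n:ℝ) - ∑ n ∈ Ioc 0 y, Λ n / (n:ℝ) := by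
    rw [← Ioc_union_Ioc_eq_Ioc (Nat.zero_le y) hyY, sum_union (Ioc_disjoint_Ioc_of_le le_rfl)]
    ring
  have a1 := mertens_lower hy
  have a2 := mertens_upper hy
  have a3 := mertens_lower (hy.trans hyY)
  have a4 := mertens_upper (hy.trans hyY)
  rw [h2, abs_le]
  constructor <;> linarith

/-- The divisor bound. -/
lemma divisor_bound (ε : ℝ) (hε : 0 < ε) : ∃ C : ℝ, 1 ≤ C ∧ ∀ n : ℕ,
    (#n.divisors : ℝ) ≤ C * (n:ℝ) ^ ε := by
  set K : ℝ := max 1 (1 / (ε * Real.log 2)) with hK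
  have hlog2 : 0 < Real.log 2 := Real.log_pos (by norm_num)
  have hK1 : 1 ≤ K := le_max_left _ _
  have hK2 : 1 ≤ K * (ε * Real.log 2) := by
    have : 1 / (ε * Real.log 2) ≤ K := le_max_right _ _
    rw [div_le_iff₀ (by positivity)] at this
    exact this
  set P0 : ℕ := ⌈(2:ℝ) ^ (1/ε)⌉₊ with hP0
  refine ⟨K ^ P0, one_le_pow₀ hK1, fun n => ?_⟩
  rcases Nat.eq_zero_or_pos n with h0 | h0
  · subst h0; simp [Real.zero_rpow hε.ne']
  rw [Nat.card_divisors h0.ne']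
  have e1 : (n:ℝ) ^ ε = ∏ p ∈ n.primeFactors, ((p:ℝ) ^ (n.factorization p)) ^ ε := by
    rw [Real.finsetProd_rpow _ _ (fun i _ => by positivity)]
    congr 1
    conv_lhs => rw [← Nat.prod_factorization_pow_eq_self h0.ne']
    rw [Finsupp.prod]; push_cast; rfl
  have e2 : ∏ p ∈ n.primeFactors, (if p < P0 then K else 1) ≤ K ^ P0 := by
    rw [← prod_filter, prod_const]
    apply pow_le_pow_right₀ hK1
    calc _ ≤ #(range P0) := card_le_card (by intro p hp; simp at hp ⊢; exact hp.2)
      _ = P0 := by simp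
  calc ((∏ x ∈ n.primeFactors, (n.factorization x + 1) : ℕ) : ℝ)
      = ∏ x ∈ n.primeFactors, ((n.factorization x : ℝ) + 1) := by push_cast; rfl
    _ ≤ ∏ p ∈ n.primeFactors, ((if p < P0 then K else 1) * ((p:ℝ) ^ (n.factorization p)) ^ ε) := by
        apply prod_le_prod
        · intros; positivity
        · intro p hp
          have hp2 : (2:ℝ) ≤ p := by exact_mod_cast (Nat.prime_of_mem_primeFactors hp).two_le
          set a := n.factorization p
          split_ifs with hlt
          · have b1 : ((2:ℝ)^a)^ε ≤ ((p:ℝ)^a)^ε := by gcongr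
            have b2 : 1 + a * (ε * Real.log 2) ≤ ((2:ℝ)^a)^ε := by
              rw [Real.rpow_def_of_pos (by positivity), Real.log_pow]
              have := Real.add_one_le_exp ((a:ℝ) * Real.log 2 * ε)
              linarith
            have ha : (0:ℝ) ≤ a := by positivity
            calc (a:ℝ) + 1 ≤ K * (1 + a * (ε * Real.log 2)) := by nlinarith
              _ ≤ _ := by gcongr; linarith
          · rw [one_mul]
            have b1 : (2:ℝ)^(1/ε) ≤ p := by
              push Not at hlt
              exact (Nat.le_ceil _).trans (by exact_mod_cast hlt)
            have b2 : (2:ℝ) ≤ (p:ℝ)^ε := by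
              calc (2:ℝ) = ((2:ℝ)^(1/ε))^ε := by
                    rw [← Real.rpow_mul (by norm_num)]; field_simp; simp
                _ ≤ _ := by gcongr
            have b3 : ((p:ℝ)^a)^ε = ((p:ℝ)^ε)^a := by
              rw [← Real.rpow_natCast, ← Real.rpow_natCast, ← Real.rpow_mul (by positivity),
                ← Real.rpow_mul (by positivity), mul_comm]
            rw [b3]
            calc (a:ℝ) + 1 ≤ (2:ℝ)^a := by exact_mod_cast Nat.lt_two_pow_self (n := a)
              _ ≤ _ := by gcongr
    _ = (∏ p ∈ n.primeFactors, (if p < P0 then K else 1)) * (n:ℝ)^ε := by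
        rw [prod_mul_distrib, e1]
    _ ≤ _ := by gcongr

end FI
end Part0

section Part1
open Matrix Finset

namespace FI

/-! ### Sums of monotone functions over arithmetic progressions -/

lemma Ioc_succ_eq {y Y : ℕ} (h : y ≤ Y) : Ioc y (Y+1) = insert (Y+1) (Ioc y Y) := by
  ext k; simp only [mem_Ioc, mem_insert]; omega

lemma sum_Ioc_succ {y Y : ℕ} (h : y ≤ Y) (f : ℕ → ℝ) :
    ∑ n ∈ Ioc y (Y+1), f n = f (Y+1) + ∑ n ∈ Ioc y Y, f n := by
  rw [Ioc_succ_eq h, sum_insert (by simp)]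

lemma abel_bound (f g : ℕ → ℝ) (B : ℝ) (y Y : ℕ) (hf0 : ∀ n, y < n → 0 ≤ f n)
    (hf : ∀ a b, y < a → a ≤ b → f b ≤ f a)
    (hg : ∀ Z, |∑ n ∈ Ioc y Z, g n| ≤ B) :
    |∑ n ∈ Ioc y Y, f n * g n| ≤ B * f (y+1) := by
  have hB : 0 ≤ B := (abs_nonneg _).trans (hg 0)
  rcases Nat.lt_or_ge y Y with hlt | hge
  · have key : ∀ Z, y + 1 ≤ Z → |∑ n ∈ Ioc y Z, f n * g n - f Z * ∑ n ∈ Ioc y Z, g n| ≤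
        B * (f (y+1) - f Z) := by
      intro Z hZ
      induction Z, hZ using Nat.le_induction with
      | base => simp [Ioc_succ_eq]
      | succ Z hZ ih =>
        rw [sum_Ioc_succ (by omega), sum_Ioc_succ (by omega)]
        have e : f (Z+1) * g (Z+1) + ∑ n ∈ Ioc y Z, f n * g n - f (Z+1) * (g (Z+1) + ∑ n ∈ Ioc y Z, g n)
          = (∑ n ∈ Ioc y Z, f n * g n - f Z * ∑ n ∈ Ioc y Z, g n) +
            (f Z - f (Z+1)) * ∑ n ∈ Ioc y Z, g n := by ring
        rw [e]
        have h1 : 0 ≤ f Z - f (Z+1) := by linarith [hf Z (Z+1) (by omega) (by omega)]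
        calc _ ≤ |∑ n ∈ Ioc y Z, f n * g n - f Z * ∑ n ∈ Ioc y Z, g n| +
            |(f Z - f (Z+1)) * ∑ n ∈ Ioc y Z, g n| := abs_add_le _ _
          _ ≤ B * (f (y+1) - f Z) + (f Z - f (Z+1)) * B := by
              rw [abs_mul, abs_of_nonneg h1]
              gcongr
              exact hg Z
          _ = _ := by ring
    have h1 := key Y hlt
    have h2 := hg Y
    have h3 := hf0 Y hlt
    calc _ = |(∑ n ∈ Ioc y Y, f n * g n - f Y * ∑ n ∈ Ioc y Y, g n) + f Y * ∑ n ∈ Ioc y Y, g n| := by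
          congr 1; ring
      _ ≤ _ := abs_add_le _ _
      _ ≤ B * (f (y+1) - f Y) + f Y * B := by
          rw [abs_mul, abs_of_nonneg h3]; gcongr
      _ = _ := by ring
  · rw [Ioc_eq_empty (by omega)]
    simp only [sum_empty, abs_zero]
    exact mul_nonneg hB (hf0 _ (by omega))

lemma ap_count (m c y Z : ℕ) (hm : 0 < m) :
    |∑ n ∈ Ioc y Z, ((m:ℝ) * (if n ≡ c [MOD m] then 1 else 0) - 1)| ≤ m := by
  have hmR : (0:ℝ) < m := by exact_mod_cast hm
  rcases Nat.lt_or_ge Z y with hlt | hge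
  · rw [Ioc_eq_empty (by omega)]; simp
  rw [sum_sub_distrib, ← mul_sum]
  simp only [sum_const, Nat.card_Ioc, nsmul_eq_mul, mul_one]
  rw [sum_boole]
  have h := Nat.Ioc_filter_modEq_card y Z hm c
  have h1 : ⌊((y:ℚ) - c) / m⌋ ≤ ⌊((Z:ℚ) - c) / m⌋ := by
    apply Int.floor_le_floor
    gcongr
  rw [max_eq_left (by linarith)] at h
  have a1 := Int.floor_le (((y:ℚ) - c) / m)
  have a2 := Int.lt_floor_add_one (((y:ℚ) - c) / m)
  have a3 := Int.floor_le (((Z:ℚ) - c) / m)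
  have a4 := Int.lt_floor_add_one (((Z:ℚ) - c) / m)
  have hq : ((#{x ∈ Ioc y Z | x ≡ c [MOD m]} : ℕ) : ℚ) = (⌊((Z:ℚ) - c) / m⌋ : ℚ) - (⌊((y:ℚ) - c) / m⌋ : ℚ) := by
    exact_mod_cast h
  set k := #{x ∈ Ioc y Z | x ≡ c [MOD m]}
  have hmQ : (0:ℚ) < m := by exact_mod_cast hm
  have b1 : (k:ℚ) ≤ ((Z:ℚ) - y) / m + 1 := by
    rw [hq]; have : ((Z:ℚ) - y) / m = ((Z:ℚ) - c) / m - ((y:ℚ) - c) / m := by ring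
    linarith
  have b2 : ((Z:ℚ) - y) / m - 1 ≤ (k:ℚ) := by
    rw [hq]; have : ((Z:ℚ) - y) / m = ((Z:ℚ) - c) / m - ((y:ℚ) - c) / m := by ring
    linarith
  have c1 : (m:ℚ) * k ≤ ((Z:ℚ) - y) + m := by
    have := mul_le_mul_of_nonneg_left b1 hmQ.le
    rw [mul_add, mul_div_cancel₀ _ hmQ.ne'] at this; linarith
  have c2 : ((Z:ℚ) - y) - m ≤ (m:ℚ) * k := by
    have := mul_le_mul_of_nonneg_left b2 hmQ.le
    rw [mul_sub, mul_div_cancel₀ _ hmQ.ne'] at this; linarith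
  have d1 : (m:ℝ) * k ≤ ((Z:ℝ) - y) + m := by exact_mod_cast c1
  have d2 : ((Z:ℝ) - y) - m ≤ (m:ℝ) * k := by exact_mod_cast c2
  rw [Nat.cast_sub hge, abs_le]
  constructor <;> linarith

lemma ap_sum (f : ℕ → ℝ) (m c y Y : ℕ) (hm : 0 < m) (hf0 : ∀ n, y < n → 0 ≤ f n)
    (hf : ∀ a b, y < a → a ≤ b → f b ≤ f a) :
    |∑ n ∈ Ioc y Y with n ≡ c [MOD m], f n - (1/m) * ∑ n ∈ Ioc y Y, f n| ≤ f (y+1) := by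
  have hmR : (0:ℝ) < m := by exact_mod_cast hm
  have h := abel_bound f (fun n => (m:ℝ) * (if n ≡ c [MOD m] then 1 else 0) - 1) m y Y hf0 hf
    (fun Z => ap_count m c y Z hm)
  have e : ∑ n ∈ Ioc y Y, f n * ((m:ℝ) * (if n ≡ c [MOD m] then 1 else 0) - 1) =
      m * (∑ n ∈ Ioc y Y with n ≡ c [MOD m], f n - (1/m) * ∑ n ∈ Ioc y Y, f n) := by
    rw [mul_sub, ← mul_assoc, mul_one_div_cancel hmR.ne', one_mul, sum_filter, mul_sum, ← sum_sub_distrib]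
    apply sum_congr rfl
    intro n _
    split_ifs <;> ring
  rw [e, abs_mul, abs_of_pos hmR] at h
  exact le_of_mul_le_mul_left h hmR

lemma harmonic_le {y Y : ℕ} (hy : 1 ≤ y) (h : y ≤ Y) :
    ∑ n ∈ Ioc y Y, (1:ℝ) / n ≤ Real.log Y - Real.log y := by
  induction Y, h using Nat.le_induction with
  | base => simp
  | succ Z hZ ih =>
    rw [sum_Ioc_succ hZ]
    have hZ0 : (0:ℝ) < Z := by exact_mod_cast (by omega : 0 < Z)
    have h1 : (1:ℝ) / ((Z+1:ℕ):ℝ) ≤ Real.log ((Z+1:ℕ):ℝ) - Real.log Z := by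
      have := Real.log_le_sub_one_of_pos (x := (Z:ℝ) / ((Z+1:ℕ):ℝ)) (by positivity)
      rw [Real.log_div (by positivity) (by positivity)] at this
      have h3 : (Z:ℝ) / ((Z+1:ℕ):ℝ) - 1 = - (1 / ((Z+1:ℕ):ℝ)) := by push_cast; field_simp; ring
      linarith
    linarith

lemma inv_ap (m c y Y : ℕ) (hm : 0 < m) :
    |∑ n ∈ Ioc y Y with n ≡ c [MOD m], (1:ℝ)/n - (1/m) * ∑ n ∈ Ioc y Y, (1:ℝ)/n| ≤ 1/(y+1) := by
  have := ap_sum (fun n => (1:ℝ)/n) m c y Y hm (fun n _ => by positivity) (fun a b h1 h2 => by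
    have : (0:ℝ) < a := by exact_mod_cast (by omega : 0 < a)
    gcongr)
  simpa using this

end FI
end Part1

section Part2
open Matrix Finset

namespace FI
open scoped ArithmeticFunction.Moebius

/-! ### Selberg's sieve and the Brun-Titchmarsh inequality -/

/-- Sum of reciprocals of integers composed of primes in `S`. -/
lemma sum_inv_le_prod (S F : Finset ℕ) (hS : ∀ p ∈ S, p.Prime) (hF : ∀ m ∈ F, m ≠ 0 ∧ m.primeFactors ⊆ S) :
    ∑ m ∈ F, (1:ℝ)/m ≤ ∏ p ∈ S, (1 - 1/(p:ℝ))⁻¹ := by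
  let f : ℕ →* ℝ := ⟨⟨fun n => ((n:ℝ))⁻¹, by simp⟩, by intro a b; simp [mul_comm]⟩
  have hf : ∀ n, f n = (n:ℝ)⁻¹ := fun n => rfl
  have h := EulerProduct.summable_and_hasSum_factoredNumbers_prod_filter_prime_geometric (f := f)
    (by intro p hp
        rw [hf, norm_inv, Real.norm_natCast]
        apply inv_lt_one_of_one_lt₀
        exact_mod_cast hp.one_lt) S
  rw [filter_true_of_mem hS] at h
  have h2 := h.2
  simp only [hf] at h2
  simp only [one_div]
  rw [← h2.tsum_eq]
  let F' : Finset (Nat.factoredNumbers S) := F.subtype (fun m => m ∈ Nat.factoredNumbers S)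
  have h3 : ∑ m ∈ F, ((m:ℝ))⁻¹ = ∑ m ∈ F', ((m:ℕ):ℝ)⁻¹ := by
    rw [sum_subtype_of_mem (fun m : ℕ => ((m:ℝ))⁻¹)]
    intro m hm
    rw [Nat.mem_factoredNumbers_iff_primeFactors_subset]
    exact hF m hm
  rw [h3]
  exact h2.summable.sum_le_tsum _ (fun m _ => by positivity)

lemma prod_primeFactors_inv {N : ℕ} (hN : N ≠ 0) :
    ∏ p ∈ N.primeFactors, (1 - 1/(p:ℝ))⁻¹ = N / (N.totient : ℝ) := by
  have h := Nat.totient_eq_mul_prod_factors N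
  have h' : (N.totient : ℝ) = N * ∏ p ∈ N.primeFactors, (1 - ((p:ℝ))⁻¹) := by
    have := congrArg (fun q : ℚ => (q:ℝ)) h
    push_cast at this
    exact this
  have hN' : (N:ℝ) ≠ 0 := by exact_mod_cast hN
  have ht : (N.totient : ℝ) ≠ 0 := by exact_mod_cast (Nat.totient_pos.2 (Nat.pos_of_ne_zero hN)).ne'
  rw [prod_inv_distrib]
  simp only [one_div]
  rw [h'] at ht ⊢
  field_simp

/-- index set of Selberg's sieve -/
def selI (k R : ℕ) : Finset ℕ := (Ioc 0 R).filter (fun l => Squarefree l ∧ l.Coprime k)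

noncomputable def selG (k R : ℕ) : ℝ := ∑ l ∈ selI k R, (1:ℝ) / l.totient

lemma mem_selI {k R l : ℕ} : l ∈ selI k R ↔ (0 < l ∧ l ≤ R) ∧ Squarefree l ∧ l.Coprime k := by
  simp [selI]

lemma selI_of_dvd {k R l d : ℕ} (hl : l ∈ selI k R) (hd : d ∣ l) : d ∈ selI k R := by
  rw [mem_selI] at *
  exact ⟨⟨Nat.pos_of_dvd_of_pos hd hl.1.1, (Nat.le_of_dvd hl.1.1 hd).trans hl.1.2⟩,
    hl.2.1.squarefree_of_dvd hd, hl.2.2.coprime_dvd_left hd⟩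

lemma selG_lower (k R : ℕ) (hk : 0 < k) (hR : 1 ≤ R) :
    Real.log R ≤ (k / (k.totient:ℝ)) * selG k R := by
  have h1 : Real.log R ≤ ∑ n ∈ Ioc 0 R, (1:ℝ)/n := by
    have := log_add_one_le_harmonic R
    rw [harmonic_eq_sum_Icc] at this
    push_cast at this
    have e : Icc 1 R = Ioc 0 R := by ext; simp [Nat.succ_le_iff]
    rw [e] at this
    simp only [one_div]
    refine le_trans ?_ this
    apply Real.log_le_log (by exact_mod_cast hR)
    linarith
  refine h1.trans ?_
  let φ : ℕ → ℕ := fun n => ∏ p ∈ n.primeFactors.filter (fun p => ¬ p ∣ k), p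
  have hpr : ∀ n : ℕ, ∀ p ∈ n.primeFactors.filter (fun p => ¬ p ∣ k), p.Prime := by
    intro n p hp
    exact Nat.prime_of_mem_primeFactors (mem_filter.1 hp).1
  have hdvd : ∀ n : ℕ, n ≠ 0 → φ n ∣ n := by
    intro n hn
    have : φ n ∣ ∏ p ∈ n.primeFactors, p := prod_dvd_prod_of_subset _ _ _ (filter_subset _ _)
    exact this.trans (Nat.prod_primeFactors_dvd n)
  have hpf : ∀ n : ℕ, (φ n).primeFactors = n.primeFactors.filter (fun p => ¬ p ∣ k) := by
    intro n
    exact Nat.primeFactors_prod (hpr n)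
  have hmaps : ∀ n ∈ Ioc 0 R, φ n ∈ selI k R := by
    intro n hn
    rw [mem_Ioc] at hn
    rw [mem_selI]
    have hd := hdvd n (by omega)
    refine ⟨⟨Nat.pos_of_dvd_of_pos hd hn.1, (Nat.le_of_dvd hn.1 hd).trans hn.2⟩, ?_, ?_⟩
    · apply Finset.squarefree_prod_of_pairwise_isCoprime
      · intro p hp q hq hpq
        rw [Function.onFun, ← Nat.coprime_iff_isRelPrime]
        exact (Nat.coprime_primes (hpr n p hp) (hpr n q hq)).2 hpq
      · intro p hp
        exact (hpr n p hp).squarefree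
    · apply Nat.Coprime.prod_left
      intro p hp
      exact ((hpr n p hp).coprime_iff_not_dvd).2 (mem_filter.1 hp).2
  rw [← sum_fiberwise_of_maps_to hmaps, selG, mul_sum]
  apply sum_le_sum
  intro l hl
  have hl' := mem_selI.1 hl
  have hl0 : l ≠ 0 := by omega
  have hlR : (0:ℝ) < l := by exact_mod_cast hl'.1.1
  set F := (Ioc 0 R).filter (fun n => φ n = l) with hF
  have hFd : ∀ n ∈ F, l ∣ n ∧ n ≠ 0 := by
    intro n hn
    rw [hF, mem_filter, mem_Ioc] at hn
    exact ⟨hn.2 ▸ hdvd n (by omega), by omega⟩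
  have e1 : ∑ n ∈ F, (1:ℝ)/n = (1/(l:ℝ)) * ∑ m ∈ F.image (fun n => n / l), (1:ℝ)/m := by
    rw [sum_image, mul_sum]
    · apply sum_congr rfl
      intro n hn
      obtain ⟨m, rfl⟩ := (hFd n hn).1
      rw [Nat.mul_div_cancel_left _ hl'.1.1]
      push_cast
      rw [one_div_mul_one_div]
    · intro a ha b hb hab
      obtain ⟨m, rfl⟩ := (hFd a ha).1
      obtain ⟨m', rfl⟩ := (hFd b hb).1
      simp only [Nat.mul_div_cancel_left _ hl'.1.1] at hab
      rw [hab]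
  have e2 : ∑ m ∈ F.image (fun n => n / l), (1:ℝ)/m ≤ ∏ p ∈ (l*k).primeFactors, (1 - 1/(p:ℝ))⁻¹ := by
    apply sum_inv_le_prod
    · intro p hp; exact Nat.prime_of_mem_primeFactors hp
    · intro m hm
      rw [mem_image] at hm
      obtain ⟨n, hn, rfl⟩ := hm
      have hd := hFd n hn
      have hnl : n / l ≠ 0 := (Nat.div_pos (Nat.le_of_dvd (by omega) hd.1) hl'.1.1).ne'
      refine ⟨hnl, ?_⟩
      intro p hp
      have hp1 := Nat.prime_of_mem_primeFactors hp
      have hp2 : p ∣ n := (Nat.dvd_of_mem_primeFactors hp).trans (Nat.div_dvd_of_dvd hd.1)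
      rw [Nat.mem_primeFactors]
      refine ⟨hp1, ?_, by positivity⟩
      by_cases hpk : p ∣ k
      · exact hpk.mul_left _
      · have : p ∈ (φ n).primeFactors := by
          rw [hpf, mem_filter]
          exact ⟨Nat.mem_primeFactors.2 ⟨hp1, hp2, hd.2⟩, hpk⟩
        have h5 : φ n = l := (mem_filter.1 hn).2
        rw [h5] at this
        exact (Nat.dvd_of_mem_primeFactors this).mul_right _
  rw [e1]
  rw [prod_primeFactors_inv (by positivity), Nat.totient_mul hl'.2.2] at e2
  have ht : (0:ℝ) < l.totient := by exact_mod_cast Nat.totient_pos.2 hl'.1.1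
  have ht' : (0:ℝ) < k.totient := by exact_mod_cast Nat.totient_pos.2 hk
  calc (1/(l:ℝ)) * ∑ m ∈ F.image (fun n => n / l), (1:ℝ)/m
      ≤ (1/(l:ℝ)) * (((l*k:ℕ):ℝ) / ((l.totient * k.totient : ℕ):ℝ)) := by gcongr
    _ = _ := by push_cast; field_simp

lemma inner_moebius (l e : ℕ) (hl : 0 < l) :
    ∑ d ∈ l.divisors with e ∣ d, (μ (l/d) : ℝ) = if l = e then 1 else 0 := by
  by_cases he : e ∣ l
  · obtain ⟨m, rfl⟩ := he
    have he0 : 0 < e := Nat.pos_of_mul_pos_right hl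
    have hm0 : 0 < m := Nat.pos_of_mul_pos_left hl
    have e1 : ((e*m).divisors.filter (fun d => e ∣ d)) = m.divisors.image (fun d => e * d) := by
      ext d
      simp only [mem_filter, Nat.mem_divisors, mem_image]
      constructor
      · rintro ⟨⟨h1, h2⟩, ⟨t, rfl⟩⟩
        exact ⟨t, ⟨Nat.dvd_of_mul_dvd_mul_left he0 h1, hm0.ne'⟩, rfl⟩
      · rintro ⟨t, ⟨h1, h2⟩, rfl⟩
        exact ⟨⟨Nat.mul_dvd_mul_left e h1, hl.ne'⟩, dvd_mul_right _ _⟩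
    rw [e1, sum_image (by intro a _ b _ h; exact Nat.eq_of_mul_eq_mul_left he0 h)]
    have e2 : ∑ d ∈ m.divisors, (μ (e * m / (e * d)) : ℝ) = ∑ d ∈ m.divisors, (μ (m / d) : ℝ) := by
      apply sum_congr rfl
      intro d _
      rw [Nat.mul_div_mul_left _ _ he0]
    rw [e2, Nat.sum_div_divisors m (fun d => (μ d : ℝ))]
    have h3 := ArithmeticFunction.coe_mul_zeta_apply (f := μ) (x := m)
    rw [ArithmeticFunction.moebius_mul_coe_zeta] at h3
    have h4 : (∑ d ∈ m.divisors, (μ d : ℝ)) = ((∑ d ∈ m.divisors, μ d : ℤ) : ℝ) := by push_cast; rfl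
    rw [h4, ← h3, ArithmeticFunction.one_apply]
    have : (e * m = e) ↔ m = 1 := by
      constructor
      · intro h; exact Nat.eq_of_mul_eq_mul_left he0 (by rw [h, mul_one])
      · rintro rfl; simp
    simp only [this]
    split_ifs <;> simp
  · rw [if_neg (by rintro rfl; exact he dvd_rfl)]
    apply sum_eq_zero
    intro d hd
    rw [mem_filter, Nat.mem_divisors] at hd
    exact absurd (hd.2.trans hd.1.1) he

noncomputable def selLam (k R d : ℕ) : ℝ :=
  d * ∑ l ∈ selI k R with d ∣ l, (μ l : ℝ) * μ (l/d) / l.totient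

lemma selU (k R e : ℕ) (he : e ∈ selI k R) :
    ∑ d ∈ selI k R with e ∣ d, selLam k R d / d = (μ e : ℝ) / e.totient := by
  have h1 : ∀ d ∈ (selI k R).filter (fun d => e ∣ d), selLam k R d / d =
      ∑ l ∈ selI k R, if d ∣ l then (μ l : ℝ) * μ (l/d) / l.totient else 0 := by
    intro d hd
    have : (d:ℝ) ≠ 0 := by
      have := (mem_selI.1 (mem_filter.1 hd).1).1.1
      exact_mod_cast this.ne'
    rw [selLam, sum_filter]; field_simp
  rw [sum_congr rfl h1, sum_comm]
  have h2 : ∀ l ∈ selI k R, ∑ d ∈ selI k R with e ∣ d,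
      (if d ∣ l then (μ l : ℝ) * μ (l/d) / l.totient else 0) =
      if l = e then (μ e : ℝ) / e.totient else 0 := by
    intro l hl
    have hl0 := (mem_selI.1 hl).1.1
    rw [← sum_filter, filter_filter]
    have : (selI k R).filter (fun d => e ∣ d ∧ d ∣ l) = l.divisors.filter (fun d => e ∣ d) := by
      ext d
      simp only [mem_filter, Nat.mem_divisors]
      constructor
      · rintro ⟨h1, h2, h3⟩; exact ⟨⟨h3, hl0.ne'⟩, h2⟩
      · rintro ⟨⟨h1, h2⟩, h3⟩; exact ⟨selI_of_dvd hl h1, h3, h1⟩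
    rw [this]
    have h4 := inner_moebius l e hl0
    have h5 : ∑ d ∈ l.divisors with e ∣ d, (μ l : ℝ) * μ (l/d) / l.totient =
      ((μ l : ℝ) / l.totient) * ∑ d ∈ l.divisors with e ∣ d, (μ (l/d) : ℝ) := by
      rw [mul_sum]; apply sum_congr rfl; intros; ring
    rw [h5, h4]
    split_ifs with h
    · rw [h, mul_one]
    · rw [mul_zero]
  rw [sum_congr rfl h2, sum_ite_eq' (selI k R) e, if_pos he]

lemma mu_sq_one {l : ℕ} (h : Squarefree l) : (μ l : ℝ) * μ l = 1 := by
  have h2 : (μ l : ℤ)^2 = 1 := ArithmeticFunction.moebius_sq_eq_one_of_squarefree h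
  have : ((μ l : ℤ) : ℝ)^2 = 1 := by exact_mod_cast h2
  rw [← sq]; exact this

lemma selQuad (k R : ℕ) :
    ∑ d ∈ selI k R, ∑ d' ∈ selI k R, selLam k R d * selLam k R d' / (Nat.lcm d d') = selG k R := by
  have h1 : ∀ d ∈ selI k R, ∀ d' ∈ selI k R,
      selLam k R d * selLam k R d' / (Nat.lcm d d') =
      ∑ e ∈ selI k R, (e.totient : ℝ) * ((if e ∣ d then selLam k R d / d else 0) *
        (if e ∣ d' then selLam k R d' / d' else 0)) := by
    intro d hd d' hd'
    have hd0 := (mem_selI.1 hd).1.1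
    have hd0' := (mem_selI.1 hd').1.1
    have hg : ((Nat.gcd d d' : ℕ) : ℝ) = ∑ e ∈ selI k R with (e ∣ d ∧ e ∣ d'), (e.totient : ℝ) := by
      conv_lhs => rw [← Nat.sum_totient (Nat.gcd d d')]
      push_cast
      apply sum_congr _ (fun _ _ => rfl)
      ext e
      simp only [Nat.mem_divisors, mem_filter, Nat.dvd_gcd_iff]
      constructor
      · rintro ⟨h1, h2⟩; exact ⟨selI_of_dvd hd h1.1, h1⟩
      · rintro ⟨h1, h2⟩; exact ⟨h2, (Nat.gcd_pos_of_pos_left _ hd0).ne'⟩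
    have hl : ((Nat.gcd d d' : ℕ) : ℝ) * (Nat.lcm d d' : ℕ) = d * d' := by
      exact_mod_cast Nat.gcd_mul_lcm d d'
    have hlc : ((Nat.lcm d d' : ℕ):ℝ) ≠ 0 := by
      exact_mod_cast (Nat.lcm_pos hd0 hd0').ne'
    have hdR : (d:ℝ) ≠ 0 := by exact_mod_cast hd0.ne'
    have hdR' : (d':ℝ) ≠ 0 := by exact_mod_cast hd0'.ne'
    have e1 : selLam k R d * selLam k R d' / (Nat.lcm d d') =
      ((Nat.gcd d d' : ℕ) : ℝ) * (selLam k R d / d * (selLam k R d' / d')) := by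
      field_simp
      linear_combination (-selLam k R d * selLam k R d') * hl
    rw [e1, hg, sum_mul, sum_filter]
    apply sum_congr rfl
    intro e _
    by_cases a : e ∣ d <;> by_cases b : e ∣ d' <;> simp [a, b]
  rw [sum_congr rfl (fun d hd => sum_congr rfl (fun d' hd' => h1 d hd d' hd'))]
  rw [sum_congr rfl (fun d hd => sum_comm), sum_comm, selG]
  apply sum_congr rfl
  intro e he
  have h2 : ∑ d ∈ selI k R, ∑ d' ∈ selI k R, (e.totient : ℝ) * ((if e ∣ d then selLam k R d / d else 0) *
        (if e ∣ d' then selLam k R d' / d' else 0)) =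
      e.totient * ((∑ d ∈ selI k R, if e ∣ d then selLam k R d / d else 0) *
        (∑ d ∈ selI k R, if e ∣ d then selLam k R d / d else 0)) := by
    rw [sum_mul_sum, mul_sum]
    apply sum_congr rfl
    intro d _
    rw [mul_sum]
  rw [h2, ← sum_filter, selU k R e he]
  have h0 := mem_selI.1 he
  have ht : (e.totient : ℝ) ≠ 0 := by exact_mod_cast (Nat.totient_pos.2 h0.1.1).ne'
  have := mu_sq_one h0.2.1
  field_simp
  linear_combination this

lemma selLam_one (k R : ℕ) : selLam k R 1 = selG k R := by
  rw [selLam, selG]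
  simp only [one_dvd, filter_true, Nat.div_one, Nat.cast_one, one_mul]
  apply sum_congr rfl
  intro l hl
  rw [mu_sq_one (mem_selI.1 hl).2.1]

lemma le_totient_mul_card (n : ℕ) (hn : 0 < n) : n ≤ n.totient * #n.divisors := by
  conv_lhs => rw [← Nat.sum_totient n]
  calc _ ≤ ∑ _d ∈ n.divisors, n.totient := by
        apply sum_le_sum
        intro d hd
        exact Nat.le_of_dvd (Nat.totient_pos.2 hn) (Nat.totient_dvd_of_dvd (Nat.dvd_of_mem_divisors hd))
    _ = _ := by rw [sum_const, smul_eq_mul, mul_comm]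

lemma selLam_sum (k R : ℕ) :
    ∑ d ∈ selI k R, |selLam k R d| ≤ ∑ l ∈ Ioc 0 R, (#l.divisors : ℝ)^2 := by
  have h1 : ∀ d ∈ selI k R, |selLam k R d| ≤ ∑ l ∈ selI k R, if d ∣ l then (d:ℝ) / l.totient else 0 := by
    intro d hd
    rw [← sum_filter, selLam, abs_mul, Nat.abs_cast]
    calc (d:ℝ) * |∑ l ∈ selI k R with d ∣ l, (μ l : ℝ) * μ (l/d) / l.totient|
        ≤ d * ∑ l ∈ selI k R with d ∣ l, 1 / (l.totient:ℝ) := by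
          gcongr
          refine (abs_sum_le_sum_abs _ _).trans ?_
          apply sum_le_sum
          intro l _
          rw [abs_div, abs_mul, Nat.abs_cast]
          have a1 : |(μ l : ℝ)| ≤ 1 := by exact_mod_cast ArithmeticFunction.abs_moebius_le_one (n := l)
          have a2 : |(μ (l/d) : ℝ)| ≤ 1 := by exact_mod_cast ArithmeticFunction.abs_moebius_le_one (n := l/d)
          gcongr
          nlinarith [abs_nonneg (μ l : ℝ), abs_nonneg (μ (l/d) : ℝ)]
      _ = _ := by rw [mul_sum]; apply sum_congr rfl; intros; ring
  refine (sum_le_sum h1).trans ?_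
  rw [sum_comm]
  calc _ ≤ ∑ l ∈ selI k R, (#l.divisors : ℝ)^2 := by
        apply sum_le_sum
        intro l hl
        have hl0 := (mem_selI.1 hl).1.1
        have ht : (0:ℝ) < l.totient := by exact_mod_cast Nat.totient_pos.2 hl0
        rw [← sum_filter]
        have h5 : ((l:ℕ):ℝ) ≤ l.totient * #l.divisors := by exact_mod_cast le_totient_mul_card l hl0
        calc _ ≤ ∑ d ∈ selI k R with d ∣ l, (#l.divisors : ℝ) := by
              apply sum_le_sum
              intro d hd
              rw [div_le_iff₀ ht]
              have : (d:ℝ) ≤ l := by exact_mod_cast Nat.le_of_dvd hl0 (mem_filter.1 hd).2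
              linarith
          _ = #((selI k R).filter (fun d => d ∣ l)) * (#l.divisors : ℝ) := by rw [sum_const, nsmul_eq_mul]
          _ ≤ #l.divisors * (#l.divisors : ℝ) := by
              gcongr
              intro d hd
              rw [Nat.mem_divisors]; exact ⟨(mem_filter.1 hd).2, hl0.ne'⟩
          _ = _ := by ring
    _ ≤ _ := by
        apply sum_le_sum_of_subset_of_nonneg (filter_subset _ _)
        intros; positivity

end FI
end Part2

section Part3
open Matrix Finset

namespace FI
open scoped ArithmeticFunction.Moebius

noncomputable def selF (k R n : ℕ) : ℝ := ∑ d ∈ selI k R with d ∣ n, selLam k R d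

lemma selF_prime (k R p : ℕ) (hR : 1 ≤ R) (hp : p.Prime) (hpR : R < p) : selF k R p = selG k R := by
  have : (selI k R).filter (fun d => d ∣ p) = {1} := by
    ext d
    simp only [mem_filter, mem_selI, mem_singleton]
    constructor
    · rintro ⟨⟨⟨h1, h2⟩, h3⟩, h4⟩
      rcases (Nat.dvd_prime hp).1 h4 with h | h
      · exact h
      · omega
    · rintro rfl
      simp [hR]
  rw [selF, this, sum_singleton, selLam_one]

lemma selF_sq_sum (k R c y Y : ℕ) (hk : 0 < k) :
    ∑ n ∈ Ioc y Y with n ≡ c [MOD k], (selF k R n)^2 / n ≤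
      ((∑ n ∈ Ioc y Y, (1:ℝ)/n) / k) * selG k R + (∑ d ∈ selI k R, |selLam k R d|)^2 / (y+1) := by
  set W : ℝ := ∑ n ∈ Ioc y Y, (1:ℝ)/n with hW
  have h1 : ∀ n : ℕ, (selF k R n)^2 / n = ∑ d ∈ selI k R, ∑ d' ∈ selI k R,
      if d.lcm d' ∣ n then selLam k R d * selLam k R d' * (1/n) else 0 := by
    intro n
    rw [selF, sq, sum_filter, sum_mul_sum, sum_div]
    apply sum_congr rfl
    intro d _
    rw [sum_div]
    apply sum_congr rfl
    intro d' _
    simp only [Nat.lcm_dvd_iff]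
    by_cases a : d ∣ n <;> by_cases b : d' ∣ n <;> simp [a, b, div_eq_mul_inv]
  rw [sum_congr rfl (fun n _ => h1 n), sum_comm, sum_congr rfl (fun d _ => sum_comm)]
  have h2 : ∀ d ∈ selI k R, ∀ d' ∈ selI k R,
      ∑ n ∈ Ioc y Y with n ≡ c [MOD k], (if d.lcm d' ∣ n then selLam k R d * selLam k R d' * (1/(n:ℝ)) else 0)
      ≤ (W / k) * (selLam k R d * selLam k R d' / (Nat.lcm d d')) +
        |selLam k R d| * |selLam k R d'| * (1 / (y+1)) := by
    intro d hd d' hd'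
    have hd1 := mem_selI.1 hd
    have hd1' := mem_selI.1 hd'
    have hl0 : 0 < d.lcm d' := Nat.lcm_pos hd1.1.1 hd1'.1.1
    have hcop : k.Coprime (d.lcm d') :=
      Nat.Coprime.coprime_dvd_right (Nat.lcm_dvd_mul d d')
        (Nat.Coprime.mul_right hd1.2.2.symm hd1'.2.2.symm)
    obtain ⟨e, he1, he2⟩ := Nat.chineseRemainder hcop c 0
    have h3 : ∑ n ∈ Ioc y Y with n ≡ c [MOD k], (if d.lcm d' ∣ n then selLam k R d * selLam k R d' * (1/(n:ℝ)) else 0)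
        = selLam k R d * selLam k R d' * ∑ n ∈ Ioc y Y with n ≡ e [MOD (k * d.lcm d')], (1:ℝ)/n := by
      rw [← sum_filter, filter_filter, mul_sum]
      apply sum_congr _ (fun _ _ => rfl)
      ext n
      simp only [mem_filter, and_congr_right_iff]
      intro _
      rw [← Nat.modEq_and_modEq_iff_modEq_mul hcop]
      constructor
      · rintro ⟨a, b⟩
        exact ⟨a.trans he1.symm, ((Nat.modEq_zero_iff_dvd).2 b).trans he2.symm⟩
      · rintro ⟨a, b⟩
        exact ⟨a.trans he1, (Nat.modEq_zero_iff_dvd).1 (b.trans he2)⟩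
    rw [h3]
    have h4 := inv_ap (k * d.lcm d') e y Y (by positivity)
    rw [← hW] at h4
    set V : ℝ := ∑ n ∈ Ioc y Y with n ≡ e [MOD (k * d.lcm d')], (1:ℝ)/n
    set x := selLam k R d * selLam k R d'
    have h5 : x * (V - 1 / ((k * d.lcm d' : ℕ):ℝ) * W) ≤ |x| * (1/(y+1)) := by
      refine (le_abs_self _).trans ?_
      rw [abs_mul]
      gcongr
    rw [← abs_mul]
    have h6 : W / k * (x / (d.lcm d' : ℕ)) = x * (1 / ((k * d.lcm d' : ℕ):ℝ) * W) := by
      have : (k:ℝ) ≠ 0 := by exact_mod_cast hk.ne'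
      have : ((d.lcm d' : ℕ):ℝ) ≠ 0 := by exact_mod_cast hl0.ne'
      push_cast; field_simp
    rw [h6]
    linarith
  refine (sum_le_sum (fun d hd => sum_le_sum (fun d' hd' => h2 d hd d' hd'))).trans ?_
  simp only [sum_add_distrib, ← mul_sum, selQuad, ← sum_mul]
  rw [← sq]
  apply le_of_eq
  ring

noncomputable def tauS (R : ℕ) : ℝ := ∑ l ∈ Ioc 0 R, (#l.divisors : ℝ)^2

lemma tauS_nonneg (R : ℕ) : 0 ≤ tauS R := sum_nonneg (fun _ _ => by positivity)

lemma bt_ap (k R c y Y : ℕ) (hk : 0 < k) (hR : 2 ≤ R) (hRy : R ≤ y) :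
    ∑ p ∈ Ioc y Y with p.Prime ∧ p ≡ c [MOD k], (1:ℝ)/p ≤
      (∑ n ∈ Ioc y Y, (1:ℝ)/n) / (k.totient * Real.log R) +
      (tauS R)^2 * (k / k.totient)^2 / (y * (Real.log R)^2) := by
  set W : ℝ := ∑ n ∈ Ioc y Y, (1:ℝ)/n with hW
  have hW0 : 0 ≤ W := sum_nonneg (fun _ _ => by positivity)
  have h1 := selF_sq_sum k R c y Y hk
  rw [← hW] at h1
  have hlR : 0 < Real.log R := Real.log_pos (by exact_mod_cast hR)
  have hG := selG_lower k R hk (by omega)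
  have ht : (0:ℝ) < k.totient := by exact_mod_cast Nat.totient_pos.2 hk
  have hkR : (0:ℝ) < k := by exact_mod_cast hk
  have hyR : (0:ℝ) < y := by exact_mod_cast (by omega : 0 < y)
  have hG0 : 0 < selG k R := by
    by_contra hcon
    push Not at hcon
    have : (k / (k.totient:ℝ)) * selG k R ≤ 0 := mul_nonpos_of_nonneg_of_nonpos (by positivity) hcon
    linarith
  have h2 : (selG k R)^2 * ∑ p ∈ Ioc y Y with p.Prime ∧ p ≡ c [MOD k], (1:ℝ)/p ≤
      ∑ n ∈ Ioc y Y with n ≡ c [MOD k], (selF k R n)^2 / n := by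
    rw [mul_sum]
    calc _ = ∑ n ∈ Ioc y Y with n.Prime ∧ n ≡ c [MOD k], (selF k R n)^2 / n := by
          apply sum_congr rfl
          intro p hp
          rw [mem_filter, mem_Ioc] at hp
          rw [selF_prime k R p (by omega) hp.2.1 (by omega)]
          ring
      _ ≤ _ := by
          apply sum_le_sum_of_subset_of_nonneg
          · intro n hn
            rw [mem_filter] at hn ⊢
            exact ⟨hn.1, hn.2.2⟩
          · intros; positivity
  have hS := selLam_sum k R
  rw [← tauS] at hS
  have hS1 := tauS_nonneg R
  generalize tauS R = S at *
  set P : ℝ := ∑ p ∈ Ioc y Y with p.Prime ∧ p ≡ c [MOD k], (1:ℝ)/p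
  clear_value W P
  have hS0 : 0 ≤ ∑ d ∈ selI k R, |selLam k R d| := sum_nonneg (fun _ _ => abs_nonneg _)
  have h3 : (selG k R)^2 * P ≤ W / k * selG k R + S^2 / y := by
    refine (h2.trans h1).trans ?_
    have : (∑ d ∈ selI k R, |selLam k R d|)^2 / ((y:ℝ)+1) ≤ S^2 / y := by
      apply div_le_div₀ (by positivity) (pow_le_pow_left₀ hS0 hS 2) hyR (by linarith)
    linarith
  have h4 : P ≤ W / (k * selG k R) + S^2 / (y * (selG k R)^2) := by
    have : W / (k * selG k R) + S^2 / (y * (selG k R)^2) = (W / k * selG k R + S^2 / y) / (selG k R)^2 := by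
      field_simp
    rw [this, le_div_iff₀ (by positivity)]
    linarith
  refine h4.trans ?_
  have h5 : Real.log R * k.totient ≤ k * selG k R := by
    calc Real.log R * k.totient ≤ ((k / (k.totient:ℝ)) * selG k R) * k.totient := by gcongr
      _ = _ := by field_simp
  have h6 : Real.log R / (k / k.totient) ≤ selG k R := by
    rw [div_le_iff₀ (by positivity)]; linarith
  gcongr ?_ + ?_
  · apply div_le_div_of_nonneg_left hW0 (by positivity)
    linarith
  · calc S^2 / (y * (selG k R)^2) ≤ S^2 / (y * (Real.log R / (k / k.totient))^2) := by gcongr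
      _ = _ := by field_simp

/-! ### abstract quadratic characters -/

structure SignChar (D : ℕ) (χ : ℕ → ℤ) : Prop where
  pos : 0 < D
  mul : ∀ a b, χ (a * b) = χ a * χ b
  val : ∀ a, χ a = 0 ∨ χ a = 1 ∨ χ a = -1
  per : ∀ a, χ (a % D) = χ a
  zero : ∀ a, χ a ≠ 0 ↔ a.Coprime D

def cong (χ : ℕ → ℤ) (q n : ℕ) : Prop := (q:ℤ) ∣ χ n * n - 1

instance (χ : ℕ → ℤ) (q n : ℕ) : Decidable (cong χ q n) := by unfold cong; infer_instance

lemma SignChar.congD {D : ℕ} {χ : ℕ → ℤ} (h : SignChar D χ) {a b : ℕ} (hab : a ≡ b [MOD D]) : χ a = χ b := by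
  rw [← h.per a, ← h.per b, hab]

lemma SignChar.sq {D : ℕ} {χ : ℕ → ℤ} (h : SignChar D χ) {a : ℕ} (ha : χ a ≠ 0) : χ a * χ a = 1 := by
  rcases h.val a with h | h | h
  · exact absurd h ha
  · rw [h]; norm_num
  · rw [h]; norm_num

lemma cong_ne {χ : ℕ → ℤ} {q n : ℕ} (hq : 1 < q) (h : cong χ q n) : χ n ≠ 0 := by
  intro h0
  rw [cong, h0] at h
  have : (q:ℤ) ∣ 1 := by
    have := h.neg_right
    simpa using this
  have := Int.le_of_dvd one_pos this
  omega

lemma cong_iff {D : ℕ} {χ : ℕ → ℤ} (h : SignChar D χ) {q n : ℕ} (hn : χ n ≠ 0) :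
    cong χ q n ↔ (q:ℤ) ∣ n - χ n := by
  have h1 := h.sq hn
  unfold cong
  constructor
  · intro h2
    have := h2.mul_left (χ n)
    have e : χ n * (χ n * n - 1) = n - χ n := by linear_combination (n:ℤ) * h1
    rwa [e] at this
  · intro h2
    have := h2.mul_left (χ n)
    have e : χ n * (n - χ n) = χ n * n - 1 := by linear_combination - h1
    rwa [e] at this

/-- cong is, within a class mod D, a single class mod q -/
lemma cong_class {D : ℕ} {χ : ℕ → ℤ} (h : SignChar D χ) {q : ℕ} (hqD : q.Coprime D) (hq : 0 < q)
    (c : ℕ) (hc : χ c ≠ 0) (ξ : ℤ) :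
    ∃ e : ℕ, ∀ n : ℕ, (n ≡ e [MOD (q * D)] ↔ ((q:ℤ) ∣ χ n * n - ξ ∧ n ≡ c [MOD D])) := by
  obtain ⟨e, he1, he2⟩ := Nat.chineseRemainder hqD ((χ c * ξ) % q).toNat c
  refine ⟨e, fun n => ?_⟩
  rw [← Nat.modEq_and_modEq_iff_modEq_mul hqD, and_congr_left_iff.2]
  · exact ⟨fun h => ⟨h.1, h.2.trans he2⟩, fun h => ⟨h.1, h.2.trans he2.symm⟩⟩
  intro hn
  have hχ : χ n = χ c := h.congD (hn.trans he2)
  have hsq := h.sq hc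
  have hq' : ((q:ℕ):ℤ) ≠ 0 := by exact_mod_cast hq.ne'
  have e1 : ((((χ c * ξ) % q).toNat : ℕ) : ℤ) ≡ χ c * ξ [ZMOD q] := by
    rw [Int.toNat_of_nonneg (Int.emod_nonneg _ hq')]
    exact Int.mod_modEq _ _
  have e2 : (n ≡ e [MOD q]) ↔ (n:ℤ) ≡ χ c * ξ [ZMOD q] := by
    rw [← Int.natCast_modEq_iff]
    have e3 : (e:ℤ) ≡ χ c * ξ [ZMOD q] := (Int.natCast_modEq_iff.2 he1).trans e1
    exact ⟨fun h => h.trans e3, fun h => h.trans e3.symm⟩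
  rw [e2, hχ, Int.modEq_comm, Int.modEq_iff_dvd]
  constructor
  · intro h2
    have := h2.mul_left (χ c)
    have e : χ c * (n - χ c * ξ) = χ c * n - ξ := by linear_combination - ξ * hsq
    rwa [e] at this
  · intro h2
    have := h2.mul_left (χ c)
    have e : χ c * (χ c * n - ξ) = n - χ c * ξ := by linear_combination n * hsq
    rwa [e] at this

def unitsD (D : ℕ) : Finset ℕ := (range D).filter (fun c => c.Coprime D)

lemma card_unitsD (D : ℕ) : #(unitsD D) = D.totient := by
  rw [Nat.totient_eq_card_coprime, unitsD]
  congr 1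
  ext c
  simp [Nat.coprime_comm]

/-- splitting a sum supported on χ ≠ 0 into classes mod D -/
lemma sum_classes {D : ℕ} {χ : ℕ → ℤ} (h : SignChar D χ) (F : Finset ℕ) (f : ℕ → ℝ) (hF : ∀ n ∈ F, χ n ≠ 0) :
    ∑ n ∈ F, f n = ∑ c ∈ unitsD D, ∑ n ∈ F with n ≡ c [MOD D], f n := by
  rw [← sum_fiberwise_of_maps_to (g := fun n => n % D) (t := unitsD D)]
  · apply sum_congr rfl
    intro c hc
    apply sum_congr _ (fun _ _ => rfl)
    ext n
    simp only [unitsD, mem_filter, mem_range] at hc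
    simp only [mem_filter, Nat.ModEq, Nat.mod_eq_of_lt hc.1]
  · intro n hn
    simp only [unitsD, mem_filter, mem_range]
    refine ⟨Nat.mod_lt _ h.pos, ?_⟩
    rw [← h.zero, h.per]
    exact hF n hn

lemma bt_signed0 {D : ℕ} {χ : ℕ → ℤ} (h : SignChar D χ) (q R y Y : ℕ) (hq : q.Prime) (hqD : ¬ q ∣ D)
    (hR : 2 ≤ R) (hRy : R ≤ y) :
    ∑ p ∈ Ioc y Y with p.Prime ∧ cong χ q p, (1:ℝ)/p ≤
      (∑ n ∈ Ioc y Y, (1:ℝ)/n) / ((q-1) * Real.log R) +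
      D * ((tauS R)^2 * (#(q*D).divisors)^2 / (y * (Real.log R)^2)) := by
  have hcop : q.Coprime D := (hq.coprime_iff_not_dvd).2 hqD
  rw [sum_classes h _ _ (fun n hn => cong_ne hq.one_lt (mem_filter.1 hn).2.2)]
  have hD := h.pos
  have hk : 0 < q * D := Nat.mul_pos hq.pos hD
  have hlR : 0 < Real.log R := Real.log_pos (by exact_mod_cast hR)
  have hyR : (0:ℝ) < y := by exact_mod_cast (by omega : 0 < y)
  have ht : (0:ℝ) < (q*D).totient := by exact_mod_cast Nat.totient_pos.2 hk
  have h1 : ∀ c ∈ unitsD D, ∑ n ∈ (Ioc y Y).filter (fun p => p.Prime ∧ cong χ q p) with n ≡ c [MOD D], (1:ℝ)/n ≤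
      (∑ n ∈ Ioc y Y, (1:ℝ)/n) / ((q*D).totient * Real.log R) +
      (tauS R)^2 * (#(q*D).divisors)^2 / (y * (Real.log R)^2) := by
    intro c hc
    have hc' : χ c ≠ 0 := by
      rw [h.zero]; exact (mem_filter.1 hc).2
    obtain ⟨e, he⟩ := cong_class h hcop hq.pos c hc' 1
    have h2 := bt_ap (q*D) R e y Y hk hR hRy
    have h3 : (((Ioc y Y).filter (fun p => p.Prime ∧ cong χ q p)).filter (fun n => n ≡ c [MOD D])) =
        (Ioc y Y).filter (fun p => p.Prime ∧ p ≡ e [MOD (q*D)]) := by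
      ext n
      rw [mem_filter, mem_filter, mem_filter, he, cong]; tauto
    rw [h3]
    refine h2.trans ?_
    have h4 : (((q*D:ℕ):ℝ) / (q*D).totient) ≤ #(q*D).divisors := by
      rw [div_le_iff₀ ht]
      have := le_totient_mul_card (q*D) hk
      have h5 : ((q*D:ℕ):ℝ) ≤ (((q*D).totient * #(q*D).divisors : ℕ) : ℝ) := Nat.cast_le.2 this
      rw [Nat.cast_mul ((q*D).totient)] at h5
      linarith
    apply add_le_add le_rfl
    apply div_le_div_of_nonneg_right _ (by positivity)
    apply mul_le_mul_of_nonneg_left _ (by positivity)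
    exact pow_le_pow_left₀ (by positivity) h4 2
  refine (sum_le_sum h1).trans ?_
  rw [sum_const, nsmul_eq_mul, card_unitsD, mul_add]
  have htD : (0:ℝ) < D.totient := by exact_mod_cast Nat.totient_pos.2 hD
  have hle : (D.totient:ℝ) ≤ D := by exact_mod_cast Nat.totient_le D
  apply add_le_add
  · rw [Nat.totient_mul hcop, Nat.totient_prime hq, Nat.cast_mul, Nat.cast_sub hq.one_lt.le]
    have hq1 : (1:ℝ) < q := by exact_mod_cast hq.one_lt
    have : (q:ℝ) - 1 > 0 := by linarith
    apply le_of_eq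
    push_cast
    field_simp
  · exact mul_le_mul_of_nonneg_right hle (by positivity)
end FI
end Part3

section Part4
open Matrix Finset

namespace FI
open Filter

lemma ev_log (B : ℝ) : ∀ᶠ y : ℕ in atTop, B ≤ Real.log y :=
  (Real.tendsto_log_atTop.comp tendsto_natCast_atTop_atTop).eventually_ge_atTop B

lemma ev_small (K c : ℝ) (hc : 0 < c) (n : ℕ) : ∀ᶠ y : ℕ in atTop, K * (Real.log y)^n ≤ (y:ℝ)^c := by
  have h := isLittleO_log_rpow_rpow_atTop (n:ℝ) hc
  have h1 := h.bound (c := (|K|+1)⁻¹) (by positivity)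
  have h2 := (tendsto_natCast_atTop_atTop (R := ℝ)).eventually h1
  filter_upwards [h2, ev_log 0, eventually_ge_atTop 1] with y h3 h4 h5
  have hy : (0:ℝ) < y := by exact_mod_cast h5
  simp only [Real.rpow_natCast] at h3
  rw [Real.norm_of_nonneg (by positivity), Real.norm_of_nonneg (by positivity)] at h3
  have h6 : (|K|+1) * (Real.log y)^n ≤ (y:ℝ)^c := by
    calc (|K|+1) * (Real.log y)^n ≤ (|K|+1) * ((|K|+1)⁻¹ * (y:ℝ)^c) := by gcongr
      _ = _ := by field_simp
  refine le_trans ?_ h6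
  gcongr
  linarith [le_abs_self K]

lemma tauS_bound (ν : ℝ) (hν : 0 < ν) : ∃ C : ℝ, 1 ≤ C ∧ ∀ R : ℕ, tauS R ≤ C * (R:ℝ)^(1 + 2*ν) := by
  obtain ⟨C, hC, h⟩ := divisor_bound ν hν
  refine ⟨C^2, by nlinarith, fun R => ?_⟩
  rcases Nat.eq_zero_or_pos R with h0 | h0
  · subst h0; simp [tauS]; positivity
  have hR : (0:ℝ) < R := by exact_mod_cast h0
  calc tauS R ≤ ∑ l ∈ Ioc 0 R, (C * (R:ℝ)^ν)^2 := by
        apply sum_le_sum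
        intro l hl
        rw [mem_Ioc] at hl
        have : (l:ℝ) ≤ R := by exact_mod_cast hl.2
        apply pow_le_pow_left₀ (by positivity)
        refine (h l).trans ?_
        gcongr
    _ = R * (C * (R:ℝ)^ν)^2 := by simp
    _ = C^2 * (R:ℝ)^(1+2*ν) := by
        rw [Real.rpow_add hR, Real.rpow_one, mul_pow, mul_comm 2 ν, Real.rpow_mul hR.le]
        norm_num
        ring

set_option maxHeartbeats 1600000 in
lemma bt_signed {D : ℕ} {χ : ℕ → ℤ} (h : SignChar D χ) (σ e : ℝ) (hσ0 : 0 < σ) (hσ : σ < 1) (he0 : 0 < e) (he : e < 1) :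
    ∀ᶠ y : ℕ in atTop, ∀ Y : ℕ, y ≤ Y → ∀ q : ℕ, q.Prime → ¬ q ∣ D → (q:ℝ) ≤ (y:ℝ)^σ →
      ∑ p ∈ Ioc y Y with p.Prime ∧ cong χ q p, (1:ℝ)/p ≤
      (1/((q:ℝ)-1)) * (2 * (1+e) * (Real.log Y - Real.log y) / (Real.log y - Real.log q) + 1 / Real.log y) := by
  set e' := e / 8 with he'
  set ν := e' * (1-σ) / 8 with hν
  have he'0 : 0 < e' := by positivity
  have hσ1 : 0 < 1 - σ := by linarith
  have hν0 : 0 < ν := by positivity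
  clear_value ν
  clear_value e'
  obtain ⟨C1, hC1, hS⟩ := tauS_bound ν hν0
  obtain ⟨C2, hC2, hT⟩ := divisor_bound ν hν0
  have hD := h.pos
  have hDR : (0:ℝ) < D := by exact_mod_cast hD
  set K : ℝ := D * (C1^2 * (C2 * (D:ℝ)^ν)^2) with hK
  have hK0 : 0 < K := by positivity
  clear_value K
  filter_upwards [ev_log 1, ev_small K (e'*(1-σ)/2) (by positivity) 1,
    ev_log (Real.log 2 / (e'/2) / (1-σ)), ev_log (4/(1-σ)), eventually_ge_atTop 2] with y hy1 hy2 hy3 hy4 hy5 Y hyY q hq hqD hqy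
  have hyR : (0:ℝ) < y := by exact_mod_cast (by omega : 0 < y)
  have hqR : (0:ℝ) < q := by exact_mod_cast hq.pos
  set L := Real.log y with hL
  have hlq : Real.log q ≤ σ * L := by
    have := Real.log_le_log hqR hqy
    rwa [Real.log_rpow hyR] at this
  set u : ℝ := y / q with hu
  have hu0 : 0 < u := by positivity
  clear_value u
  have hlu : Real.log u = L - Real.log q := by rw [hu, Real.log_div hyR.ne' hqR.ne']
  have hlu1 : (1-σ) * L ≤ Real.log u := by rw [hlu]; linarith
  have hlu4 : 4 ≤ Real.log u := by
    rw [div_le_iff₀ hσ1] at hy4; linarith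
  have hlu2 : Real.log 2 ≤ e'/2 * Real.log u := by
    rw [div_le_iff₀ hσ1, div_le_iff₀ (by positivity)] at hy3
    have := mul_le_mul_of_nonneg_left hlu1 (by positivity : 0 ≤ e'/2); linarith
  have he'8 : e' < 1/8 := by rw [he']; linarith
  set r : ℝ := u ^ ((1-e')/2) with hr
  have hr0 : 0 < r := by positivity
  clear_value r
  have hlr : Real.log r = (1-e')/2 * Real.log u := by rw [hr, Real.log_rpow hu0]
  have hlr1 : 7/4 ≤ Real.log r := by rw [hlr]; have := mul_le_mul (show (7/16:ℝ) ≤ (1-e')/2 by linarith) hlu4 (by norm_num) (by linarith); linarith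
  have hr2 : 2 ≤ r := by
    by_contra hcon
    push Not at hcon
    have : Real.log r < r := by
      have := Real.log_le_sub_one_of_pos hr0
      linarith
    have := Real.log_lt_log hr0 hcon
    have := Real.log_two_lt_d9
    linarith
  set R := ⌊r⌋₊ with hRdef
  clear_value R
  have hR2 : 2 ≤ R := hRdef ▸ Nat.le_floor (by exact_mod_cast hr2)
  have hRr : (R:ℝ) ≤ r := hRdef ▸ Nat.floor_le hr0.le
  have hRr' : r / 2 ≤ R := by
    have := Nat.lt_floor_add_one r
    rw [← hRdef] at this
    linarith
  have hRR : (0:ℝ) < R := by exact_mod_cast (by omega : 0 < R)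
  have hlR : (1-2*e')/2 * Real.log u ≤ Real.log R := by
    have := Real.log_le_log (by positivity) hRr'
    rw [Real.log_div hr0.ne' (by norm_num), hlr] at this
    linarith
  have hlR1 : 1 ≤ Real.log R := by have := mul_le_mul (show (3/8:ℝ) ≤ (1-2*e')/2 by linarith) hlu4 (by norm_num) (by linarith); linarith
  have hq1 : (1:ℝ) ≤ q := by exact_mod_cast hq.one_lt.le
  have hq2 : (1:ℝ) < q := by exact_mod_cast hq.one_lt
  have huy : u ≤ y := by rw [hu]; exact div_le_self hyR.le hq1
  have hu1 : 1 ≤ u := by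
    by_contra hcon
    push Not at hcon
    have := Real.log_nonpos hu0.le hcon.le
    linarith
  have hRy : R ≤ y := by
    have h1 : r ≤ u := by
      rw [hr]
      calc u ^ ((1-e')/2) ≤ u ^ (1:ℝ) := Real.rpow_le_rpow_of_exponent_le hu1 (by linarith)
        _ = u := Real.rpow_one u
    exact_mod_cast (hRr.trans (h1.trans huy))
  refine (bt_signed0 h q R y Y hq hqD hR2 hRy).trans ?_
  have hq10 : (0:ℝ) < q - 1 := by linarith
  rw [mul_add]
  have hW := harmonic_le (y := y) (Y := Y) (by omega) hyY
  have hlY : L ≤ Real.log Y := Real.log_le_log hyR (by exact_mod_cast hyY)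
  apply add_le_add
  · rw [← hlu]
    calc (∑ n ∈ Ioc y Y, (1:ℝ)/n) / ((q-1) * Real.log R) ≤ (Real.log Y - L) / ((q-1) * ((1-2*e')/2 * Real.log u)) := by
          apply div_le_div₀ (by linarith) hW
          · have : 0 < 1 - 2 * e' := by linarith
            positivity
          · gcongr
      _ = (1/((q:ℝ)-1)) * ((Real.log Y - L) / Real.log u * (2 / (1-2*e'))) := by
          have : 1 - 2 * e' ≠ 0 := by linarith
          have : Real.log u ≠ 0 := by linarith
          field_simp
      _ ≤ (1/((q:ℝ)-1)) * ((Real.log Y - L) / Real.log u * (2 * (1+e))) := by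
          have h1 : 0 ≤ Real.log Y - L := by linarith
          have h2 : 0 < Real.log u := by linarith
          have h3 : 2 / (1-2*e') ≤ 2 * (1+e) := by
            rw [div_le_iff₀ (by linarith), he']; have := mul_pos he0 (sub_pos.2 he); linarith
          gcongr
      _ = _ := by ring
  · have hS1 : tauS R ≤ C1 * r^(1+2*ν) := by
      refine (hS R).trans ?_
      gcongr
    have hT1 : ((#(q*D).divisors : ℕ):ℝ) ≤ C2 * ((D:ℝ)^ν * (q:ℝ)^ν) := by
      refine (hT (q*D)).trans ?_
      push_cast
      rw [Real.mul_rpow hqR.le hDR.le, mul_comm ((q:ℝ)^ν)]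
    have hS0 := tauS_nonneg R
    calc (D:ℝ) * ((tauS R)^2 * ((#(q*D).divisors : ℕ):ℝ)^2 / (y * (Real.log R)^2))
        ≤ D * ((C1 * r^(1+2*ν))^2 * (C2 * ((D:ℝ)^ν * (q:ℝ)^ν))^2 / (y * 1^2)) := by
          gcongr
      _ = K * (r^(1+2*ν))^2 * ((q:ℝ)^ν)^2 / y := by rw [hK]; ring
      _ ≤ K * (u^(1 - e' + 2*ν)) * (y:ℝ)^(2*ν) / y := by
          have a1 : (r^(1+2*ν))^2 ≤ u^(1 - e' + 2*ν) := by
            rw [hr, ← Real.rpow_mul hu0.le, ← Real.rpow_natCast, ← Real.rpow_mul hu0.le]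
            apply Real.rpow_le_rpow_of_exponent_le hu1
            push_cast
            have := mul_pos hν0 he'0; linarith
          have a2 : ((q:ℝ)^ν)^2 ≤ (y:ℝ)^(2*ν) := by
            rw [← Real.rpow_natCast, ← Real.rpow_mul hqR.le]
            push_cast
            rw [mul_comm]
            apply Real.rpow_le_rpow hqR.le _ (by positivity)
            have : (y:ℝ)^σ ≤ (y:ℝ)^(1:ℝ) := Real.rpow_le_rpow_of_exponent_le (by exact_mod_cast (by omega : 1 ≤ y)) hσ.le
            rw [Real.rpow_one] at this
            linarith
          gcongr
      _ = (K * (u^(2*ν-e') * (y:ℝ)^(2*ν))) * (1 / q) := by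
          have : u^(1 - e' + 2*ν) = u * u^(2*ν-e') := by
            rw [show 1 - e' + 2*ν = 1 + (2*ν-e') by ring, Real.rpow_add hu0, Real.rpow_one]
          rw [this, hu]
          field_simp
      _ ≤ (1 / L) * (1/q) := by
          gcongr
          have a3 : u^(2*ν-e') ≤ (y:ℝ)^((1-σ)*(2*ν-e')) := by
            have : (y:ℝ)^(1-σ) ≤ u := by
              rw [← Real.log_le_log_iff (by positivity) hu0, Real.log_rpow hyR]
              exact hlu1
            rw [Real.rpow_mul hyR.le]
            apply Real.rpow_le_rpow_of_nonpos (by positivity) this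
            have := mul_pos he'0 hσ0; linarith
          have hy6 : 1 ≤ (y:ℝ) := by exact_mod_cast (by omega : 1 ≤ y)
          have a4 : (y:ℝ)^((1-σ)*(2*ν-e')) * (y:ℝ)^(2*ν) ≤ (y:ℝ)^(-(e'*(1-σ)/2)) := by
            rw [← Real.rpow_add hyR]
            apply Real.rpow_le_rpow_of_exponent_le hy6
            have : (1-σ)*ν ≤ ν := by have := mul_pos hσ0 hν0; linarith
            have : 8 * ν = e' * (1-σ) := by rw [hν]; ring
            linarith
          rw [le_div_iff₀ (by linarith)]
          have a5 : 0 < (y:ℝ)^(e'*(1-σ)/2) := by positivity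
          calc K * (u^(2*ν-e') * (y:ℝ)^(2*ν)) * L ≤ K * ((y:ℝ)^((1-σ)*(2*ν-e')) * (y:ℝ)^(2*ν)) * L := by
                gcongr
            _ ≤ K * ((y:ℝ)^(-(e'*(1-σ)/2))) * L := by
                gcongr
            _ = (K * L) * ((y:ℝ)^(e'*(1-σ)/2))⁻¹ := by rw [Real.rpow_neg hyR.le]; ring
            _ ≤ (y:ℝ)^(e'*(1-σ)/2) * ((y:ℝ)^(e'*(1-σ)/2))⁻¹ := by
                rw [pow_one] at hy2
                gcongr
            _ = 1 := mul_inv_cancel₀ a5.ne'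
      _ ≤ (1/((q:ℝ)-1)) * (1/L) := by
          rw [mul_comm]
          have : 0 < L := by linarith
          gcongr
          linarith
end FI
end Part4

section Part5
open Matrix Finset

namespace FI

/-! ### The large sieve -/

noncomputable def ee (t : ℝ) : ℂ := Complex.exp (Complex.I * ((2 * Real.pi * t : ℝ) : ℂ))

lemma ee_add (s t : ℝ) : ee (s + t) = ee s * ee t := by
  rw [ee, ee, ee, ← Complex.exp_add]; congr 1; push_cast; ring

lemma ee_zero : ee 0 = 1 := by simp [ee]

lemma norm_ee (t : ℝ) : ‖ee t‖ = 1 := by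
  rw [ee, mul_comm]; exact Complex.norm_exp_ofReal_mul_I _

lemma conj_ee (t : ℝ) : (starRingEnd ℂ) (ee t) = ee (-t) := by
  rw [ee, ee, ← Complex.exp_conj]
  congr 1
  simp only [map_mul, Complex.conj_I, Complex.conj_ofReal]
  push_cast; ring

lemma ee_int (k : ℤ) : ee k = 1 := by
  rw [ee, Complex.exp_eq_one_iff]
  exact ⟨k, by push_cast; ring⟩

lemma ee_nat_mul (n : ℕ) (t : ℝ) : ee (n * t) = ee t ^ n := by
  rw [ee, ee, ← Complex.exp_nat_mul]; congr 1; push_cast; ring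

lemma norm_ee_sub_one (β : ℝ) : 4 * |β - round β| ≤ ‖ee β - 1‖ := by
  set b := β - round β with hb
  have h1 : ee β = ee b := by
    have : β = b + ((round β : ℤ):ℝ) := by rw [hb]; ring
    conv_lhs => rw [this]
    rw [ee_add, ee_int, mul_one]
  have h2 : |b| ≤ 1/2 := abs_sub_round β
  rw [h1, ee, Complex.norm_exp_I_mul_ofReal_sub_one, norm_mul, Real.norm_eq_abs, Real.norm_eq_abs]
  have h3 : 2 * Real.pi * b / 2 = Real.pi * b := by ring
  rw [h3]
  have hpi := Real.pi_pos
  have h4 := Real.mul_abs_le_abs_sin (x := Real.pi * b) (by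
    rw [abs_mul, abs_of_pos hpi]; nlinarith)
  rw [abs_mul, abs_of_pos hpi] at h4
  have h5 : 2 / Real.pi * (Real.pi * |b|) = 2 * |b| := by field_simp
  rw [h5] at h4
  rw [abs_two]
  linarith

noncomputable def KK (M : ℕ) (β : ℝ) : ℂ := ∑ i ∈ range (2*M+1), ee (((i:ℝ) - M) * β)

lemma KK_triv (M : ℕ) (β : ℝ) : ‖KK M β‖ ≤ 2*M+1 := by
  refine (norm_sum_le _ _).trans ?_
  simp [norm_ee]

lemma KK_bound (M : ℕ) (β : ℝ) (hβ : β - round β ≠ 0) : ‖KK M β‖ ≤ 1 / (2 * |β - round β|) := by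
  have h0 : 0 < |β - round β| := abs_pos.2 hβ
  have h1 : KK M β = ee (-M * β) * ∑ i ∈ range (2*M+1), ee β ^ i := by
    rw [KK, mul_sum]
    apply sum_congr rfl
    intro i _
    rw [← ee_nat_mul, ← ee_add]; congr 1; ring
  have h2 : ‖KK M β‖ * ‖ee β - 1‖ ≤ 2 := by
    rw [h1, norm_mul, norm_ee, one_mul, ← norm_mul, geom_sum_mul]
    refine (norm_sub_le _ _).trans ?_
    rw [norm_pow, norm_ee]; norm_num
  have h3 := norm_ee_sub_one β
  rw [le_div_iff₀ (by positivity)]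
  have := mul_le_mul_of_nonneg_left h3 (norm_nonneg (KK M β))
  linarith

lemma KK_row {ι : Type*} [DecidableEq ι] (P : Finset ι) (θ : ι → ℝ) (δ : ℝ) (hδ : 0 < δ) (hδ2 : δ ≤ 1/2)
    (hsep : ∀ r ∈ P, ∀ s ∈ P, r ≠ s → ∀ k : ℤ, δ ≤ |θ r - θ s - k|) (M : ℕ) (r : ι) (hr : r ∈ P) :
    ∑ s ∈ P, ‖KK M (θ r - θ s)‖ ≤ 2*M+1 + (2/δ) * (1 + Real.log (1/δ)) := by
  rw [← add_sum_erase P _ hr]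
  apply add_le_add (KK_triv _ _)
  let b : ι → ℝ := fun s => (θ r - θ s) - round (θ r - θ s)
  let j : ι → ℤ := fun s => ⌊b s / δ⌋
  have hb1 : ∀ s ∈ P.erase r, δ ≤ |b s| := fun s hs =>
    hsep r hr s (mem_of_mem_erase hs) (ne_of_mem_erase hs).symm _
  have hb2 : ∀ s, |b s| ≤ 1/2 := fun s => abs_sub_round _
  have hjb : ∀ s, (j s : ℝ) * δ ≤ b s ∧ b s < ((j s : ℝ) + 1) * δ := by
    intro s
    constructor
    · rw [← le_div_iff₀ hδ]; exact Int.floor_le _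
    · rw [← div_lt_iff₀ hδ]; exact Int.lt_floor_add_one _
  have hinj : Set.InjOn j (P.erase r : Finset ι) := by
    intro s hs t ht hst
    by_contra hne
    have h1 := hsep t (mem_of_mem_erase ht) s (mem_of_mem_erase hs) (Ne.symm hne)
      (round (θ r - θ s) - round (θ r - θ t))
    have h2 : θ t - θ s - ((round (θ r - θ s) - round (θ r - θ t) : ℤ) : ℝ) = b s - b t := by
      simp only [b]; push_cast; ring
    rw [h2] at h1
    have a1 := hjb s
    have a2 := hjb t
    rw [hst] at a1
    have : |b s - b t| < δ := by rw [abs_lt]; constructor <;> linarith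
    linarith
  have hjb2 : ∀ s ∈ P.erase r, j s ≠ 0 ∧ |(j s : ℝ)| * δ ≤ 2 * |b s| ∧ |(j s : ℝ)| ≤ 1/δ := by
    intro s hs
    have a1 := hjb s
    have a2 := hb1 s hs
    have a3 := hb2 s
    have h3 : 1/2 + δ ≤ 1 := by linarith
    rcases lt_trichotomy (j s) 0 with hj | hj | hj
    · have hjR : (j s : ℝ) ≤ -1 := by exact_mod_cast (by omega : j s ≤ -1)
      have hbneg : b s < 0 ∨ b s = 0 ∨ 0 < b s := lt_trichotomy _ _
      have hb0 : b s ≤ 0 := by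
        have : ((j s : ℝ) + 1) * δ ≤ 0 := mul_nonpos_of_nonpos_of_nonneg (by linarith) hδ.le
        linarith
      rw [abs_of_nonpos hb0] at *
      rw [abs_of_nonpos (by linarith : (j s : ℝ) ≤ 0)]
      refine ⟨hj.ne, ?_, ?_⟩
      · linarith
      · rw [le_div_iff₀ hδ]; linarith
    · exfalso
      rw [hj] at a1
      simp only [Int.cast_zero, zero_mul, zero_add, one_mul] at a1
      rw [abs_of_nonneg a1.1] at a2
      linarith
    · have hjR : (1:ℝ) ≤ j s := by exact_mod_cast hj
      have hb0 : 0 ≤ b s := by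
        have : 0 ≤ (j s : ℝ) * δ := by positivity
        linarith
      rw [abs_of_nonneg hb0] at *
      rw [abs_of_nonneg (by linarith : (0:ℝ) ≤ j s)]
      refine ⟨hj.ne', ?_, ?_⟩
      · linarith
      · rw [le_div_iff₀ hδ]; linarith
  calc ∑ s ∈ P.erase r, ‖KK M (θ r - θ s)‖ ≤ ∑ s ∈ P.erase r, (1/δ) * (1 / |(j s : ℝ)|) := by
        apply sum_le_sum
        intro s hs
        have a1 := hb1 s hs
        obtain ⟨a2, a3, a4⟩ := hjb2 s hs
        have hb0 : b s ≠ 0 := by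
          intro h0; rw [h0, abs_zero] at a1; linarith
        have hbp : 0 < |b s| := abs_pos.2 hb0
        have hj0 : 0 < |(j s : ℝ)| := abs_pos.2 (by exact_mod_cast a2)
        refine (KK_bound M _ hb0).trans ?_
        rw [one_div_mul_one_div]
        apply one_div_le_one_div_of_le (by positivity)
        change δ * |(j s : ℝ)| ≤ 2 * |b s|
        linarith
    _ = (1/δ) * ∑ n ∈ (P.erase r).image j, 1 / |(n:ℝ)| := by rw [sum_image hinj, mul_sum]
    _ ≤ (1/δ) * (∑ n ∈ (Icc 1 ⌊1/δ⌋₊).image (fun n : ℕ => (n:ℤ)), 1 / |(n:ℝ)| +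
          ∑ n ∈ (Icc 1 ⌊1/δ⌋₊).image (fun n : ℕ => -(n:ℤ)), 1 / |(n:ℝ)|) := by
        gcongr
        rw [← sum_union_inter]
        refine le_trans ?_ (le_add_of_nonneg_right (sum_nonneg (fun _ _ => by positivity)))
        apply sum_le_sum_of_subset_of_nonneg
        · intro n hn
          rw [mem_image] at hn
          obtain ⟨s, hs, rfl⟩ := hn
          obtain ⟨a2, a3, a4⟩ := hjb2 s hs
          have h5 : (j s).natAbs ∈ Icc 1 ⌊1/δ⌋₊ := by
            rw [mem_Icc]
            refine ⟨Int.natAbs_pos.2 a2, Nat.le_floor ?_⟩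
            rw [Nat.cast_natAbs]; push_cast; exact a4
          rw [mem_union, mem_image, mem_image]
          rcases Int.natAbs_eq (j s) with h | h
          · left; exact ⟨_, h5, h.symm⟩
          · right; exact ⟨_, h5, h.symm⟩
        · intros; positivity
    _ = (1/δ) * (2 * ∑ n ∈ Icc 1 ⌊1/δ⌋₊, ((n:ℝ))⁻¹) := by
        rw [sum_image (by intro a _ b _ h; simpa using h), sum_image (by intro a _ b _ h; simpa using h)]
        simp only [Int.cast_natCast, Int.cast_neg, abs_neg, Nat.abs_cast, one_div]
        ring
    _ ≤ (1/δ) * (2 * (1 + Real.log (1/δ))) := by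
        have h1 := harmonic_le_one_add_log ⌊1/δ⌋₊
        rw [harmonic_eq_sum_Icc] at h1
        push_cast at h1
        have h2 : Real.log (⌊1/δ⌋₊ : ℝ) ≤ Real.log (1/δ) := by
          have h3 : 1 ≤ 1/δ := by rw [le_div_iff₀ hδ]; linarith
          apply Real.log_le_log
          · exact_mod_cast Nat.floor_pos.2 h3
          · exact Nat.floor_le (by positivity)
        gcongr
        linarith
    _ = _ := by ring

theorem large_sieve {ι : Type*} [DecidableEq ι] (P : Finset ι) (θ : ι → ℝ) (δ : ℝ) (hδ : 0 < δ) (hδ2 : δ ≤ 1/2)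
    (hsep : ∀ r ∈ P, ∀ s ∈ P, r ≠ s → ∀ k : ℤ, δ ≤ |θ r - θ s - k|)
    (F : Finset ℕ) (σ : ℕ → ℤ) (hinj : Set.InjOn σ F) (M : ℕ) (hs : ∀ m ∈ F, |σ m| ≤ M) (a : ℕ → ℝ) :
    ∑ r ∈ P, ‖∑ m ∈ F, (a m : ℂ) * ee (σ m * θ r)‖^2 ≤
      (2*M+1 + (2/δ) * (1 + Real.log (1/δ))) * ∑ m ∈ F, (a m)^2 := by
  set B : ℝ := 2*M+1 + (2/δ) * (1 + Real.log (1/δ)) with hB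
  have hB0 : 0 ≤ B := by
    have : 0 ≤ Real.log (1/δ) := Real.log_nonneg (by rw [le_div_iff₀ hδ]; linarith)
    positivity
  let S : ι → ℂ := fun r => ∑ m ∈ F, (a m : ℂ) * ee (σ m * θ r)
  let T : ℝ → ℂ := fun x => ∑ r ∈ P, (starRingEnd ℂ) (S r) * ee (x * θ r)
  set X : ℝ := ∑ r ∈ P, ‖S r‖^2 with hX
  change X ≤ _
  have hX0 : 0 ≤ X := sum_nonneg (fun _ _ => by positivity)
  -- step 1
  have h1 : (X : ℂ) = ∑ m ∈ F, (a m : ℂ) * T (σ m) := by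
    have e1 : ∀ r ∈ P, ((‖S r‖^2 : ℝ) : ℂ) = ∑ m ∈ F, (a m : ℂ) * ((starRingEnd ℂ) (S r) * ee (σ m * θ r)) := by
      intro r _
      have : ((‖S r‖^2 : ℝ) : ℂ) = (starRingEnd ℂ) (S r) * S r := by
        rw [Complex.conj_mul']; push_cast; rfl
      rw [this]
      conv_lhs => arg 2; simp only [S]
      rw [mul_sum]
      apply sum_congr rfl; intros; ring
    rw [hX]
    push_cast
    push_cast at e1
    rw [sum_congr rfl e1, sum_comm]
    apply sum_congr rfl
    intro m _
    simp only [T]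
    rw [mul_sum]
  have h2 : X ≤ ∑ m ∈ F, |a m| * ‖T (σ m)‖ := by
    have : X = ‖(X:ℂ)‖ := by rw [Complex.norm_real, Real.norm_of_nonneg hX0]
    rw [this, h1]
    refine (norm_sum_le _ _).trans ?_
    apply sum_le_sum
    intro m _
    rw [norm_mul, Complex.norm_real, Real.norm_eq_abs]
  have h3 : X^2 ≤ (∑ m ∈ F, (a m)^2) * ∑ m ∈ F, ‖T (σ m)‖^2 := by
    calc X^2 ≤ (∑ m ∈ F, |a m| * ‖T (σ m)‖)^2 := pow_le_pow_left₀ hX0 h2 2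
      _ ≤ (∑ m ∈ F, |a m|^2) * ∑ m ∈ F, ‖T (σ m)‖^2 := sum_mul_sq_le_sq_mul_sq _ _ _
      _ = _ := by simp only [sq_abs]
  have h4 : ∑ m ∈ F, ‖T (σ m)‖^2 ≤ ∑ i ∈ range (2*M+1), ‖T ((i:ℝ) - M)‖^2 := by
    have e : ∀ m ∈ F, ((((σ m + M).toNat : ℕ) : ℝ) - M) = σ m := by
      intro m hm
      have := abs_le.1 (hs m hm)
      have h5 : (((σ m + M).toNat : ℕ) : ℤ) = σ m + M := Int.toNat_of_nonneg (by linarith)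
      have h6 : (((σ m + M).toNat : ℕ) : ℝ) = ((((σ m + M).toNat : ℕ) : ℤ) : ℝ) := by norm_cast
      rw [h6, h5]; push_cast; ring
    have hinj2 : Set.InjOn (fun m => (σ m + M).toNat) F := by
      intro m hm m' hm' h
      apply hinj hm hm'
      have := abs_le.1 (hs m hm)
      have := abs_le.1 (hs m' hm')
      simp only at h
      omega
    calc ∑ m ∈ F, ‖T (σ m)‖^2 = ∑ m ∈ F, ‖T ((((σ m + M).toNat : ℕ) : ℝ) - M)‖^2 :=
          sum_congr rfl (fun m hm => by rw [e m hm])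
      _ = ∑ i ∈ F.image (fun m => (σ m + M).toNat), ‖T ((i:ℝ) - M)‖^2 := by rw [sum_image hinj2]
      _ ≤ _ := by
          apply sum_le_sum_of_subset_of_nonneg
          · intro i hi
            rw [mem_image] at hi
            obtain ⟨m, hm, rfl⟩ := hi
            have := abs_le.1 (hs m hm)
            rw [mem_range]; omega
          · intros; positivity
  have h5 : ((∑ i ∈ range (2*M+1), ‖T ((i:ℝ) - M)‖^2 : ℝ) : ℂ) =
      ∑ r ∈ P, ∑ s ∈ P, (starRingEnd ℂ) (S r) * S s * KK M (θ r - θ s) := by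
    have e1 : ∀ x : ℝ, ((‖T x‖^2 : ℝ) : ℂ) = ∑ r ∈ P, ∑ s ∈ P, (starRingEnd ℂ) (S r) * S s * ee (x * (θ r - θ s)) := by
      intro x
      have : ((‖T x‖^2 : ℝ) : ℂ) = T x * (starRingEnd ℂ) (T x) := by
        rw [Complex.mul_conj']; push_cast; rfl
      rw [this]
      simp only [T]
      rw [map_sum, sum_mul_sum]
      apply sum_congr rfl; intro r _
      apply sum_congr rfl; intro s _
      rw [map_mul, Complex.conj_conj, conj_ee, show x * (θ r - θ s) = x * θ r + -(x * θ s) by ring, ee_add]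
      ring
    push_cast
    push_cast at e1
    rw [sum_congr rfl (fun i _ => e1 _), sum_comm]
    apply sum_congr rfl; intro r _
    rw [sum_comm]
    apply sum_congr rfl; intro s _
    exact (mul_sum _ _ _).symm
  have h6 : ∑ i ∈ range (2*M+1), ‖T ((i:ℝ) - M)‖^2 ≤ B * X := by
    have hn : 0 ≤ ∑ i ∈ range (2*M+1), ‖T ((i:ℝ) - M)‖^2 := sum_nonneg (fun _ _ => by positivity)
    have e2 : ∑ i ∈ range (2*M+1), ‖T ((i:ℝ) - M)‖^2 = ‖((∑ i ∈ range (2*M+1), ‖T ((i:ℝ) - M)‖^2 : ℝ) : ℂ)‖ := by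
      rw [Complex.norm_real, Real.norm_of_nonneg hn]
    rw [e2, h5]
    have hsym : ∀ r s, ‖KK M (θ r - θ s)‖ = ‖KK M (θ s - θ r)‖ := by
      intro r s
      have : (starRingEnd ℂ) (KK M (θ r - θ s)) = KK M (θ s - θ r) := by
        rw [KK, KK, map_sum]
        apply sum_congr rfl; intro i _
        rw [conj_ee]; congr 1; ring
      rw [← this, Complex.norm_conj]
    calc ‖∑ r ∈ P, ∑ s ∈ P, (starRingEnd ℂ) (S r) * S s * KK M (θ r - θ s)‖
        ≤ ∑ r ∈ P, ∑ s ∈ P, ((1/2) * (‖S r‖^2 * ‖KK M (θ r - θ s)‖) + (1/2) * (‖S s‖^2 * ‖KK M (θ s - θ r)‖)) := by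
          refine (norm_sum_le _ _).trans (sum_le_sum fun r _ => (norm_sum_le _ _).trans (sum_le_sum fun s _ => ?_))
          rw [norm_mul, norm_mul, Complex.norm_conj, hsym s r]
          have := mul_nonneg (sq_nonneg (‖S r‖ - ‖S s‖)) (norm_nonneg (KK M (θ r - θ s)))
          linarith
      _ = ∑ r ∈ P, ∑ s ∈ P, ‖S r‖^2 * ‖KK M (θ r - θ s)‖ := by
          simp only [sum_add_distrib, ← mul_sum]
          rw [sum_comm (s := P) (t := P) (f := fun r s => ‖S s‖^2 * ‖KK M (θ s - θ r)‖)]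
          simp only [← mul_sum]
          ring
      _ ≤ ∑ r ∈ P, ‖S r‖^2 * B := by
          apply sum_le_sum
          intro r hr
          rw [← mul_sum]
          gcongr
          exact KK_row P θ δ hδ hδ2 hsep M r hr
      _ = B * X := by rw [← sum_mul, mul_comm]
  set A : ℝ := ∑ m ∈ F, (a m)^2 with hA
  have hA0 : 0 ≤ A := sum_nonneg (fun _ _ => by positivity)
  have h7 : X^2 ≤ A * (B * X) := h3.trans (mul_le_mul_of_nonneg_left (h4.trans h6) hA0)
  rcases hX0.eq_or_lt with h0 | h0
  · rw [← h0]; positivity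
  · clear_value A B X
    by_contra hcon
    push Not at hcon
    have := mul_lt_mul_of_pos_right hcon h0
    linarith
end FI
end Part5

section Part6
open Matrix Finset

namespace FI

lemma sum_ee_zmod (q : ℕ) (hq : 0 < q) (k : ℤ) :
    ∑ b ∈ range q, ee (k * ((b:ℝ) / q)) = if (q:ℤ) ∣ k then (q:ℂ) else 0 := by
  have hqR : (q:ℝ) ≠ 0 := by exact_mod_cast hq.ne'
  have h1 : ∀ b ∈ range q, ee (k * ((b:ℝ) / q)) = (ee (k / q)) ^ b := by
    intro b _
    rw [← ee_nat_mul]; congr 1; ring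
  rw [sum_congr rfl h1]
  split_ifs with h
  · obtain ⟨t, rfl⟩ := h
    have : (((q:ℤ) * t : ℤ) : ℝ) / q = (t:ℝ) := by push_cast; field_simp
    rw [this, ee_int]; simp
  · have hne : ee (k / q) - 1 ≠ 0 := by
      intro h0
      have h2 := norm_ee_sub_one ((k:ℝ) / q)
      rw [h0, norm_zero] at h2
      have h3 : (k:ℝ)/q - round ((k:ℝ)/q) = 0 := by
        rw [← abs_eq_zero]; linarith [abs_nonneg ((k:ℝ)/q - round ((k:ℝ)/q))]
      apply h
      refine ⟨round ((k:ℝ)/q), ?_⟩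
      have h4 : (k:ℝ) = q * (round ((k:ℝ)/q) : ℤ) := by
        have : (k:ℝ)/q = (round ((k:ℝ)/q) : ℤ) := by linarith
        rw [← this]; field_simp
      exact_mod_cast h4
    have h5 := geom_sum_mul (ee (k / q)) q
    have h6 : ee ((k:ℝ) / q) ^ q = 1 := by
      rw [← ee_nat_mul]
      have : (q:ℝ) * ((k:ℝ)/q) = (k:ℝ) := by field_simp
      rw [this, ee_int]
    rw [h6, sub_self] at h5
    exact (mul_eq_zero.1 h5).resolve_right hne

noncomputable def clsum (F : Finset ℕ) (σ : ℕ → ℤ) (a : ℕ → ℝ) (q : ℕ) (h : ZMod q) : ℝ :=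
  ∑ m ∈ F with ((σ m : ℤ) : ZMod q) = h, a m

noncomputable def expS (F : Finset ℕ) (σ : ℕ → ℤ) (a : ℕ → ℝ) (t : ℝ) : ℂ :=
  ∑ m ∈ F, (a m : ℂ) * ee (σ m * t)

lemma sum_clsum (F : Finset ℕ) (σ : ℕ → ℤ) (a : ℕ → ℝ) (q : ℕ) [NeZero q] :
    ∑ h : ZMod q, clsum F σ a q h = ∑ m ∈ F, a m := by
  unfold clsum
  exact sum_fiberwise F (fun m => ((σ m : ℤ) : ZMod q)) a

lemma parseval (F : Finset ℕ) (σ : ℕ → ℤ) (a : ℕ → ℝ) (q : ℕ) [NeZero q] :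
    ∑ b ∈ range q, ‖expS F σ a ((b:ℝ)/q)‖^2 = q * ∑ h : ZMod q, (clsum F σ a q h)^2 := by
  have hq : 0 < q := Nat.pos_of_neZero q
  have h1 : ∀ t : ℝ, ((‖expS F σ a t‖^2 : ℝ) : ℂ) = ∑ m ∈ F, ∑ m' ∈ F, (a m : ℂ) * a m' * ee (((σ m - σ m' : ℤ):ℝ) * t) := by
    intro t
    have : ((‖expS F σ a t‖^2 : ℝ) : ℂ) = expS F σ a t * (starRingEnd ℂ) (expS F σ a t) := by
      rw [Complex.mul_conj']; push_cast; rfl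
    rw [this, expS, map_sum, sum_mul_sum]
    apply sum_congr rfl; intro m _
    apply sum_congr rfl; intro m' _
    rw [map_mul, Complex.conj_ofReal, conj_ee]
    have : (((σ m - σ m' : ℤ):ℝ) * t) = σ m * t + -(σ m' * t) := by push_cast; ring
    rw [this, ee_add]; ring
  have h2 : ((∑ b ∈ range q, ‖expS F σ a ((b:ℝ)/q)‖^2 : ℝ) : ℂ) =
      ∑ m ∈ F, ∑ m' ∈ F, (a m : ℂ) * a m' * (if ((σ m : ℤ) : ZMod q) = σ m' then (q:ℂ) else 0) := by
    rw [Complex.ofReal_sum, sum_congr rfl (fun b _ => h1 _), sum_comm]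
    apply sum_congr rfl; intro m _
    rw [sum_comm]
    apply sum_congr rfl; intro m' _
    rw [← mul_sum, sum_ee_zmod q hq]
    congr 1
    apply if_congr _ rfl rfl
    rw [← ZMod.intCast_zmod_eq_zero_iff_dvd, Int.cast_sub, sub_eq_zero]
  have h3 : ∑ h : ZMod q, (clsum F σ a q h)^2 =
      ∑ m ∈ F, ∑ m' ∈ F, (if ((σ m : ℤ) : ZMod q) = σ m' then a m * a m' else 0) := by
    have e : ∀ h : ZMod q, (clsum F σ a q h)^2 = ∑ m ∈ F, ∑ m' ∈ F,
        (if ((σ m : ℤ) : ZMod q) = h then (if ((σ m' : ℤ) : ZMod q) = h then a m * a m' else 0) else 0) := by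
      intro h
      rw [clsum, sum_filter, sq, sum_mul_sum]
      apply sum_congr rfl; intro m _
      apply sum_congr rfl; intro m' _
      split_ifs <;> simp
    simp only [e]
    rw [sum_comm]
    apply sum_congr rfl; intro m _
    rw [sum_comm]
    apply sum_congr rfl; intro m' _
    rw [sum_ite_eq univ]
    simp only [mem_univ, if_true]
    exact if_congr eq_comm rfl rfl
  have h4 : ((∑ b ∈ range q, ‖expS F σ a ((b:ℝ)/q)‖^2 : ℝ) : ℂ) = ((q * ∑ h : ZMod q, (clsum F σ a q h)^2 : ℝ) : ℂ) := by
    rw [h2, h3]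
    push_cast
    rw [mul_sum]
    apply sum_congr rfl; intro m _
    rw [mul_sum]
    apply sum_congr rfl; intro m' _
    split_ifs
    · push_cast; ring
    · simp
  exact_mod_cast h4

noncomputable def varq (F : Finset ℕ) (σ : ℕ → ℤ) (a : ℕ → ℝ) (q : ℕ) [NeZero q] : ℝ :=
  ∑ h : ZMod q, (clsum F σ a q h - (∑ m ∈ F, a m) / q)^2

lemma varq_eq (F : Finset ℕ) (σ : ℕ → ℤ) (a : ℕ → ℝ) (q : ℕ) [NeZero q] :
    q * varq F σ a q = ∑ b ∈ Ico 1 q, ‖expS F σ a ((b:ℝ)/q)‖^2 := by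
  have hq : 0 < q := Nat.pos_of_neZero q
  have hqR : (q:ℝ) ≠ 0 := by exact_mod_cast hq.ne'
  have h1 := parseval F σ a q
  rw [range_eq_Ico, sum_eq_sum_Ico_succ_bot hq] at h1
  have h0 : expS F σ a (((0:ℕ):ℝ)/q) = ((∑ m ∈ F, a m : ℝ) : ℂ) := by
    rw [expS]
    push_cast
    apply sum_congr rfl; intros; simp [ee_zero]
  rw [h0, Complex.norm_real, Real.norm_eq_abs, sq_abs] at h1
  have h2 : varq F σ a q = ∑ h : ZMod q, (clsum F σ a q h)^2 - (∑ m ∈ F, a m)^2 / q := by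
    rw [varq]
    simp only [sub_sq, sum_add_distrib, sum_sub_distrib]
    rw [← sum_mul, ← mul_sum, sum_clsum]
    simp only [sum_const, card_univ, ZMod.card, nsmul_eq_mul]
    field_simp
    ring
  rw [h2, mul_sub]
  have : (q:ℝ) * ((∑ m ∈ F, a m)^2 / q) = (∑ m ∈ F, a m)^2 := by field_simp
  rw [this]
  have h3 : (0:ℕ) + 1 = 1 := rfl
  rw [h3] at h1
  linarith

lemma cov_bound {ι : Type*} (U : Finset ι) (hU : U.Nonempty) (f g : ι → ℝ) (c d : ℝ) :
    |∑ i ∈ U, f i * g i - (∑ i ∈ U, f i) * (∑ i ∈ U, g i) / #U| ≤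
      √(∑ i ∈ U, (f i - c)^2) * √(∑ i ∈ U, (g i - d)^2) := by
  have hn : (0:ℝ) < #U := by exact_mod_cast card_pos.2 hU
  set n : ℝ := ((#U : ℕ) : ℝ) with hnd
  set fb := (∑ i ∈ U, f i) / n with hfb
  set gb := (∑ i ∈ U, g i) / n with hgb
  have sf : ∑ i ∈ U, f i = n * fb := by rw [hfb]; field_simp
  have sg : ∑ i ∈ U, g i = n * gb := by rw [hgb]; field_simp
  have h1 : ∑ i ∈ U, f i * g i - (∑ i ∈ U, f i) * (∑ i ∈ U, g i) / n = ∑ i ∈ U, (f i - fb) * (g i - gb) := by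
    have e : ∀ i, (f i - fb) * (g i - gb) = f i * g i - fb * g i - gb * f i + fb * gb := fun i => by ring
    simp only [e, sum_add_distrib, sum_sub_distrib, ← mul_sum, sum_const, nsmul_eq_mul, ← hnd]
    rw [sf, sg]; field_simp; ring
  have hmin : ∀ (f : ι → ℝ) (fb c : ℝ), ∑ i ∈ U, f i = n * fb → ∑ i ∈ U, (f i - fb)^2 ≤ ∑ i ∈ U, (f i - c)^2 := by
    intro f fb c sf
    have e : ∀ i, (f i - c)^2 = (f i - fb)^2 + 2 * (fb - c) * f i + (c^2 - fb^2) := fun i => by ring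
    rw [sum_congr rfl (fun i _ => e i), sum_add_distrib, sum_add_distrib, ← mul_sum, sum_const, nsmul_eq_mul, ← hnd]
    rw [sf]
    have : 0 ≤ n * (fb - c)^2 := mul_nonneg hn.le (sq_nonneg _)
    linarith
  rw [h1, ← Real.sqrt_mul (sum_nonneg fun _ _ => by positivity), ← Real.sqrt_sq_eq_abs]
  apply Real.sqrt_le_sqrt
  refine (sum_mul_sq_le_sq_mul_sq _ _ _).trans ?_
  apply mul_le_mul (hmin f fb c sf) (hmin g gb d sg) (sum_nonneg fun _ _ => by positivity) (sum_nonneg fun _ _ => by positivity)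

lemma clsum_pair (F G : Finset ℕ) (σ : ℕ → ℤ) (a b : ℕ → ℝ) (q : ℕ) [Fact q.Prime] :
    ∑ m ∈ F, ∑ k ∈ G, (if ((σ m : ℤ) : ZMod q) * ((σ k : ℤ) : ZMod q) = 1 then a m * b k else 0) =
      ∑ h ∈ univ.erase (0 : ZMod q), clsum F σ a q h * clsum G σ b q h⁻¹ := by
  have e : ∀ h : ZMod q, clsum F σ a q h * clsum G σ b q h⁻¹ = ∑ m ∈ F, ∑ k ∈ G,
      (if ((σ m : ℤ) : ZMod q) = h then (if ((σ k : ℤ) : ZMod q) = h⁻¹ then a m * b k else 0) else 0) := by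
    intro h
    rw [clsum, clsum, sum_filter, sum_filter, sum_mul_sum]
    apply sum_congr rfl; intro m _
    apply sum_congr rfl; intro m' _
    split_ifs <;> simp
  simp only [e]
  conv_rhs => rw [sum_comm]
  apply sum_congr rfl; intro m _
  conv_rhs => rw [sum_comm]
  apply sum_congr rfl; intro k _
  rw [sum_ite_eq (univ.erase (0:ZMod q))]
  by_cases h0 : ((σ m : ℤ) : ZMod q) = 0
  · simp [h0]
  · simp only [mem_erase, mem_univ, and_true, ne_eq, h0, not_false_eq_true, if_true]
    apply if_congr _ rfl rfl
    constructor
    · intro h; exact eq_inv_of_mul_eq_one_right h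
    · intro h; rw [h, mul_inv_cancel₀ h0]

lemma clsum_units (F : Finset ℕ) (σ : ℕ → ℤ) (a : ℕ → ℝ) (q : ℕ) [Fact q.Prime] :
    ∑ h ∈ univ.erase (0 : ZMod q), clsum F σ a q h = ∑ m ∈ F with ((σ m : ℤ) : ZMod q) ≠ 0, a m := by
  rw [← sum_fiberwise_of_maps_to (s := F.filter (fun m => ((σ m : ℤ) : ZMod q) ≠ 0)) (g := fun m => ((σ m : ℤ) : ZMod q))
    (t := univ.erase (0 : ZMod q)) (by intro m hm; simpa using (mem_filter.1 hm).2)]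
  apply sum_congr rfl
  intro h hh
  rw [clsum, filter_filter]
  apply sum_congr _ (fun _ _ => rfl)
  ext m
  simp only [mem_filter]
  have h0 := ne_of_mem_erase hh
  constructor
  · rintro ⟨h1, h2⟩; exact ⟨h1, by rw [h2]; exact h0, h2⟩
  · rintro ⟨h1, h2, h3⟩; exact ⟨h1, h3⟩

lemma bilinear_var (F G : Finset ℕ) (σ : ℕ → ℤ) (a b : ℕ → ℝ) (q : ℕ) [hq : Fact q.Prime] :
    |∑ m ∈ F, ∑ k ∈ G, (if ((σ m : ℤ) : ZMod q) * ((σ k : ℤ) : ZMod q) = 1 then a m * b k else 0) -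
      (∑ m ∈ F with ((σ m : ℤ) : ZMod q) ≠ 0, a m) * (∑ k ∈ G with ((σ k : ℤ) : ZMod q) ≠ 0, b k) / ((q:ℝ)-1)| ≤
      √(varq F σ a q) * √(varq G σ b q) := by
  rw [clsum_pair, ← clsum_units, ← clsum_units]
  have hinv : ∀ f : ZMod q → ℝ, ∑ h ∈ univ.erase (0 : ZMod q), f h⁻¹ = ∑ h ∈ univ.erase (0 : ZMod q), f h := by
    intro f
    apply sum_nbij' (fun h => h⁻¹) (fun h => h⁻¹) <;> simp
  have hcard : ((#(univ.erase (0 : ZMod q)) : ℕ) : ℝ) = (q:ℝ) - 1 := by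
    rw [card_erase_of_mem (mem_univ _), card_univ, ZMod.card, Nat.cast_sub hq.out.one_lt.le]; simp
  have hne : (univ.erase (0 : ZMod q)).Nonempty := ⟨1, by simp⟩
  have h1 := cov_bound (univ.erase (0 : ZMod q)) hne (fun h => clsum F σ a q h) (fun h => clsum G σ b q h⁻¹)
    ((∑ m ∈ F, a m) / q) ((∑ m ∈ G, b m) / q)
  rw [hcard, hinv (fun h => clsum G σ b q h), hinv (fun h => (clsum G σ b q h - (∑ m ∈ G, b m) / q)^2)] at h1
  refine h1.trans ?_
  apply mul_le_mul _ _ (Real.sqrt_nonneg _) (Real.sqrt_nonneg _)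
  all_goals
    apply Real.sqrt_le_sqrt
    apply sum_le_sum_of_subset_of_nonneg (erase_subset _ _)
    intros; positivity

/-- large sieve for variances over primes in a dyadic range -/
lemma var_large_sieve (PQ : Finset ℕ) (Q : ℕ) (hQ : 1 ≤ Q) (hP : ∀ q ∈ PQ, q.Prime ∧ Q < q ∧ q ≤ 2*Q)
    (F : Finset ℕ) (σ : ℕ → ℤ) (hinj : Set.InjOn σ F) (M : ℕ) (hs : ∀ m ∈ F, |σ m| ≤ M) (a : ℕ → ℝ)
    (V : ℕ → ℝ) (hV : ∀ q ∈ PQ, q * V q = ∑ b ∈ Ico 1 q, ‖expS F σ a ((b:ℝ)/q)‖^2) :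
    ∑ q ∈ PQ, V q ≤ (1/(Q:ℝ)) * ((2*M+1 + 8*(Q:ℝ)^2 * (1 + Real.log (4*(Q:ℝ)^2))) * ∑ m ∈ F, (a m)^2) := by
  have hQR : (1:ℝ) ≤ Q := by exact_mod_cast hQ
  have h1 := large_sieve (PQ.sigma (fun q => Ico 1 q)) (fun r => (r.2:ℝ) / r.1) (1/(4*(Q:ℝ)^2)) (by positivity)
    (by rw [div_le_div_iff₀ (by positivity) (by positivity)]; nlinarith) (by
      rintro ⟨q, b⟩ hr ⟨q', b'⟩ hs hne k
      simp only [mem_sigma, mem_Ico] at hr hs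
      obtain ⟨hp, hq1, hq2⟩ := hP q hr.1
      obtain ⟨hp', hq1', hq2'⟩ := hP q' hs.1
      have hqR : (0:ℝ) < q := by exact_mod_cast hp.pos
      have hqR' : (0:ℝ) < q' := by exact_mod_cast hp'.pos
      have e : (b:ℝ) / q - (b':ℝ) / q' - k = (((b:ℤ) * q' - b' * q - k * q * q' : ℤ) : ℝ) / (q * q') := by
        push_cast; field_simp
      simp only
      rw [e, abs_div, abs_of_pos (by positivity : (0:ℝ) < q * q')]
      have hne0 : (b:ℤ) * q' - b' * q - k * q * q' ≠ 0 := by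
        intro h0
        by_cases hqq : q = q'
        · subst hqq
          have hbb : b ≠ b' := by rintro rfl; exact hne rfl
          have hq0 : (q:ℤ) ≠ 0 := by exact_mod_cast hp.ne_zero
          have h3 : (b:ℤ) - b' = q * k := by
            apply mul_left_cancel₀ hq0
            linear_combination h0
          have h4 : (q:ℤ) ∣ (b:ℤ) - b' := ⟨k, h3⟩
          have h5 : (b:ℤ) - b' = 0 := by
            apply Int.eq_zero_of_abs_lt_dvd h4
            rw [abs_lt]; constructor <;> omega
          omega
        · have h3 : (q:ℤ) ∣ b * q' := ⟨b' + k * q', by linear_combination h0⟩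
          have h4 : q ∣ b * q' := by exact_mod_cast h3
          rcases hp.dvd_mul.1 h4 with h5 | h5
          · have := Nat.le_of_dvd (by omega) h5; omega
          · exact hqq ((Nat.prime_dvd_prime_iff_eq hp hp').1 h5)
      have h6 : (1:ℝ) ≤ |(((b:ℤ) * q' - b' * q - k * q * q' : ℤ) : ℝ)| := by
        have := Int.one_le_abs hne0
        exact_mod_cast this
      apply div_le_div₀ (by linarith) h6 (by positivity)
      have a1 : (q:ℝ) ≤ 2 * Q := by exact_mod_cast hq2
      have a2 : (q':ℝ) ≤ 2 * Q := by exact_mod_cast hq2'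
      calc (q:ℝ) * q' ≤ (2*Q) * (2*Q) := by gcongr
        _ = _ := by ring) F σ hinj M hs a
  rw [sum_sigma] at h1
  have h2 : ∑ q ∈ PQ, (Q:ℝ) * V q ≤ ∑ q ∈ PQ, ∑ b ∈ Ico 1 q, ‖expS F σ a ((b:ℝ)/q)‖^2 := by
    apply sum_le_sum
    intro q hq
    rw [← hV q hq]
    obtain ⟨hp, hq1, hq2⟩ := hP q hq
    have hq0 : (0:ℝ) < q := by exact_mod_cast hp.pos
    have hV0 : 0 ≤ V q := by
      have : 0 ≤ (q:ℝ) * V q := by rw [hV q hq]; exact sum_nonneg (fun _ _ => by positivity)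
      exact nonneg_of_mul_nonneg_right this hq0
    gcongr
  rw [← mul_sum] at h2
  have h3 := h2.trans h1
  have e : (2 / (1/(4*(Q:ℝ)^2))) * (1 + Real.log (1 / (1/(4*(Q:ℝ)^2)))) = 8*(Q:ℝ)^2 * (1 + Real.log (4*(Q:ℝ)^2)) := by
    rw [one_div_one_div]
    field_simp
    ring
  rw [e] at h3
  rw [one_div, inv_mul_eq_div, le_div_iff₀ (by linarith)]
  linarith

end FI
end Part6

section Part7
open Matrix Finset
namespace FI

/-- signed integer attached to n -/
def sg (χ : ℕ → ℤ) (n : ℕ) : ℤ := χ n * n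

lemma sg_mul {D : ℕ} {χ : ℕ → ℤ} (h : SignChar D χ) (m k : ℕ) : sg χ (m*k) = sg χ m * sg χ k := by
  simp only [sg, h.mul]; push_cast; ring

noncomputable def Kq (χ : ℕ → ℤ) (q n : ℕ) : ℝ :=
  (if ((sg χ n : ℤ) : ZMod q) = 1 then 1 else 0) - (if ((sg χ n : ℤ) : ZMod q) ≠ 0 then 1/((q:ℝ)-1) else 0)

lemma box_eq {D : ℕ} {χ : ℕ → ℤ} (h : SignChar D χ) (F G : Finset ℕ) (a b : ℕ → ℝ) (q : ℕ) [hq : Fact q.Prime] :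
    ∑ m ∈ F, ∑ k ∈ G, a m * b k * Kq χ q (m*k) =
    ∑ m ∈ F, ∑ k ∈ G, (if ((sg χ m : ℤ) : ZMod q) * ((sg χ k : ℤ) : ZMod q) = 1 then a m * b k else 0) -
      (∑ m ∈ F with ((sg χ m : ℤ) : ZMod q) ≠ 0, a m) * (∑ k ∈ G with ((sg χ k : ℤ) : ZMod q) ≠ 0, b k) / ((q:ℝ)-1) := by
  rw [sum_filter, sum_filter, sum_mul_sum, sum_div, ← sum_sub_distrib]
  apply sum_congr rfl; intro m _
  rw [sum_div, ← sum_sub_distrib]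
  apply sum_congr rfl; intro k _
  rw [Kq, sg_mul h]
  push_cast
  by_cases h1 : ((sg χ m : ℤ) : ZMod q) = 0 <;> by_cases h2 : ((sg χ k : ℤ) : ZMod q) = 0 <;>
    by_cases h3 : ((sg χ m : ℤ) : ZMod q) * ((sg χ k : ℤ) : ZMod q) = 1 <;> simp [h1, h2, h3] <;> ring

lemma sg_abs {D : ℕ} {χ : ℕ → ℤ} (h : SignChar D χ) (m : ℕ) (hm : χ m ≠ 0) : |sg χ m| = m := by
  rcases h.val m with h1 | h1 | h1
  · exact absurd h1 hm
  · simp [sg, h1]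
  · simp [sg, h1]

lemma box_bound {D : ℕ} {χ : ℕ → ℤ} (h : SignChar D χ) (PQ : Finset ℕ) (Q : ℕ) (hQ : 1 ≤ Q)
    (hP : ∀ q ∈ PQ, q.Prime ∧ Q < q ∧ q ≤ 2*Q) (F G : Finset ℕ) (hF : ∀ m ∈ F, χ m ≠ 0) (hG : ∀ m ∈ G, χ m ≠ 0)
    (M K : ℕ) (hM : ∀ m ∈ F, m ≤ M) (hK : ∀ k ∈ G, k ≤ K) (a b : ℕ → ℝ) :
    ∑ q ∈ PQ, |∑ m ∈ F, ∑ k ∈ G, a m * b k * Kq χ q (m*k)| ≤ (1/(Q:ℝ)) *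
      (√((2*M+1 + 8*(Q:ℝ)^2 * (1 + Real.log (4*(Q:ℝ)^2))) * ∑ m ∈ F, (a m)^2) *
      √((2*K+1 + 8*(Q:ℝ)^2 * (1 + Real.log (4*(Q:ℝ)^2))) * ∑ m ∈ G, (b m)^2)) := by
  have hQR : (1:ℝ) ≤ Q := by exact_mod_cast hQ
  have key : ∀ (F : Finset ℕ) (hF : ∀ m ∈ F, χ m ≠ 0) (M : ℕ) (hM : ∀ m ∈ F, m ≤ M) (a : ℕ → ℝ), ∃ V : ℕ → ℝ,
      (∀ q, 0 ≤ V q) ∧ (∀ q ∈ PQ, ∀ hq : NeZero q, V q = varq F (sg χ) a q) ∧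
      ∑ q ∈ PQ, V q ≤ (1/(Q:ℝ)) * ((2*M+1 + 8*(Q:ℝ)^2 * (1 + Real.log (4*(Q:ℝ)^2))) * ∑ m ∈ F, (a m)^2) := by
    intro F hF M hM a
    have hv : ∀ q ∈ PQ, ∀ hq : NeZero q, (∑ b ∈ Ico 1 q, ‖expS F (sg χ) a ((b:ℝ)/q)‖^2)/q = varq F (sg χ) a q := by
      intro q hq hq'
      have hq0 : (q:ℝ) ≠ 0 := by exact_mod_cast (hP q hq).1.ne_zero
      rw [← varq_eq]; field_simp
    refine ⟨fun q => (∑ b ∈ Ico 1 q, ‖expS F (sg χ) a ((b:ℝ)/q)‖^2)/q, ?_, hv, ?_⟩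
    · intro q
      exact div_nonneg (sum_nonneg fun _ _ => by positivity) (by positivity)
    · apply var_large_sieve PQ Q hQ hP F (sg χ) ?_ M ?_ a
      · intro q hq
        have hq0 : (q:ℝ) ≠ 0 := by exact_mod_cast (hP q hq).1.ne_zero
        field_simp
      · intro m hm k hk hmk
        have h1 := sg_abs h m (hF m hm)
        have h2 := sg_abs h k (hF k hk)
        rw [hmk, h2] at h1
        exact_mod_cast h1.symm
      · intro m hm
        rw [sg_abs h m (hF m hm)]
        exact_mod_cast hM m hm
  obtain ⟨V, hV0, hV1, hV2⟩ := key F hF M hM a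
  obtain ⟨W, hW0, hW1, hW2⟩ := key G hG K hK b
  calc ∑ q ∈ PQ, |∑ m ∈ F, ∑ k ∈ G, a m * b k * Kq χ q (m*k)| ≤ ∑ q ∈ PQ, √(V q) * √(W q) := by
        apply sum_le_sum
        intro q hq
        have : Fact q.Prime := ⟨(hP q hq).1⟩
        rw [box_eq h, hV1 q hq inferInstance, hW1 q hq inferInstance]
        exact bilinear_var F G (sg χ) a b q
    _ ≤ √(∑ q ∈ PQ, V q) * √(∑ q ∈ PQ, W q) := by
        exact Real.sum_sqrt_mul_sqrt_le _ hV0 hW0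
    _ ≤ _ := by
        refine (mul_le_mul (Real.sqrt_le_sqrt hV2) (Real.sqrt_le_sqrt hW2) (Real.sqrt_nonneg _) (Real.sqrt_nonneg _)).trans ?_
        rw [Real.sqrt_mul (by positivity), Real.sqrt_mul (by positivity : (0:ℝ) ≤ 1/Q)]
        have : √(1/(Q:ℝ)) * √(1/(Q:ℝ)) = 1/Q := Real.mul_self_sqrt (by positivity)
        apply le_of_eq
        nth_rw 3 [← this]; ring

structure Par (D y Y : ℕ) (T : ℝ) : Prop where
  T1 : 10000 ≤ T
  yY : y ≤ Y
  Yy : (Y:ℝ) ≤ y * T^4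
  lg : 2 + Real.log (4*Y+4) ≤ T
  dv : ∀ n : ℕ, n ≤ 4*Y → (#n.divisors : ℝ) ≤ T
  big : T^400 ≤ y
  DT : (D:ℝ) ≤ T

lemma sum_inv_sq_le (G : Finset ℕ) (z : ℝ) (hz : 0 < z) (hG : ∀ k ∈ G, z < k) :
    ∑ k ∈ G, (1/(k:ℝ))^2 ≤ 2 / z := by
  by_cases hne : G = ∅
  · subst hne; simp; positivity
  obtain ⟨N, hN⟩ : ∃ N, ∀ k ∈ G, k ≤ N := ⟨G.sup id, fun k hk => le_sup (f := id) hk⟩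
  set k0 := ⌊z⌋₊ + 1 with hk0
  have hk0z : z < k0 := by rw [hk0]; push_cast; exact Nat.lt_floor_add_one z
  have hsub : G ⊆ Ico k0 (N+1) := by
    intro k hk
    rw [mem_Ico]
    have h1 := hG k hk
    have h2 := hN k hk
    have : ⌊z⌋₊ < k := (Nat.floor_lt hz.le).2 h1
    omega
  have h1 : ∀ k ∈ Ico k0 (N+1), (1/(k:ℝ))^2 ≤ 2 * (1/(k:ℝ) - 1/((k+1:ℕ):ℝ)) := by
    intro k hk
    have : 1 ≤ k := by rw [mem_Ico] at hk; omega
    have hk1 : (1:ℝ) ≤ k := by exact_mod_cast this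
    have e : 2 * (1/(k:ℝ) - 1/((k+1:ℕ):ℝ)) - (1/(k:ℝ))^2 = ((k:ℝ) - 1) / (k^2 * (k+1)) := by
      push_cast; field_simp; ring
    have : 0 ≤ ((k:ℝ) - 1) / (k^2 * (k+1)) := div_nonneg (by linarith) (by positivity)
    linarith
  calc ∑ k ∈ G, (1/(k:ℝ))^2 ≤ ∑ k ∈ Ico k0 (N+1), (1/(k:ℝ))^2 :=
        sum_le_sum_of_subset_of_nonneg hsub (fun _ _ _ => by positivity)
    _ ≤ ∑ k ∈ Ico k0 (N+1), 2 * (1/(k:ℝ) - 1/((k+1:ℕ):ℝ)) := sum_le_sum h1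
    _ ≤ 2 / z := by
        rw [← mul_sum]
        have h2 : k0 ≤ N + 1 := by
          obtain ⟨k, hk⟩ := nonempty_iff_ne_empty.2 hne
          have := mem_Ico.1 (hsub hk); omega
        have h3 := sum_Ico_sub (fun k : ℕ => -(1/(k:ℝ))) h2
        have h4 : ∑ k ∈ Ico k0 (N+1), (1/(k:ℝ) - 1/((k+1:ℕ):ℝ)) = 1/(k0:ℝ) - 1/((N+1:ℕ):ℝ) := by
          rw [← sub_eq_zero]
          have : ∀ k : ℕ, (1/(k:ℝ) - 1/((k+1:ℕ):ℝ)) = -(1/((k+1:ℕ):ℝ)) - -(1/(k:ℝ)) := fun k => by ring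
          simp only [this]; rw [h3]; ring
        rw [h4]
        have h5 : 1/(k0:ℝ) ≤ 1/z := one_div_le_one_div_of_le hz hk0z.le
        have h6 : (0:ℝ) ≤ 1/((N+1:ℕ):ℝ) := by positivity
        have : 2/z = 2 * (1/z) := by ring
        linarith

end FI
end Part7

section Part8
open Matrix Finset
namespace FI

lemma box_num (T Q B y Y : ℝ) (hT : 10000 ≤ T) (hQ : 0 < Q) (hQ1 : T^32 ≤ 4*Q^2) (hQ2 : Q^2*T^32 ≤ y) (hY : Y ≤ y*T^4)
    (hB : T^30 ≤ B) (hBY : B*T^30 ≤ Y) (hy : 0 < y) :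
    ((5*B+8*Q^2*T)*(2*T^2/B)) * ((3*(Y/B)+8*Q^2*T)*(2*T^2*B/y)) ≤ Q^2 / T^20 := by
  have hT0 : 0 < T := by linarith
  have hB0 : 0 < B := lt_of_lt_of_le (by positivity) hB
  have e : ((5*B+8*Q^2*T)*(2*T^2/B)) * ((3*(Y/B)+8*Q^2*T)*(2*T^2*B/y)) =
      60 * (Y*T^4/y) + 160 * (Q^2 * (B * T^5 / y)) + 96 * (Q^2 * (T^5 * Y / (B * y))) + 256 * (Q^2 * (Q^2*T^6/y)) := by
    field_simp
    ring
  have t1 : Y*T^4/y ≤ Q^2 * (4 / T^21) := by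
    rw [div_le_iff₀ hy]
    calc Y * T^4 ≤ (y*T^4)*T^4 := by gcongr
      _ = (T^29) * y / T^21 := by field_simp
      _ ≤ (T^32) * y / T^21 := by gcongr; linarith; norm_num
      _ ≤ (4*Q^2)*y / T^21 := by gcongr
      _ = _ := by ring
  have t2 : B * T^5 / y ≤ 1/T^21 := by
    rw [div_le_div_iff₀ hy (by positivity)]
    have : B * T^30 ≤ y * T^4 := hBY.trans hY
    have h2 : B * T^26 * T^4 ≤ y * T^4 := by linarith [this, (by ring : B * T^26*T^4 = B*T^30)]
    have h3 := le_of_mul_le_mul_right h2 (by positivity)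
    linarith [(by ring : B * T^5 * T^21 = B * T^26)]
  have t3 : T^5 * Y / (B * y) ≤ 1/T^21 := by
    rw [div_le_div_iff₀ (by positivity) (by positivity)]
    calc T^5 * Y * T^21 ≤ T^5 * (y*T^4)*T^21 := by gcongr
      _ = T^30 * y := by ring
      _ ≤ B * y := by gcongr
      _ = _ := by ring
  have t4 : Q^2*T^6/y ≤ 1/T^21 := by
    rw [div_le_div_iff₀ hy (by positivity)]
    calc Q^2*T^6*T^21 = Q^2 * T^27 := by ring
      _ ≤ Q^2 * T^32 := by gcongr; linarith; norm_num
      _ ≤ 1 * y := by linarith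
  rw [e]
  have hQ2 : 0 < Q^2 := by positivity
  have s2 := mul_le_mul_of_nonneg_left t2 hQ2.le
  have s3 := mul_le_mul_of_nonneg_left t3 hQ2.le
  have s4 := mul_le_mul_of_nonneg_left t4 hQ2.le
  have s5 : Q^2 * (1/T^21) * T = Q^2 / T^20 := by field_simp
  have s6 : Q^2 * (1/T^21) * 10000 ≤ Q^2 * (1/T^21) * T := by gcongr
  have s7 : Q^2 * (4 / T^21) = 4 * (Q^2 * (1/T^21)) := by ring
  rw [s7] at t1
  have : 0 ≤ Q^2 * (1/T^21) := by positivity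
  linarith

lemma box_q {D y Y : ℕ} {T : ℝ} {χ : ℕ → ℤ} (h : SignChar D χ) (P : Par D y Y T) (PQ : Finset ℕ) (Q : ℕ)
    (hP : ∀ q ∈ PQ, q.Prime ∧ Q < q ∧ q ≤ 2*Q ∧ T^16 ≤ q ∧ (q:ℝ)^2 * T^32 ≤ y)
    (F G : Finset ℕ) (hF : ∀ m ∈ F, χ m ≠ 0) (hG : ∀ m ∈ G, χ m ≠ 0) (B : ℝ) (hB : T^30 ≤ B) (hBY : B*T^30 ≤ Y)
    (hF1 : ∀ m ∈ F, B ≤ m ∧ m ≤ 2*B) (hG1 : ∀ k ∈ G, y/B < k ∧ k ≤ Y/B) (a b : ℕ → ℝ)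
    (ha : ∀ m ∈ F, |a m| ≤ T / m) (hb : ∀ k ∈ G, |b k| ≤ T / k) :
    ∑ q ∈ PQ, |∑ m ∈ F, ∑ k ∈ G, a m * b k * Kq χ q (m*k)| ≤ 1/T^10 := by
  have hT0 : 0 < T := by linarith [P.T1]
  have hB0 : 0 < B := lt_of_lt_of_le (by positivity) hB
  have hy0 : (0:ℝ) < y := lt_of_lt_of_le (by positivity) P.big
  by_cases hne : PQ = ∅
  · subst hne; simp; positivity
  obtain ⟨q0, hq0⟩ := nonempty_iff_ne_empty.2 hne
  obtain ⟨hq0p, hq0a, hq0b, hq0c, hq0d⟩ := hP q0 hq0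
  have hQ1 : 1 ≤ Q := by have := hq0p.two_le; omega
  have hQR : (1:ℝ) ≤ Q := by exact_mod_cast hQ1
  have hQa : (Q:ℝ) ≤ q0 := by exact_mod_cast hq0a.le
  have hQb : (q0:ℝ) ≤ 2*Q := by exact_mod_cast hq0b
  refine (box_bound h PQ Q hQ1 (fun q hq => ⟨(hP q hq).1, (hP q hq).2.1, (hP q hq).2.2.1⟩) F G hF hG ⌊2*B⌋₊ ⌊Y/B⌋₊
    (fun m hm => Nat.le_floor (hF1 m hm).2) (fun k hk => Nat.le_floor (hG1 k hk).2) a b).trans ?_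
  have hQ2 : (Q:ℝ)^2*T^32 ≤ y := le_trans (by gcongr) hq0d
  have hQ3 : T^32 ≤ 4*(Q:ℝ)^2 := by
    calc T^32 = (T^16)^2 := by ring
      _ ≤ (2*(Q:ℝ))^2 := by gcongr; linarith
      _ = _ := by ring
  have hT1 : 1 ≤ T := by linarith [P.T1]
  have hyY : (y:ℝ) ≤ Y := by exact_mod_cast P.yY
  have hl : 1 + Real.log (4*(Q:ℝ)^2) ≤ T := by
    have h1 : Real.log (4*(Q:ℝ)^2) ≤ Real.log (4*Y+4) := by
      apply Real.log_le_log (by positivity)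
      have : (Q:ℝ)^2 * 1 ≤ (Q:ℝ)^2*T^32 := by gcongr; exact one_le_pow₀ hT1
      linarith
    linarith [P.lg]
  have hl0 : 0 ≤ 1 + Real.log (4*(Q:ℝ)^2) := by
    have : 0 ≤ Real.log (4*(Q:ℝ)^2) := Real.log_nonneg (by nlinarith)
    linarith
  have hB1 : 1 ≤ B := le_trans (one_le_pow₀ hT1) hB
  have hYB : 1 ≤ Y/B := by
    rw [le_div_iff₀ hB0]
    calc 1 * B = B * 1 := by ring
      _ ≤ B * T^30 := by gcongr; exact one_le_pow₀ hT1
      _ ≤ Y := hBY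
  have X1 : (2*(⌊2*B⌋₊:ℝ)+1 + 8*(Q:ℝ)^2 * (1 + Real.log (4*(Q:ℝ)^2))) * ∑ m ∈ F, (a m)^2 ≤ (5*B+8*(Q:ℝ)^2*T)*(2*T^2/B) := by
    have f1 : (⌊2*B⌋₊:ℝ) ≤ 2*B := Nat.floor_le (by positivity)
    have f2 : ∑ m ∈ F, (a m)^2 ≤ 2*T^2/B := by
      have g1 : ∀ m ∈ F, (a m)^2 ≤ T^2/B^2 := by
        intro m hm
        have hm1 := (hF1 m hm).1
        rw [← sq_abs, ← div_pow]
        have : |a m| ≤ T/B := (ha m hm).trans (by gcongr)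
        gcongr
      have g2 : (#F:ℝ) ≤ 2*B := by
        have : F ⊆ Ioc 0 ⌊2*B⌋₊ := by
          intro m hm
          obtain ⟨u, v⟩ := hF1 m hm
          rw [mem_Ioc]
          refine ⟨?_, Nat.le_floor v⟩
          have : (0:ℝ) < m := by linarith
          exact_mod_cast this
        have := card_le_card this
        rw [Nat.card_Ioc] at this
        have h3 : (#F:ℝ) ≤ (⌊2*B⌋₊:ℝ) := by exact_mod_cast this
        linarith
      calc ∑ m ∈ F, (a m)^2 ≤ ∑ m ∈ F, T^2/B^2 := sum_le_sum g1
        _ = #F * (T^2/B^2) := by rw [sum_const, nsmul_eq_mul]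
        _ ≤ (2*B) * (T^2/B^2) := by gcongr
        _ = 2*T^2/B := by field_simp
    have f3 : (0:ℝ) ≤ ∑ m ∈ F, (a m)^2 := sum_nonneg fun _ _ => sq_nonneg _
    have f4 : 8*(Q:ℝ)^2 * (1 + Real.log (4*(Q:ℝ)^2)) ≤ 8*(Q:ℝ)^2*T := by gcongr
    apply mul_le_mul (by linarith) f2 f3 (by positivity)
  have X2 : (2*(⌊Y/B⌋₊:ℝ)+1 + 8*(Q:ℝ)^2 * (1 + Real.log (4*(Q:ℝ)^2))) * ∑ m ∈ G, (b m)^2 ≤ (3*(Y/B)+8*(Q:ℝ)^2*T)*(2*T^2*B/y) := by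
    have f1 : (⌊Y/B⌋₊:ℝ) ≤ Y/B := Nat.floor_le (by positivity)
    have f2 : ∑ m ∈ G, (b m)^2 ≤ 2*T^2*B/y := by
      calc ∑ m ∈ G, (b m)^2 ≤ ∑ m ∈ G, T^2 * (1/(m:ℝ))^2 := by
            apply sum_le_sum
            intro m hm
            have := hb m hm
            calc (b m)^2 = |b m|^2 := (sq_abs _).symm
              _ ≤ (T/m)^2 := by gcongr
              _ = _ := by ring
        _ = T^2 * ∑ m ∈ G, (1/(m:ℝ))^2 := by rw [mul_sum]
        _ ≤ T^2 * (2/(y/B)) := by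
            gcongr
            exact sum_inv_sq_le G _ (by positivity) (fun k hk => (hG1 k hk).1)
        _ = _ := by field_simp
    have f3 : (0:ℝ) ≤ ∑ m ∈ G, (b m)^2 := sum_nonneg fun _ _ => sq_nonneg _
    have f4 : 8*(Q:ℝ)^2 * (1 + Real.log (4*(Q:ℝ)^2)) ≤ 8*(Q:ℝ)^2*T := by gcongr
    apply mul_le_mul (by linarith) f2 f3 (by positivity)
  have X3 := box_num T Q B y Y P.T1 (by linarith) hQ3 hQ2 P.Yy hB hBY hy0
  calc _ ≤ (1/(Q:ℝ)) * (√((5*B+8*(Q:ℝ)^2*T)*(2*T^2/B)) * √((3*(Y/B)+8*(Q:ℝ)^2*T)*(2*T^2*B/y))) := by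
        apply mul_le_mul_of_nonneg_left _ (by positivity)
        exact mul_le_mul (Real.sqrt_le_sqrt X1) (Real.sqrt_le_sqrt X2) (Real.sqrt_nonneg _) (Real.sqrt_nonneg _)
    _ ≤ (1/(Q:ℝ)) * √((Q:ℝ)^2 / T^20) := by
        rw [← Real.sqrt_mul (by positivity)]
        apply mul_le_mul_of_nonneg_left (Real.sqrt_le_sqrt X3) (by positivity)
    _ = 1/T^10 := by
        have : (Q:ℝ)^2 / T^20 = (Q/T^10)^2 := by ring
        rw [this, Real.sqrt_sq (by positivity)]
        field_simp

lemma box_all {D y Y : ℕ} {T : ℝ} {χ : ℕ → ℤ} (h : SignChar D χ) (P : Par D y Y T) (PQ : Finset ℕ)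
    (hP : ∀ q ∈ PQ, q.Prime ∧ T^16 ≤ q ∧ (q:ℝ)^2 * T^32 ≤ y)
    (F G : Finset ℕ) (hF : ∀ m ∈ F, χ m ≠ 0) (hG : ∀ m ∈ G, χ m ≠ 0) (B : ℝ) (hB : T^30 ≤ B) (hBY : B*T^30 ≤ Y)
    (hF1 : ∀ m ∈ F, B ≤ m ∧ m ≤ 2*B) (hG1 : ∀ k ∈ G, y/B < k ∧ k ≤ Y/B) (a b : ℕ → ℝ)
    (ha : ∀ m ∈ F, |a m| ≤ T / m) (hb : ∀ k ∈ G, |b k| ≤ T / k) :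
    ∑ q ∈ PQ, |∑ m ∈ F, ∑ k ∈ G, a m * b k * Kq χ q (m*k)| ≤ 3/T^9 := by
  have hT0 : 0 < T := by linarith [P.T1]
  have hT1 : 1 ≤ T := by linarith [P.T1]
  rw [← sum_fiberwise_of_maps_to (g := fun q => Nat.log 2 (q-1)) (t := range (Nat.log 2 Y + 1)) ?_]
  · calc _ ≤ ∑ i ∈ range (Nat.log 2 Y + 1), 1/T^10 := by
          apply sum_le_sum
          intro i _
          apply box_q h P _ (2^i) _ F G hF hG B hB hBY hF1 hG1 a b ha hb
          intro q hq
          rw [mem_filter] at hq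
          obtain ⟨hq, hi⟩ := hq
          obtain ⟨h1, h2, h3⟩ := hP q hq
          have h4 := h1.two_le
          have h5 := Nat.pow_log_le_self 2 (x := q-1) (by omega)
          have h6 := Nat.lt_pow_succ_log_self (b := 2) (by norm_num) (q-1)
          rw [hi] at h5 h6
          rw [Nat.succ_eq_add_one, pow_succ] at h6
          exact ⟨h1, by omega, by omega, h2, h3⟩
      _ = (Nat.log 2 Y + 1) * (1/T^10) := by rw [sum_const, card_range, nsmul_eq_mul]; push_cast; ring
      _ ≤ (3*T) * (1/T^10) := by
          gcongr
          have hY0 : Y ≠ 0 := by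
            intro h0
            have := P.yY
            have h2 := P.big
            have : y = 0 := by omega
            rw [this] at h2
            have : 0 < T^400 := by positivity
            push_cast at h2; linarith
          have h1 := Nat.pow_log_le_self 2 hY0
          have h2 : ((2:ℝ)^(Nat.log 2 Y)) ≤ Y := by exact_mod_cast h1
          have h3 := Real.log_le_log (by positivity) h2
          rw [Real.log_pow] at h3
          have h4 := Real.log_two_gt_d9
          have hY1 : (1:ℝ) ≤ Y := by exact_mod_cast Nat.one_le_iff_ne_zero.2 hY0
          have h5 : Real.log Y ≤ Real.log (4*Y+4) := Real.log_le_log (by linarith) (by linarith)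
          have h6 := P.lg
          have h7 : (Nat.log 2 Y : ℝ) * (1/2) ≤ Nat.log 2 Y * Real.log 2 := by gcongr; linarith
          linarith
      _ = _ := by field_simp
  · intro q hq
    obtain ⟨h1, h2, h3⟩ := hP q hq
    rw [mem_range]
    have : Nat.log 2 (q-1) ≤ Nat.log 2 Y := by
      apply Nat.log_mono_right
      have h4 : (q:ℝ)^2*1 ≤ (q:ℝ)^2 * T^32 := by gcongr; exact one_le_pow₀ hT1
      have h5 : (q:ℝ)^2 ≤ (y:ℝ) := by linarith
      have h6 : q^2 ≤ y := by exact_mod_cast h5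
      have := P.yY
      have : q ≤ q^2 := Nat.le_self_pow (by norm_num) q
      omega
    omega
end FI
end Part8

section Part9
open Matrix Finset
open scoped ArithmeticFunction.vonMangoldt
namespace FI

lemma sum_log_primes_dvd (n : ℕ) (hn : n ≠ 0) (PQ : Finset ℕ) (hP : ∀ q ∈ PQ, q.Prime ∧ q ∣ n) :
    ∑ q ∈ PQ, Real.log q ≤ Real.log n := by
  rw [← ArithmeticFunction.vonMangoldt_sum (n := n)]
  calc ∑ q ∈ PQ, Real.log q = ∑ q ∈ PQ, Λ q := by
        apply sum_congr rfl
        intro q hq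
        rw [ArithmeticFunction.vonMangoldt_apply_prime (hP q hq).1]
    _ ≤ _ := by
        apply sum_le_sum_of_subset_of_nonneg
        · intro q hq; rw [Nat.mem_divisors]; exact ⟨(hP q hq).2, hn⟩
        · intros; exact ArithmeticFunction.vonMangoldt_nonneg

lemma sum_inv_primes_le (PQ : Finset ℕ) (y : ℕ) (hy : 1 ≤ y) (hP : ∀ q ∈ PQ, 2 ≤ q ∧ q ≤ y) :
    ∑ q ∈ PQ, 1/(q:ℝ) ≤ Real.log y := by
  have h1 := harmonic_le (y := 1) (Y := y) le_rfl hy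
  simp only [Nat.cast_one, Real.log_one, sub_zero] at h1
  refine le_trans ?_ h1
  apply sum_le_sum_of_subset_of_nonneg
  · intro q hq; have := hP q hq; rw [mem_Ioc]; omega
  · intros; positivity

lemma SignChar.natAbs_le {D : ℕ} {χ : ℕ → ℤ} (h : SignChar D χ) (n : ℕ) : (sg χ n - 1).natAbs ≤ n + 1 := by
  rcases h.val n with h1 | h1 | h1 <;> simp only [sg, h1] <;> omega

lemma SignChar.natAbs_ne {D : ℕ} {χ : ℕ → ℤ} (h : SignChar D χ) (n : ℕ) (hn : 2 ≤ n) : (sg χ n - 1).natAbs ≠ 0 := by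
  rcases h.val n with h1 | h1 | h1 <;> simp only [sg, h1] <;> omega

lemma sg_eq_one_iff (χ : ℕ → ℤ) (q n : ℕ) : ((sg χ n : ℤ) : ZMod q) = 1 ↔ q ∣ (sg χ n - 1).natAbs := by
  rw [← Int.natCast_dvd, ← ZMod.intCast_zmod_eq_zero_iff_dvd]
  push_cast
  rw [sub_eq_zero]

lemma kq_sum {D y Y : ℕ} {T : ℝ} {χ : ℕ → ℤ} (h : SignChar D χ) (P : Par D y Y T) (PQ : Finset ℕ)
    (hP : ∀ q ∈ PQ, q.Prime ∧ q ≤ y) (n : ℕ) (hn : 2 ≤ n) (hn2 : n ≤ 4*Y) :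
    ∑ q ∈ PQ, Real.log q * |Kq χ q n| ≤ 3*T^2 := by
  have hT0 : 0 < T := by linarith [P.T1]
  have hyY : (y:ℝ) ≤ Y := by exact_mod_cast P.yY
  have hlg : ∀ r : ℕ, 1 ≤ r → r ≤ 4*Y+4 → Real.log r ≤ T := by
    intro r h1 h2
    have h3 : (r:ℝ) ≤ 4*Y+4 := by exact_mod_cast h2
    have : Real.log r ≤ Real.log (4*Y+4) := Real.log_le_log (by exact_mod_cast h1) h3
    linarith [P.lg]
  have h1 : ∀ q ∈ PQ, Real.log q * |Kq χ q n| ≤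
      (if q ∣ (sg χ n - 1).natAbs then Real.log q else 0) + 2 * T * (1/(q:ℝ)) := by
    intro q hq
    obtain ⟨hp, hqy⟩ := hP q hq
    have hq2 : (2:ℝ) ≤ q := by exact_mod_cast hp.two_le
    have hl0 : 0 ≤ Real.log q := Real.log_nonneg (by linarith)
    have hlT : Real.log q ≤ T := hlg q hp.one_lt.le (by have := P.yY; omega)
    have hk : |Kq χ q n| ≤ (if q ∣ (sg χ n - 1).natAbs then 1 else 0) + 2 * (1/(q:ℝ)) := by
      rw [Kq]
      refine (abs_sub _ _).trans ?_
      apply add_le_add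
      · by_cases hd : q ∣ (sg χ n - 1).natAbs
        · rw [if_pos ((sg_eq_one_iff χ q n).2 hd), if_pos hd, abs_one]
        · rw [if_neg (fun h0 => hd ((sg_eq_one_iff χ q n).1 h0)), if_neg hd, abs_zero]
      · have h2 : 1/((q:ℝ)-1) ≤ 2 * (1/(q:ℝ)) := by
          rw [mul_one_div, div_le_div_iff₀ (by linarith) (by linarith)]; linarith
        have h3 : 0 ≤ 1/((q:ℝ)-1) := by apply div_nonneg zero_le_one; linarith
        split_ifs
        · rw [abs_of_nonneg h3]; exact h2
        · rw [abs_zero]; positivity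
    calc Real.log q * |Kq χ q n| ≤ Real.log q * ((if q ∣ (sg χ n - 1).natAbs then 1 else 0) + 2 * (1/(q:ℝ))) := by gcongr
      _ = (if q ∣ (sg χ n - 1).natAbs then Real.log q else 0) + 2 * Real.log q * (1/(q:ℝ)) := by
          split_ifs <;> ring
      _ ≤ _ := by gcongr
  refine (sum_le_sum h1).trans ?_
  rw [sum_add_distrib, ← mul_sum, ← sum_filter]
  have hne := h.natAbs_ne n hn
  have h2 := sum_log_primes_dvd _ hne (PQ.filter (fun q => q ∣ (sg χ n - 1).natAbs)) (fun q hq => by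
    rw [mem_filter] at hq; exact ⟨(hP q hq.1).1, hq.2⟩)
  have h3 := hlg (sg χ n - 1).natAbs (Nat.one_le_iff_ne_zero.2 hne) (by have := h.natAbs_le n; omega)
  by_cases hy : 1 ≤ y
  · have h4 := sum_inv_primes_le PQ y hy (fun q hq => ⟨(hP q hq).1.two_le, (hP q hq).2⟩)
    have h5 := hlg y hy (by have := P.yY; omega)
    have h6 : 2 * T * ∑ q ∈ PQ, 1/(q:ℝ) ≤ 2 * T * T := by gcongr; linarith
    have h7 := P.T1
    have h8 : T * 1 ≤ T * T := by gcongr; linarith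
    have : T^2 = T*T := by ring
    linarith
  · exfalso
    have h5 := P.big
    have : y = 0 := by omega
    rw [this] at h5
    have : 0 < T^400 := by positivity
    push_cast at h5; linarith

lemma pair_sum (S1 S2 Bd : Finset ℕ) (hB : ∀ n ∈ Bd, n ≠ 0) (g : ℕ → ℝ) (hg : ∀ n, 0 ≤ g n) :
    ∑ m ∈ S1, ∑ k ∈ S2, (if m*k ∈ Bd then g (m*k) else 0) ≤ ∑ n ∈ Bd, #n.divisors * g n := by
  rw [← sum_product']
  rw [← sum_filter]
  rw [← sum_fiberwise_of_maps_to (g := fun p : ℕ × ℕ => p.1 * p.2) (t := Bd) (fun p hp => (mem_filter.1 hp).2)]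
  apply sum_le_sum
  intro n hn
  have h1 : ∀ p ∈ ((S1 ×ˢ S2).filter (fun p => p.1 * p.2 ∈ Bd)).filter (fun p => p.1 * p.2 = n), g (p.1*p.2) = g n := by
    intro p hp
    rw [(mem_filter.1 hp).2]
  rw [sum_congr rfl h1, sum_const, nsmul_eq_mul]
  apply mul_le_mul_of_nonneg_right _ (hg n)
  norm_cast
  apply card_le_card_of_injOn (fun p => p.1)
  · intro p hp
    have := (mem_filter.1 hp).2
    simp only [mem_coe, Nat.mem_divisors]
    exact ⟨⟨p.2, this.symm⟩, hB n hn⟩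
  · rintro ⟨a, b⟩ hp ⟨a', b'⟩ hp' (haa : a = a')
    have h2 : a * b = n := (mem_filter.1 hp).2
    have h3 : a' * b' = n := (mem_filter.1 hp').2
    subst haa
    have ha : a ≠ 0 := by rintro rfl; exact hB n hn (by omega)
    have : b = b' := Nat.eq_of_mul_eq_mul_left (Nat.pos_of_ne_zero ha) (h2.trans h3.symm)
    rw [this]
end FI
end Part9

section Part10
open Matrix Finset
open scoped ArithmeticFunction.vonMangoldt
namespace FI

noncomputable def jj (θ : ℝ) (m : ℕ) : ℕ := ⌊Real.log m / θ⌋₊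

lemma jj_le {θ : ℝ} (hθ : 0 < θ) {m : ℕ} (hm : 1 ≤ m) : Real.exp (θ * jj θ m) ≤ m := by
  have hm1 : (1:ℝ) ≤ m := by exact_mod_cast hm
  have h1 : (jj θ m : ℝ) ≤ Real.log m / θ := Nat.floor_le (div_nonneg (Real.log_nonneg hm1) hθ.le)
  rw [le_div_iff₀ hθ] at h1
  calc Real.exp (θ * jj θ m) ≤ Real.exp (Real.log m) := Real.exp_le_exp.2 (by linarith)
    _ = m := Real.exp_log (by linarith)

lemma jj_lt {θ : ℝ} (hθ : 0 < θ) {m : ℕ} (hm : 1 ≤ m) : (m:ℝ) < Real.exp (θ * jj θ m) * Real.exp θ := by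
  have hm1 : (1:ℝ) ≤ m := by exact_mod_cast hm
  have h1 : Real.log m / θ < (jj θ m : ℝ) + 1 := Nat.lt_floor_add_one _
  rw [div_lt_iff₀ hθ] at h1
  rw [← Real.exp_add]
  calc (m:ℝ) = Real.exp (Real.log m) := (Real.exp_log (by linarith)).symm
    _ < _ := Real.exp_lt_exp.2 (by linarith)

/-- separation of variables for one modulus -/
lemma sep_q {y Y : ℕ} (θ : ℝ) (hθ : 0 < θ) (J : ℕ) (hJ : ∀ m, 1 ≤ m → m ≤ Y → jj θ m < J)
    (t : ℕ → ℕ → ℝ) :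
    |∑ m ∈ Ioc 0 Y, ∑ k ∈ Ioc 0 Y, (if y < m*k ∧ m*k ≤ Y then t m k else 0)| ≤
      ∑ j ∈ range J, |∑ m ∈ Ioc 0 Y with jj θ m = j, ∑ k ∈ (Ioc 0 Y).filter (fun k : ℕ => (y:ℝ) < k * Real.exp (θ*j) ∧ k * Real.exp (θ*j) ≤ Y), t m k| +
      ∑ m ∈ Ioc 0 Y, ∑ k ∈ Ioc 0 Y, (if m*k ∈ Ioc y ⌊Real.exp θ * y⌋₊ ∪ Ioc Y ⌊Real.exp θ * Y⌋₊ then |t m k| else 0) := by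
  classical
  have e1 : ∑ j ∈ range J, ∑ m ∈ Ioc 0 Y with jj θ m = j, ∑ k ∈ (Ioc 0 Y).filter (fun k : ℕ => (y:ℝ) < k * Real.exp (θ*j) ∧ k * Real.exp (θ*j) ≤ Y), t m k
      = ∑ m ∈ Ioc 0 Y, ∑ k ∈ Ioc 0 Y, (if (y:ℝ) < k * Real.exp (θ*jj θ m) ∧ k * Real.exp (θ*jj θ m) ≤ Y then t m k else 0) := by
    rw [← sum_fiberwise_of_maps_to (s := Ioc 0 Y) (g := fun m => jj θ m) (t := range J)]
    · apply sum_congr rfl; intro j _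
      apply sum_congr rfl; intro m hm
      rw [(mem_filter.1 hm).2, sum_filter]
    · intro m hm; rw [mem_Ioc] at hm; exact mem_range.2 (hJ m hm.1 hm.2)
  have e2 : ∑ m ∈ Ioc 0 Y, ∑ k ∈ Ioc 0 Y, (if y < m*k ∧ m*k ≤ Y then t m k else 0) =
      ∑ j ∈ range J, ∑ m ∈ Ioc 0 Y with jj θ m = j, ∑ k ∈ (Ioc 0 Y).filter (fun k : ℕ => (y:ℝ) < k * Real.exp (θ*j) ∧ k * Real.exp (θ*j) ≤ Y), t m k
      + ∑ m ∈ Ioc 0 Y, ∑ k ∈ Ioc 0 Y, ((if y < m*k ∧ m*k ≤ Y then t m k else 0) -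
        (if (y:ℝ) < k * Real.exp (θ*jj θ m) ∧ k * Real.exp (θ*jj θ m) ≤ Y then t m k else 0)) := by
    rw [e1]
    simp only [sum_sub_distrib]
    ring
  rw [e2]
  refine (abs_add_le _ _).trans (add_le_add (abs_sum_le_sum_abs _ _) ?_)
  refine (abs_sum_le_sum_abs _ _).trans (sum_le_sum fun m hm => ?_)
  refine (abs_sum_le_sum_abs _ _).trans (sum_le_sum fun k hk => ?_)
  rw [mem_Ioc] at hm hk
  have h1 := jj_le hθ (m := m) hm.1
  have h2 := jj_lt hθ (m := m) hm.1
  have hk0 : (0:ℝ) < k := by exact_mod_cast hk.1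
  generalize Real.exp (θ * jj θ m) = B at h1 h2
  have h3 : (k:ℝ) * B ≤ ((m*k:ℕ):ℝ) := by push_cast; have := mul_le_mul_of_nonneg_left h1 hk0.le; linarith
  have h4 : ((m*k:ℕ):ℝ) < Real.exp θ * (k * B) := by push_cast; have := mul_lt_mul_of_pos_left h2 hk0; linarith
  have hE : 0 < Real.exp θ := Real.exp_pos _
  by_cases c1 : y < m*k ∧ m*k ≤ Y <;> by_cases c2 : (y:ℝ) < k * B ∧ k * B ≤ Y
  · rw [if_pos c1, if_pos c2, sub_self, abs_zero]; split_ifs <;> positivity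
  · rw [if_pos c1, if_neg c2, sub_zero, if_pos]
    rw [mem_union]; left
    rw [mem_Ioc]
    refine ⟨c1.1, Nat.le_floor ?_⟩
    have h5 : ((m*k:ℕ):ℝ) ≤ Y := by exact_mod_cast c1.2
    have h6 : (k:ℝ) * B ≤ y := by
      by_contra h7; push Not at h7
      exact c2 ⟨h7, h3.trans h5⟩
    have := mul_le_mul_of_nonneg_left h6 hE.le
    linarith
  · rw [if_neg c1, if_pos c2, zero_sub, abs_neg, if_pos]
    rw [mem_union]; right
    rw [mem_Ioc]
    constructor
    · by_contra h7; push Not at h7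
      apply c1
      refine ⟨?_, h7⟩
      have : (y:ℝ) < ((m*k:ℕ):ℝ) := by linarith [c2.1]
      exact_mod_cast this
    · apply Nat.le_floor
      have := mul_le_mul_of_nonneg_left c2.2 hE.le
      linarith
  · rw [if_neg c1, if_neg c2, sub_self, abs_zero]; split_ifs <;> positivity

lemma sum_filter_and_of_zero (F : Finset ℕ) (p r : ℕ → Prop) [DecidablePred p] [DecidablePred r] (f : ℕ → ℝ)
    (hz : ∀ x, ¬ r x → f x = 0) : ∑ x ∈ F.filter p, f x = ∑ x ∈ F.filter (fun x => p x ∧ r x), f x := by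
  symm
  apply sum_subset
  · intro x hx; rw [mem_filter] at hx ⊢; exact ⟨hx.1, hx.2.1⟩
  · intro x hx hx2
    apply hz
    intro h
    rw [mem_filter] at hx
    exact hx2 (mem_filter.2 ⟨hx.1, hx.2, h⟩)

lemma bdry_sum (θ : ℝ) (hθ : 0 < θ) (y : ℕ) (hy : 1 ≤ y) : ∑ n ∈ Ioc y ⌊Real.exp θ * y⌋₊, 1/(n:ℝ) ≤ θ := by
  have hy0 : (1:ℝ) ≤ y := by exact_mod_cast hy
  have hE : 1 ≤ Real.exp θ := Real.one_le_exp hθ.le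
  have h1 : y ≤ ⌊Real.exp θ * y⌋₊ := Nat.le_floor (by nlinarith)
  have h2 := harmonic_le hy h1
  have h3 : ((⌊Real.exp θ * y⌋₊:ℕ):ℝ) ≤ Real.exp θ * y := Nat.floor_le (by positivity)
  have h4 : (0:ℝ) < (⌊Real.exp θ * y⌋₊:ℕ) := by exact_mod_cast lt_of_lt_of_le (by omega : 0 < y) h1
  have h5 := Real.log_le_log h4 h3
  rw [Real.log_mul (by positivity) (by linarith), Real.log_exp] at h5
  linarith

lemma typeII {D y Y : ℕ} {T : ℝ} {χ : ℕ → ℤ} (h : SignChar D χ) (P : Par D y Y T) (PQ : Finset ℕ)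
    (hP : ∀ q ∈ PQ, q.Prime ∧ T^16 ≤ q ∧ (q:ℝ)^2 * T^32 ≤ y) (U : ℕ) (hU : T^31 ≤ U) (a b : ℕ → ℝ)
    (ha : ∀ m, 0 < m → m ≤ Y → |a m| ≤ T / m) (hb : ∀ m, 0 < m → m ≤ Y → |b m| ≤ T / m)
    (ha0 : ∀ m, m ≤ U → a m = 0) (hb0 : ∀ m, m ≤ U → b m = 0)
    (hac : ∀ m, χ m = 0 → a m = 0) (hbc : ∀ m, χ m = 0 → b m = 0) :
    ∑ q ∈ PQ, Real.log q * |∑ m ∈ Ioc 0 Y, ∑ k ∈ Ioc 0 Y, (if y < m*k ∧ m*k ≤ Y then a m * b k * Kq χ q (m*k) else 0)|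
      ≤ 12/T := by
  have hT1 := P.T1
  have hT0 : 0 < T := by linarith
  have hyY : (y:ℝ) ≤ Y := by exact_mod_cast P.yY
  have hy1R : (1:ℝ) ≤ y := le_trans (one_le_pow₀ (by linarith)) P.big
  have hy1 : 1 ≤ y := by exact_mod_cast hy1R
  have hY1 : 1 ≤ Y := hy1.trans P.yY
  have hlg : ∀ r : ℕ, 1 ≤ r → r ≤ 4*Y+4 → Real.log r ≤ T := by
    intro r h1 h2
    have h3 : (r:ℝ) ≤ 4*Y+4 := by exact_mod_cast h2
    have : Real.log r ≤ Real.log (4*Y+4) := Real.log_le_log (by exact_mod_cast h1) h3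
    linarith [P.lg]
  have hPy : ∀ q ∈ PQ, q.Prime ∧ q ≤ y := by
    intro q hq
    obtain ⟨h1, h2, h3⟩ := hP q hq
    refine ⟨h1, ?_⟩
    have h4 : (q:ℝ)^2*1 ≤ (q:ℝ)^2 * T^32 := by gcongr; exact one_le_pow₀ (by linarith)
    have h5 : (q:ℝ)^2 ≤ (y:ℝ) := by linarith
    have h6 : q^2 ≤ y := by exact_mod_cast h5
    exact le_trans (Nat.le_self_pow (by norm_num) q) h6
  set θ : ℝ := 1/T^6 with hθd
  have hθ : 0 < θ := by positivity
  have hθ1 : θ ≤ 1/2 := by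
    rw [hθd]
    apply one_div_le_one_div_of_le (by norm_num)
    calc (2:ℝ) ≤ T := by linarith
      _ ≤ T^6 := le_self_pow₀ (by linarith) (by norm_num)
  have hE2 : Real.exp θ ≤ 2 := by
    have h1 : Real.exp θ ≤ Real.exp (1/2) := Real.exp_le_exp.2 hθ1
    have h2 := Real.exp_one_lt_d9
    have h3 : Real.exp (1/2) * Real.exp (1/2) = Real.exp 1 := by rw [← Real.exp_add]; norm_num
    nlinarith [Real.exp_pos (1/2)]
  set J : ℕ := ⌊T^7⌋₊ + 1 with hJd
  have hJ : ∀ m, 1 ≤ m → m ≤ Y → jj θ m < J := by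
    intro m h1 h2
    have h3 := hlg m h1 (by omega)
    rw [hJd, Nat.lt_succ_iff, jj]
    apply Nat.floor_le_floor
    rw [hθd, div_le_iff₀ (by positivity)]
    calc Real.log m ≤ T := h3
      _ = T^7 * (1/T^6) := by field_simp
  set Bd := Ioc y ⌊Real.exp θ * y⌋₊ ∪ Ioc Y ⌊Real.exp θ * Y⌋₊ with hBd
  have hBd1 : ∀ n ∈ Bd, 2 ≤ n ∧ n ≤ 4*Y := by
    intro n hn
    rw [hBd, mem_union, mem_Ioc, mem_Ioc] at hn
    have hf : ⌊Real.exp θ * Y⌋₊ ≤ 4*Y := by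
      rw [← Nat.floor_natCast (R := ℝ) (4*Y)]
      apply Nat.floor_le_floor
      push_cast
      have : Real.exp θ * Y ≤ 2 * Y := by gcongr
      linarith [(by positivity : (0:ℝ) ≤ Y)]
    have hf2 : ⌊Real.exp θ * y⌋₊ ≤ ⌊Real.exp θ * Y⌋₊ := by
      apply Nat.floor_le_floor; gcongr
    have := P.yY
    omega
  -- pointwise bound
  have main : ∀ q ∈ PQ, Real.log q * |∑ m ∈ Ioc 0 Y, ∑ k ∈ Ioc 0 Y, (if y < m*k ∧ m*k ≤ Y then a m * b k * Kq χ q (m*k) else 0)|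
      ≤ T * ∑ j ∈ range J, |∑ m ∈ (Ioc 0 Y).filter (fun m => jj θ m = j ∧ U < m ∧ χ m ≠ 0),
        ∑ k ∈ (Ioc 0 Y).filter (fun k : ℕ => ((y:ℝ) < k * Real.exp (θ*j) ∧ k * Real.exp (θ*j) ≤ Y) ∧ U < k ∧ χ k ≠ 0), a m * b k * Kq χ q (m*k)| +
        ∑ n ∈ Bd, #n.divisors * (T^2/n * (Real.log q * |Kq χ q n|)) := by
    intro q hq
    have hq1 := (hPy q hq).1.one_lt.le
    have hl0 : 0 ≤ Real.log q := Real.log_nonneg (by exact_mod_cast hq1)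
    have hlT : Real.log q ≤ T := hlg q hq1 (by have := (hPy q hq).2; have := P.yY; omega)
    have h1 := sep_q (y := y) (Y := Y) θ hθ J hJ (fun m k => a m * b k * Kq χ q (m*k))
    rw [← hBd] at h1
    have h2 : ∑ m ∈ Ioc 0 Y, ∑ k ∈ Ioc 0 Y, (if m*k ∈ Bd then |a m * b k * Kq χ q (m*k)| else 0) ≤
        ∑ n ∈ Bd, #n.divisors * (T^2/n * |Kq χ q n|) := by
      refine le_trans ?_ (pair_sum (Ioc 0 Y) (Ioc 0 Y) Bd (fun n hn => by have := hBd1 n hn; omega) (fun n => T^2/n * |Kq χ q n|)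
        (fun n => by positivity))
      apply sum_le_sum; intro m hm
      apply sum_le_sum; intro k hk
      rw [mem_Ioc] at hm hk
      split_ifs
      · rw [abs_mul, abs_mul]
        have : |a m| * |b k| ≤ T/m * (T/k) := by
          gcongr
          · exact ha m hm.1 hm.2
          · exact hb k hk.1 hk.2
        have e : T/m * (T/k) = T^2/((m*k:ℕ):ℝ) := by push_cast; ring
        rw [e] at this
        gcongr
      · exact le_rfl
    have h3 : ∀ j ∈ range J, |∑ m ∈ Ioc 0 Y with jj θ m = j, ∑ k ∈ (Ioc 0 Y).filter (fun k : ℕ => (y:ℝ) < k * Real.exp (θ*j) ∧ k * Real.exp (θ*j) ≤ Y), a m * b k * Kq χ q (m*k)|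
        = |∑ m ∈ (Ioc 0 Y).filter (fun m => jj θ m = j ∧ U < m ∧ χ m ≠ 0),
        ∑ k ∈ (Ioc 0 Y).filter (fun k : ℕ => ((y:ℝ) < k * Real.exp (θ*j) ∧ k * Real.exp (θ*j) ≤ Y) ∧ U < k ∧ χ k ≠ 0), a m * b k * Kq χ q (m*k)| := by
      intro j _
      congr 1
      have hz : ∀ m, ¬ (U < m ∧ χ m ≠ 0) → a m = 0 := by
        intro m hn
        by_cases hm : m ≤ U
        · exact ha0 m hm
        · apply hac; by_contra h0; exact hn ⟨by omega, h0⟩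
      have hz2 : ∀ m, ¬ (U < m ∧ χ m ≠ 0) → b m = 0 := by
        intro m hn
        by_cases hm : m ≤ U
        · exact hb0 m hm
        · apply hbc; by_contra h0; exact hn ⟨by omega, h0⟩
      rw [sum_filter_and_of_zero (Ioc 0 Y) (fun m => jj θ m = j) (fun m => U < m ∧ χ m ≠ 0)]
      · apply sum_congr rfl
        intro m _
        apply sum_filter_and_of_zero (Ioc 0 Y)
        intro k hk
        rw [hz2 k hk]; ring
      · intro m hm
        apply sum_eq_zero
        intro k _
        rw [hz m hm]; ring
    rw [sum_congr rfl h3] at h1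
    have h4 := mul_le_mul_of_nonneg_left (h1.trans (add_le_add_right h2 _)) hl0
    refine h4.trans ?_
    rw [mul_add]
    apply add_le_add
    · apply mul_le_mul_of_nonneg_right hlT (sum_nonneg fun _ _ => abs_nonneg _)
    · rw [mul_sum]
      apply le_of_eq
      apply sum_congr rfl; intros; ring
  refine (sum_le_sum main).trans ?_
  rw [sum_add_distrib, ← mul_sum, sum_comm, sum_comm (s := PQ) (t := Bd)]
  have A1 : ∀ j ∈ range J, ∑ q ∈ PQ, |∑ m ∈ (Ioc 0 Y).filter (fun m => jj θ m = j ∧ U < m ∧ χ m ≠ 0),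
        ∑ k ∈ (Ioc 0 Y).filter (fun k : ℕ => ((y:ℝ) < k * Real.exp (θ*j) ∧ k * Real.exp (θ*j) ≤ Y) ∧ U < k ∧ χ k ≠ 0), a m * b k * Kq χ q (m*k)| ≤ 3/T^9 := by
    intro j _
    set B := Real.exp (θ*j) with hB
    have hB0 : 0 < B := Real.exp_pos _
    by_cases hF : (Ioc 0 Y).filter (fun m => jj θ m = j ∧ U < m ∧ χ m ≠ 0) = ∅
    · rw [hF]; simp; positivity
    by_cases hG : (Ioc 0 Y).filter (fun k : ℕ => ((y:ℝ) < k * B ∧ k * B ≤ Y) ∧ U < k ∧ χ k ≠ 0) = ∅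
    · rw [hG]; simp; positivity
    obtain ⟨m0, hm0⟩ := nonempty_iff_ne_empty.2 hF
    obtain ⟨k0, hk0⟩ := nonempty_iff_ne_empty.2 hG
    have hFm : ∀ m ∈ (Ioc 0 Y).filter (fun m => jj θ m = j ∧ U < m ∧ χ m ≠ 0), B ≤ m ∧ m ≤ 2*B := by
      intro m hm
      rw [mem_filter, mem_Ioc] at hm
      have h1 := jj_le hθ (m := m) hm.1.1
      have h2 := jj_lt hθ (m := m) hm.1.1
      rw [hm.2.1, ← hB] at h1 h2
      refine ⟨h1, ?_⟩
      have : B * Real.exp θ ≤ B * 2 := by gcongr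
      linarith
    have hT31 : T^31 = T * T^30 := by ring
    have hT30 : 0 < T^30 := by positivity
    have hT2 : 2 * T^30 ≤ T * T^30 := by gcongr; linarith
    apply box_all h P PQ hP _ _ _ _ B _ _ hFm _ a b _ _
    · intro m hm; exact (mem_filter.1 hm).2.2.2
    · intro m hm; exact (mem_filter.1 hm).2.2.2
    · have h1 := (hFm m0 hm0).2
      have h2 : (U:ℝ) ≤ m0 := by exact_mod_cast (mem_filter.1 hm0).2.2.1.le
      linarith
    · obtain ⟨⟨h1, h2⟩, h3, h4⟩ := (mem_filter.1 hk0).2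
      have h5 : (U:ℝ) ≤ k0 := by exact_mod_cast h3.le
      have h6 : T^30 ≤ (k0:ℝ) := by linarith
      have := mul_le_mul_of_nonneg_left h6 hB0.le
      linarith
    · intro k hk
      obtain ⟨⟨h1, h2⟩, h3, h4⟩ := (mem_filter.1 hk).2
      rw [div_lt_iff₀ hB0, le_div_iff₀ hB0]
      exact ⟨h1, h2⟩
    · intro m hm; rw [mem_filter, mem_Ioc] at hm; exact ha m hm.1.1 hm.1.2
    · intro m hm; rw [mem_filter, mem_Ioc] at hm; exact hb m hm.1.1 hm.1.2
  have A2 : T * ∑ j ∈ range J, ∑ q ∈ PQ, |∑ m ∈ (Ioc 0 Y).filter (fun m => jj θ m = j ∧ U < m ∧ χ m ≠ 0),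
        ∑ k ∈ (Ioc 0 Y).filter (fun k : ℕ => ((y:ℝ) < k * Real.exp (θ*j) ∧ k * Real.exp (θ*j) ≤ Y) ∧ U < k ∧ χ k ≠ 0), a m * b k * Kq χ q (m*k)| ≤ 6/T := by
    calc _ ≤ T * ∑ j ∈ range J, 3/T^9 := mul_le_mul_of_nonneg_left (sum_le_sum A1) hT0.le
      _ = T * (J * (3/T^9)) := by rw [sum_const, card_range, nsmul_eq_mul]
      _ ≤ T * ((2*T^7) * (3/T^9)) := by
          gcongr
          rw [hJd]; push_cast
          have h1 : (⌊T^7⌋₊:ℝ) ≤ T^7 := Nat.floor_le (by positivity)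
          have h2 : 1 ≤ T^7 := one_le_pow₀ (by linarith)
          linarith
      _ = 6/T := by field_simp; norm_num
  have A3 : ∑ n ∈ Bd, ∑ q ∈ PQ, (#n.divisors:ℝ) * (T^2/n * (Real.log q * |Kq χ q n|)) ≤ 6/T := by
    calc _ ≤ ∑ n ∈ Bd, (3*T^5) * (1/(n:ℝ)) := by
          apply sum_le_sum
          intro n hn
          obtain ⟨h1, h2⟩ := hBd1 n hn
          rw [← mul_sum, ← mul_sum]
          have h3 := kq_sum h P PQ hPy n h1 h2
          have h4 := P.dv n h2
          calc _ ≤ T * (T^2/n * (3*T^2)) := by gcongr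
            _ = _ := by ring
      _ = (3*T^5) * ∑ n ∈ Bd, 1/(n:ℝ) := by rw [mul_sum]
      _ ≤ (3*T^5) * (θ + θ) := by
          gcongr
          rw [hBd]
          refine le_trans ?_ (add_le_add (bdry_sum θ hθ y hy1) (bdry_sum θ hθ Y hY1))
          rw [← sum_union_inter]
          have : 0 ≤ ∑ n ∈ Ioc y ⌊Real.exp θ * y⌋₊ ∩ Ioc Y ⌊Real.exp θ * Y⌋₊, 1/(n:ℝ) := sum_nonneg fun _ _ => by positivity
          linarith
      _ = 6/T := by rw [hθd]; field_simp; norm_num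
  have : 12/T = 6/T + 6/T := by ring
  linarith
end FI
end Part10

section Part11
open Matrix Finset
open scoped ArithmeticFunction.vonMangoldt
namespace FI

lemma clsum_typeI {D : ℕ} {χ : ℕ → ℤ} (h : SignChar D χ) (q : ℕ) [hq : Fact q.Prime] (hqD : ¬ q ∣ D) (ξ : ZMod q) (hξ : ξ ≠ 0)
    (f : ℕ → ℝ) (y Y : ℕ) (hf0 : ∀ n, y < n → 0 ≤ f n) (hf : ∀ a b, y < a → a ≤ b → f b ≤ f a) :
    |clsum (Ioc y Y) (sg χ) f q ξ - ∑ c ∈ unitsD D, (1/((q*D:ℕ):ℝ)) * ∑ n ∈ Ioc y Y, f n| ≤ D * f (y+1) := by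
  rw [clsum, sum_classes h _ _ ?_, ← sum_sub_distrib]
  · have hcop : q.Coprime D := (Nat.Prime.coprime_iff_not_dvd hq.out).2 hqD
    refine (abs_sum_le_sum_abs _ _).trans ?_
    calc _ ≤ ∑ c ∈ unitsD D, f (y+1) := by
          apply sum_le_sum
          intro c hc
          have hc0 : χ c ≠ 0 := (h.zero c).2 (mem_filter.1 hc).2
          obtain ⟨e, he⟩ := cong_class h hcop hq.out.pos c hc0 (ξ.val : ℤ)
          have e1 : ((Ioc y Y).filter (fun m => ((sg χ m : ℤ) : ZMod q) = ξ)).filter (fun n => n ≡ c [MOD D]) =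
              (Ioc y Y).filter (fun n => n ≡ e [MOD (q*D)]) := by
            rw [filter_filter]
            apply filter_congr
            intro n _
            rw [he n, ← ZMod.intCast_zmod_eq_zero_iff_dvd]
            push_cast
            rw [ZMod.natCast_zmod_val, sub_eq_zero, sg]
            push_cast
            rfl
          rw [e1]
          exact ap_sum f (q*D) e y Y (Nat.mul_pos hq.out.pos h.pos) hf0 hf
      _ = #(unitsD D) * f (y+1) := by rw [sum_const, nsmul_eq_mul]
      _ ≤ D * f (y+1) := by
          apply mul_le_mul_of_nonneg_right _ (hf0 _ (by omega))
          rw [card_unitsD]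
          exact_mod_cast Nat.totient_le D
  · intro n hn
    rw [mem_filter] at hn
    intro h0
    apply hξ
    rw [← hn.2, sg, h0]; simp

lemma typeI_q {D : ℕ} {χ : ℕ → ℤ} (h : SignChar D χ) (q : ℕ) [hq : Fact q.Prime] (hqD : ¬ q ∣ D) (ξ : ZMod q) (hξ : ξ ≠ 0)
    (f : ℕ → ℝ) (y Y : ℕ) (hf0 : ∀ n, y < n → 0 ≤ f n) (hf : ∀ a b, y < a → a ≤ b → f b ≤ f a) :
    |∑ k ∈ Ioc y Y, f k * ((if ((sg χ k : ℤ) : ZMod q) = ξ then 1 else 0) -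
      (if ((sg χ k : ℤ) : ZMod q) ≠ 0 then 1/((q:ℝ)-1) else 0))| ≤ 2 * D * f (y+1) := by
  have hq2 : (2:ℝ) ≤ q := by exact_mod_cast hq.out.two_le
  have hcard : ((#(univ.erase (0 : ZMod q)) : ℕ) : ℝ) = (q:ℝ) - 1 := by
    rw [card_erase_of_mem (mem_univ _), card_univ, ZMod.card, Nat.cast_sub hq.out.one_lt.le]; simp
  set A : ℝ := ∑ c ∈ unitsD D, (1/((q*D:ℕ):ℝ)) * ∑ n ∈ Ioc y Y, f n with hA
  have e : ∑ k ∈ Ioc y Y, f k * ((if ((sg χ k : ℤ) : ZMod q) = ξ then 1 else 0) -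
      (if ((sg χ k : ℤ) : ZMod q) ≠ 0 then 1/((q:ℝ)-1) else 0)) =
      clsum (Ioc y Y) (sg χ) f q ξ - (∑ η ∈ univ.erase (0 : ZMod q), clsum (Ioc y Y) (sg χ) f q η) / ((q:ℝ)-1) := by
    rw [clsum_units, clsum, sum_filter, sum_filter, sum_div, ← sum_sub_distrib]
    apply sum_congr rfl
    intro k _
    split_ifs <;> ring
  have e2 : clsum (Ioc y Y) (sg χ) f q ξ - (∑ η ∈ univ.erase (0 : ZMod q), clsum (Ioc y Y) (sg χ) f q η) / ((q:ℝ)-1) =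
      (clsum (Ioc y Y) (sg χ) f q ξ - A) - (∑ η ∈ univ.erase (0 : ZMod q), (clsum (Ioc y Y) (sg χ) f q η - A)) / ((q:ℝ)-1) := by
    rw [sum_sub_distrib, sum_const, nsmul_eq_mul, hcard]
    have : (q:ℝ) - 1 ≠ 0 := by linarith
    field_simp
    ring
  rw [e, e2]
  have h1 := clsum_typeI h q hqD ξ hξ f y Y hf0 hf
  rw [← hA] at h1
  have h2 : |(∑ η ∈ univ.erase (0 : ZMod q), (clsum (Ioc y Y) (sg χ) f q η - A)) / ((q:ℝ)-1)| ≤ D * f (y+1) := by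
    rw [abs_div, abs_of_pos (by linarith : (0:ℝ) < (q:ℝ)-1), div_le_iff₀ (by linarith)]
    refine (abs_sum_le_sum_abs _ _).trans ?_
    calc _ ≤ ∑ η ∈ univ.erase (0 : ZMod q), D * f (y+1) := by
          apply sum_le_sum
          intro η hη
          exact clsum_typeI h q hqD η (ne_of_mem_erase hη) f y Y hf0 hf
      _ = _ := by rw [sum_const, nsmul_eq_mul, hcard]; ring
  refine (abs_sub _ _).trans ?_
  linarith

/-- fixed outer variable -/
lemma typeI_b {D : ℕ} {χ : ℕ → ℤ} (h : SignChar D χ) (q : ℕ) [hq : Fact q.Prime] (hqD : ¬ q ∣ D) (b : ℕ)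
    (f : ℕ → ℝ) (y Y : ℕ) (hf0 : ∀ n, y < n → 0 ≤ f n) (hf : ∀ a b, y < a → a ≤ b → f b ≤ f a) :
    |∑ k ∈ Ioc y Y, f k * Kq χ q (b*k)| ≤ 2 * D * f (y+1) := by
  by_cases hb : ((sg χ b : ℤ) : ZMod q) = 0
  · have : ∀ k, Kq χ q (b*k) = 0 := by
      intro k
      rw [Kq, sg_mul h]; push_cast; rw [hb]; simp
    simp only [this, mul_zero, sum_const_zero, abs_zero]
    have := hf0 (y+1) (by omega)
    positivity
  · have := typeI_q h q hqD (((sg χ b : ℤ) : ZMod q))⁻¹ (inv_ne_zero hb) f y Y hf0 hf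
    refine le_trans (le_of_eq ?_) this
    congr 1
    apply sum_congr rfl
    intro k _
    congr 1
    rw [Kq, sg_mul h]; push_cast
    congr 1
    · apply if_congr _ rfl rfl
      constructor
      · intro h1; exact eq_inv_of_mul_eq_one_right h1
      · intro h1; rw [h1, mul_inv_cancel₀ hb]
    · apply if_congr _ rfl rfl
      simp [hb]

lemma conv_sum (g k : ℕ → ℝ) (F : ℕ → ℝ) (y Y : ℕ) :
    ∑ n ∈ Ioc y Y, (∑ p ∈ n.divisorsAntidiagonal, g p.1 * k p.2) * F n =
      ∑ m ∈ Ioc 0 Y, ∑ l ∈ Ioc 0 Y, (if y < m*l ∧ m*l ≤ Y then g m * k l * F (m*l) else 0) := by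
  rw [← sum_product', ← sum_filter]
  rw [← sum_fiberwise_of_maps_to (g := fun p : ℕ × ℕ => p.1 * p.2) (t := Ioc y Y)
    (fun p hp => mem_Ioc.2 (mem_filter.1 hp).2)]
  apply sum_congr rfl
  intro n hn
  rw [mem_Ioc] at hn
  rw [sum_mul]
  have e : n.divisorsAntidiagonal = ((Ioc 0 Y ×ˢ Ioc 0 Y).filter (fun p => y < p.1*p.2 ∧ p.1*p.2 ≤ Y)).filter (fun p => p.1 * p.2 = n) := by
    ext ⟨a, b⟩
    simp only [Nat.mem_divisorsAntidiagonal, mem_filter, mem_product, mem_Ioc]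
    constructor
    · rintro ⟨h1, h2⟩
      have ha : a ≠ 0 := by rintro rfl; simp at h1; omega
      have hb : b ≠ 0 := by rintro rfl; simp at h1; omega
      have h3 : a ≤ n := Nat.le_of_dvd (by omega) ⟨b, h1.symm⟩
      have h4 : b ≤ n := Nat.le_of_dvd (by omega) ⟨a, by rw [mul_comm]; exact h1.symm⟩
      refine ⟨⟨⟨⟨by omega, by omega⟩, by omega, by omega⟩, ?_⟩, h1⟩
      rw [h1]; exact hn
    · rintro ⟨⟨_, h2⟩, h3⟩
      exact ⟨h3, by omega⟩
  rw [← e]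
  apply sum_congr rfl
  intro p hp
  rw [(Nat.mem_divisorsAntidiagonal.1 hp).1]
end FI
end Part11

section Part12
open Matrix Finset
open scoped ArithmeticFunction.vonMangoldt ArithmeticFunction.Moebius ArithmeticFunction.zeta
namespace FI

lemma typeI_full {D y Y : ℕ} {T : ℝ} {χ : ℕ → ℤ} (h : SignChar D χ) (P : Par D y Y T) (q : ℕ) (hq : q.Prime) (hqD : ¬ q ∣ D)
    (W : ℕ) (hW : 3 * W ≤ y) (c : ℕ → ℝ) (hc : ∀ b, 0 < b → b ≤ Y → |c b| ≤ T) (hc0 : ∀ b, W < b → c b = 0)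
    (kf : ℕ → ℝ) (hk0 : ∀ n, 1 ≤ n → 0 ≤ kf n) (hk : ∀ a b, 3 ≤ a → a ≤ b → kf b / b ≤ kf a / a)
    (hkT : ∀ n, 1 ≤ n → n ≤ Y+1 → kf n ≤ T) :
    |∑ m ∈ Ioc 0 Y, ∑ l ∈ Ioc 0 Y, (if y < m*l ∧ m*l ≤ Y then c m * kf l * (Kq χ q (m*l) / ((m*l:ℕ):ℝ)) else 0)| ≤
      W * (2 * T^3 / y) := by
  have : Fact q.Prime := ⟨hq⟩
  have hT1 := P.T1
  have hT0 : 0 < T := by linarith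
  have hy1R : (1:ℝ) ≤ y := le_trans (one_le_pow₀ (by linarith)) P.big
  have inner : ∀ m ∈ Ioc 0 Y, |∑ l ∈ Ioc 0 Y, (if y < m*l ∧ m*l ≤ Y then c m * kf l * (Kq χ q (m*l) / ((m*l:ℕ):ℝ)) else 0)| ≤
      if m ≤ W then 2 * T^3 / y else 0 := by
    intro m hm
    rw [mem_Ioc] at hm
    by_cases hmW : m ≤ W
    · rw [if_pos hmW]
      have hm0 : 0 < m := hm.1
      have hmR : (0:ℝ) < m := by exact_mod_cast hm0
      rw [← sum_filter]
      have e : (Ioc 0 Y).filter (fun l => y < m*l ∧ m*l ≤ Y) = Ioc (y/m) (Y/m) := by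
        ext l
        simp only [mem_filter, mem_Ioc]
        rw [Nat.div_lt_iff_lt_mul hm0, Nat.le_div_iff_mul_le hm0, mul_comm l m]
        constructor
        · rintro ⟨_, h2⟩; exact h2
        · rintro ⟨h1, h2⟩
          refine ⟨⟨?_, ?_⟩, h1, h2⟩
          · by_contra h0; have : l = 0 := by omega
            subst this; simp at h1
          · exact le_trans (Nat.le_mul_of_pos_left l hm0) h2
      rw [e]
      have e2 : ∑ l ∈ Ioc (y/m) (Y/m), c m * kf l * (Kq χ q (m*l) / ((m*l:ℕ):ℝ)) =
          (c m / m) * ∑ l ∈ Ioc (y/m) (Y/m), (kf l / l) * Kq χ q (m*l) := by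
        rw [mul_sum]
        apply sum_congr rfl
        intro l hl
        push_cast
        field_simp
      rw [e2, abs_mul]
      have h3 : 3 ≤ y/m := by
        rw [Nat.le_div_iff_mul_le hm0]
        have : 3 * m ≤ 3 * W := by omega
        omega
      have h4 := typeI_b h q hqD m (fun l => kf l / l) (y/m) (Y/m)
        (fun n hn => div_nonneg (hk0 n (by omega)) (by positivity)) (fun a b ha hab => hk a b (by omega) hab)
      have h5 : kf (y/m+1) / ((y/m+1:ℕ):ℝ) ≤ T * (m/y) := by
        have h6 : (y:ℝ)/m < ((y/m+1:ℕ):ℝ) := by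
          rw [div_lt_iff₀ hmR]
          have : y < (y/m+1)*m := by
            rw [add_mul]; have := Nat.div_add_mod y m; have := Nat.mod_lt y hm0; rw [mul_comm m] at *; omega
          exact_mod_cast this
        have h7 : y/m+1 ≤ Y+1 := by have := Nat.div_le_self y m; have := P.yY; omega
        calc kf (y/m+1) / ((y/m+1:ℕ):ℝ) ≤ T / ((y:ℝ)/m) := by
              apply div_le_div₀ hT0.le (hkT _ (by omega) h7) (by positivity) h6.le
          _ = _ := by field_simp
      have h8 : |c m / m| ≤ T/m := by
        rw [abs_div, abs_of_pos hmR]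
        exact div_le_div_of_nonneg_right (hc m hm.1 hm.2) hmR.le
      have h9 : |∑ l ∈ Ioc (y/m) (Y/m), (kf l / l) * Kq χ q (m*l)| ≤ 2 * T * (T * (m/y)) := by
        refine h4.trans ?_
        have := P.DT
        have h10 : 0 ≤ kf (y/m+1) / ((y/m+1:ℕ):ℝ) := div_nonneg (hk0 _ (by omega)) (by positivity)
        calc _ ≤ 2 * T * (kf (y/m+1) / ((y/m+1:ℕ):ℝ)) := by gcongr
          _ ≤ _ := by gcongr
      calc _ ≤ T/m * (2 * T * (T * (m/y))) := by gcongr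
        _ = _ := by field_simp
    · rw [if_neg hmW, hc0 m (by omega)]
      simp
  refine (abs_sum_le_sum_abs _ _).trans ((sum_le_sum inner).trans ?_)
  rw [← sum_filter, sum_const, nsmul_eq_mul]
  apply mul_le_mul_of_nonneg_right _ (by positivity)
  have : (Ioc 0 Y).filter (fun m => m ≤ W) ⊆ Ioc 0 W := by
    intro m hm; rw [mem_filter, mem_Ioc] at hm; rw [mem_Ioc]; omega
  have := card_le_card this
  rw [Nat.card_Ioc] at this
  exact_mod_cast this

noncomputable def vLo (U : ℕ) : ArithmeticFunction ℝ := ⟨fun n => if n ≤ U then Λ n else 0, by simp⟩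
noncomputable def vHi (U : ℕ) : ArithmeticFunction ℝ := ⟨fun n => if n ≤ U then 0 else Λ n, by simp⟩
noncomputable def mLo (U : ℕ) : ArithmeticFunction ℝ := ⟨fun n => if n ≤ U then ((μ n : ℤ) : ℝ) else 0, by simp⟩
noncomputable def mHi (U : ℕ) : ArithmeticFunction ℝ := ⟨fun n => if n ≤ U then 0 else ((μ n : ℤ) : ℝ), by simp⟩

lemma vLo_apply (U n : ℕ) : vLo U n = if n ≤ U then Λ n else 0 := rfl
lemma vHi_apply (U n : ℕ) : vHi U n = if n ≤ U then 0 else Λ n := rfl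
lemma mLo_apply (U n : ℕ) : mLo U n = if n ≤ U then ((μ n : ℤ) : ℝ) else 0 := rfl
lemma mHi_apply (U n : ℕ) : mHi U n = if n ≤ U then 0 else ((μ n : ℤ) : ℝ) := rfl

lemma vaughan (U : ℕ) : (Λ : ArithmeticFunction ℝ) =
    vLo U + mLo U * ArithmeticFunction.log - (vLo U * mLo U) * (ζ : ArithmeticFunction ℝ) + vHi U * (mHi U * (ζ : ArithmeticFunction ℝ)) := by
  have h1 : (Λ : ArithmeticFunction ℝ) = vLo U + vHi U := by
    ext n; rw [ArithmeticFunction.add_apply, vLo_apply, vHi_apply]; split_ifs <;> simp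
  have h2 : ((μ : ArithmeticFunction ℤ) : ArithmeticFunction ℝ) = mLo U + mHi U := by
    ext n; rw [ArithmeticFunction.add_apply, mLo_apply, mHi_apply, ArithmeticFunction.intCoe_apply]; split_ifs <;> simp
  have h3 : ((μ : ArithmeticFunction ℤ) : ArithmeticFunction ℝ) * (ζ : ArithmeticFunction ℝ) = 1 := ArithmeticFunction.coe_moebius_mul_coe_zeta
  have h4 : (Λ : ArithmeticFunction ℝ) * (ζ : ArithmeticFunction ℝ) = ArithmeticFunction.log := ArithmeticFunction.vonMangoldt_mul_zeta
  rw [← h4]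
  rw [h2] at h3
  rw [h1]
  linear_combination (- vHi U) * h3

lemma abs_mLo_le (U n : ℕ) : |mLo U n| ≤ 1 := by
  rw [mLo_apply]; split_ifs
  · rw [← Int.cast_abs]; exact_mod_cast ArithmeticFunction.abs_moebius_le_one
  · simp

lemma abs_mHi_le (U n : ℕ) : |mHi U n| ≤ 1 := by
  rw [mHi_apply]; split_ifs
  · simp
  · rw [← Int.cast_abs]; exact_mod_cast ArithmeticFunction.abs_moebius_le_one

lemma abs_vLo_mLo (U n : ℕ) (hn : 1 ≤ n) : |(vLo U * mLo U) n| ≤ Real.log n := by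
  rw [ArithmeticFunction.mul_apply, ← ArithmeticFunction.vonMangoldt_sum (n := n)]
  refine (abs_sum_le_sum_abs _ _).trans ?_
  rw [← Nat.map_div_right_divisors, sum_map]
  apply sum_le_sum
  intro d hd
  change |vLo U d * mLo U (n/d)| ≤ Λ d
  rw [abs_mul]
  have h1 := abs_mLo_le U (n/d)
  have h2 : |vLo U d| ≤ Λ d := by
    rw [vLo_apply]; split_ifs
    · rw [abs_of_nonneg ArithmeticFunction.vonMangoldt_nonneg]
    · simp [ArithmeticFunction.vonMangoldt_nonneg]
  calc |vLo U d| * |mLo U (n/d)| ≤ Λ d * 1 := by gcongr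
    _ = Λ d := mul_one _

lemma vLo_mLo_zero (U n : ℕ) (hn : U*U < n) : (vLo U * mLo U) n = 0 := by
  rw [ArithmeticFunction.mul_apply]
  apply sum_eq_zero
  intro p hp
  obtain ⟨h1, h2⟩ := Nat.mem_divisorsAntidiagonal.1 hp
  rw [vLo_apply, mLo_apply]
  by_cases h3 : p.1 ≤ U
  · by_cases h4 : p.2 ≤ U
    · have := Nat.mul_le_mul h3 h4; omega
    · rw [if_neg h4, mul_zero]
  · rw [if_neg h3, zero_mul]

lemma abs_mHi_zeta (U n : ℕ) : |(mHi U * (ζ : ArithmeticFunction ℝ)) n| ≤ #n.divisors := by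
  rw [ArithmeticFunction.coe_mul_zeta_apply] 
  refine (abs_sum_le_sum_abs _ _).trans ?_
  refine (sum_le_sum fun i _ => abs_mHi_le U i).trans ?_
  simp

lemma mHi_zeta_zero (U n : ℕ) (hn : n ≤ U) : (mHi U * (ζ : ArithmeticFunction ℝ)) n = 0 := by
  rw [ArithmeticFunction.coe_mul_zeta_apply]
  apply sum_eq_zero
  intro d hd
  rw [mHi_apply, if_pos]
  exact (Nat.divisor_le hd).trans hn
end FI
end Part12

section Part13
open Matrix Finset
open scoped ArithmeticFunction.vonMangoldt ArithmeticFunction.Moebius ArithmeticFunction.zeta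
namespace FI

lemma Kq_zero {D : ℕ} {χ : ℕ → ℤ} (h : SignChar D χ) (q : ℕ) [hq : Fact q.Prime] (m k : ℕ) (hm : χ m = 0) : Kq χ q (m*k) = 0 := by
  rw [Kq, sg_mul h, sg, hm]; simp

lemma log_div_anti (a b : ℕ) (ha : 3 ≤ a) (hab : a ≤ b) : Real.log b / b ≤ Real.log a / a := by
  have h3 : (3:ℝ) ≤ a := by exact_mod_cast ha
  have h4 : (a:ℝ) ≤ b := by exact_mod_cast hab
  have := Real.exp_one_lt_d9
  exact Real.log_div_self_antitoneOn (show Real.exp 1 ≤ (a:ℝ) by linarith) (show Real.exp 1 ≤ (b:ℝ) by linarith) h4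

lemma bv_split {D y Y : ℕ} {T : ℝ} {χ : ℕ → ℤ} (h : SignChar D χ) (P : Par D y Y T) (q : ℕ) (hq : q.Prime) (hqD : ¬ q ∣ D)
    (U : ℕ) (hU : 3*(U*U) ≤ y) (hU1 : 1 ≤ U) (a b : ℕ → ℝ)
    (ha : ∀ m, a m = if χ m = 0 then 0 else vHi U m / m)
    (hb : ∀ m, b m = if χ m = 0 then 0 else (mHi U * (ζ : ArithmeticFunction ℝ)) m / m) :
    |∑ n ∈ Ioc y Y, Λ n * (Kq χ q n / n)| ≤ 2 * ((U*U:ℕ) * (2 * T^3 / y)) +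
      |∑ m ∈ Ioc 0 Y, ∑ k ∈ Ioc 0 Y, (if y < m*k ∧ m*k ≤ Y then a m * b k * Kq χ q (m*k) else 0)| := by
  have : Fact q.Prime := ⟨hq⟩
  have hT1 := P.T1
  have hT0 : 0 < T := by linarith
  have hlg : ∀ r : ℕ, 1 ≤ r → r ≤ 4*Y+4 → Real.log r ≤ T := by
    intro r h1 h2
    have h3 : (r:ℝ) ≤ 4*Y+4 := by exact_mod_cast h2
    have : Real.log r ≤ Real.log (4*Y+4) := Real.log_le_log (by exact_mod_cast h1) h3
    linarith [P.lg]
  have hUU : U ≤ U*U := Nat.le_mul_self U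
  have e : ∑ n ∈ Ioc y Y, Λ n * (Kq χ q n / n) =
      ∑ n ∈ Ioc y Y, (∑ p ∈ n.divisorsAntidiagonal, mLo U p.1 * (fun k : ℕ => Real.log k) p.2) * (Kq χ q n / n) -
      ∑ n ∈ Ioc y Y, (∑ p ∈ n.divisorsAntidiagonal, (vLo U * mLo U) p.1 * (fun _ => (1:ℝ)) p.2) * (Kq χ q n / n) +
      ∑ n ∈ Ioc y Y, (∑ p ∈ n.divisorsAntidiagonal, vHi U p.1 * (mHi U * (ζ : ArithmeticFunction ℝ)) p.2) * (Kq χ q n / n) := by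
    rw [← sum_sub_distrib, ← sum_add_distrib]
    apply sum_congr rfl
    intro n hn
    rw [mem_Ioc] at hn
    rw [← sub_mul, ← add_mul]
    congr 1
    have h1 := congrArg (fun f : ArithmeticFunction ℝ => f n) (vaughan U)
    have hsub : ∀ (f g : ArithmeticFunction ℝ), (f - g) n = f n - g n := fun f g => by
      rw [eq_sub_iff_add_eq, ← ArithmeticFunction.add_apply, sub_add_cancel]
    simp only [ArithmeticFunction.add_apply, hsub] at h1
    rw [h1, vLo_apply, if_neg (by omega), zero_add]
    congr 1
    congr 1
    rw [ArithmeticFunction.mul_apply]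
    apply sum_congr rfl
    intro p hp
    congr 1
    have hp2 : p.2 ≠ 0 := by
      obtain ⟨u, v⟩ := Nat.mem_divisorsAntidiagonal.1 hp
      intro h0; rw [h0] at u; simp at u; omega
    rw [ArithmeticFunction.natCoe_apply, ArithmeticFunction.zeta_apply, if_neg hp2]; simp
  rw [e]
  have s1 : |∑ n ∈ Ioc y Y, (∑ p ∈ n.divisorsAntidiagonal, mLo U p.1 * (fun k : ℕ => Real.log k) p.2) * (Kq χ q n / n)| ≤ (U*U:ℕ) * (2 * T^3 / y) := by
    rw [conv_sum (fun m => mLo U m) (fun k : ℕ => Real.log k) (fun n => Kq χ q n / n)]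
    apply typeI_full h P q hq hqD (U*U) hU (fun m => mLo U m) _ _ (fun k : ℕ => Real.log k)
    · intro n hn; exact Real.log_nonneg (by exact_mod_cast hn)
    · exact log_div_anti
    · intro n h1 h2; exact hlg n h1 (by omega)
    · intro b _ _; have := abs_mLo_le U b; linarith
    · intro b hb; rw [mLo_apply, if_neg (by omega)]
  have s2 : |∑ n ∈ Ioc y Y, (∑ p ∈ n.divisorsAntidiagonal, (vLo U * mLo U) p.1 * (fun _ => (1:ℝ)) p.2) * (Kq χ q n / n)| ≤ (U*U:ℕ) * (2 * T^3 / y) := by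
    rw [conv_sum (fun m => (vLo U * mLo U) m) (fun _ : ℕ => (1:ℝ)) (fun n => Kq χ q n / n)]
    apply typeI_full h P q hq hqD (U*U) hU (fun m => (vLo U * mLo U) m) _ _ (fun k : ℕ => (1:ℝ))
    · intro n hn; exact zero_le_one
    · intro a b h1 h2
      have : (0:ℝ) < a := by exact_mod_cast (by omega : 0 < a)
      apply one_div_le_one_div_of_le this; exact_mod_cast h2
    · intro n h1 h2; linarith
    · intro b h1 h2; exact (abs_vLo_mLo U b h1).trans (hlg b h1 (by omega))
    · intro b hb; exact vLo_mLo_zero U b hb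
  have s3 : ∑ n ∈ Ioc y Y, (∑ p ∈ n.divisorsAntidiagonal, vHi U p.1 * (mHi U * (ζ : ArithmeticFunction ℝ)) p.2) * (Kq χ q n / n) =
      ∑ m ∈ Ioc 0 Y, ∑ k ∈ Ioc 0 Y, (if y < m*k ∧ m*k ≤ Y then a m * b k * Kq χ q (m*k) else 0) := by
    rw [conv_sum (fun m => vHi U m) (fun k => (mHi U * (ζ : ArithmeticFunction ℝ)) k) (fun n => Kq χ q n / n)]
    apply sum_congr rfl; intro m _
    apply sum_congr rfl; intro k _
    apply ite_congr rfl _ (fun _ => rfl)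
    intro _
    rw [ha, hb]
    by_cases h1 : χ m = 0
    · rw [Kq_zero h q m k h1]; simp
    · by_cases h2 : χ k = 0
      · rw [mul_comm m k, Kq_zero h q k m h2]; simp
      · rw [if_neg h1, if_neg h2]; push_cast; ring
  rw [s3]
  refine (abs_add_le _ _).trans ?_
  apply add_le_add _ le_rfl
  refine (abs_sub _ _).trans ?_
  linarith

theorem bv {D y Y : ℕ} {T : ℝ} {χ : ℕ → ℤ} (h : SignChar D χ) (P : Par D y Y T) (PQ : Finset ℕ)
    (hP : ∀ q ∈ PQ, q.Prime ∧ ¬ q ∣ D ∧ T^16 ≤ q ∧ (q:ℝ)^2 * T^32 ≤ y) :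
    ∑ q ∈ PQ, Real.log q * |∑ n ∈ Ioc y Y, Λ n * (Kq χ q n / n)| ≤ 1 := by
  have hT1 := P.T1
  have hT0 : 0 < T := by linarith
  have hT1' : 1 ≤ T := by linarith
  have hlg : ∀ r : ℕ, 1 ≤ r → r ≤ 4*Y+4 → Real.log r ≤ T := by
    intro r h1 h2
    have h3 : (r:ℝ) ≤ 4*Y+4 := by exact_mod_cast h2
    have : Real.log r ≤ Real.log (4*Y+4) := Real.log_le_log (by exact_mod_cast h1) h3
    linarith [P.lg]
  set U := ⌈T^31⌉₊ with hUd
  have hU1 : T^31 ≤ U := Nat.le_ceil _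
  have hT31 : 1 ≤ T^31 := one_le_pow₀ hT1'
  have hU2 : (U:ℝ) ≤ T^32 := by
    have h1 : (U:ℝ) < T^31 + 1 := Nat.ceil_lt_add_one (by positivity)
    have h2 : 2 * T^31 ≤ T * T^31 := by gcongr; linarith
    have h3 : T * T^31 = T^32 := by ring
    linarith
  have hU3 : (1:ℝ) ≤ U := hT31.trans hU1
  have hUU : ((U*U:ℕ):ℝ) ≤ T^64 := by
    push_cast
    calc (U:ℝ)*U ≤ T^32*T^32 := by gcongr
      _ = T^64 := by ring
  have hU4 : 3*(U*U) ≤ y := by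
    have : (3:ℝ) * ((U*U:ℕ):ℝ) ≤ y := by
      calc (3:ℝ) * ((U*U:ℕ):ℝ) ≤ T * T^64 := by gcongr; linarith
        _ = T^65 := by ring
        _ ≤ T^400 := pow_le_pow_right₀ hT1' (by norm_num)
        _ ≤ y := P.big
    exact_mod_cast this
  obtain ⟨a, ha⟩ : ∃ a : ℕ → ℝ, ∀ m, a m = if χ m = 0 then 0 else vHi U m / m := ⟨_, fun _ => rfl⟩
  obtain ⟨b, hb⟩ : ∃ b : ℕ → ℝ, ∀ m, b m = if χ m = 0 then 0 else (mHi U * (ζ : ArithmeticFunction ℝ)) m / m := ⟨_, fun _ => rfl⟩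
  have hII := typeII h P PQ (fun q hq => ⟨(hP q hq).1, (hP q hq).2.2⟩) U hU1 a b
    (by
      intro m h1 h2
      rw [ha]
      split_ifs
      · rw [abs_zero]; positivity
      · rw [abs_div, Nat.abs_cast]
        apply div_le_div_of_nonneg_right _ (by positivity)
        rw [vHi_apply]
        split_ifs
        · rw [abs_zero]; exact hT0.le
        · rw [abs_of_nonneg ArithmeticFunction.vonMangoldt_nonneg]
          exact ArithmeticFunction.vonMangoldt_le_log.trans (hlg m h1 (by omega)))
    (by
      intro m h1 h2
      rw [hb]
      split_ifs
      · rw [abs_zero]; positivity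
      · rw [abs_div, Nat.abs_cast]
        apply div_le_div_of_nonneg_right _ (by positivity)
        exact (abs_mHi_zeta U m).trans (P.dv m (by omega)))
    (by intro m hm; rw [ha, vHi_apply, if_pos hm]; simp)
    (by intro m hm; rw [hb, mHi_zeta_zero U m hm]; simp)
    (by intro m hm; rw [ha, if_pos hm]) (by intro m hm; rw [hb, if_pos hm])
  have hy0 : (0:ℝ) < y := lt_of_lt_of_le (by positivity) P.big
  have hsq : T^200 ≤ √(y:ℝ) := by
    apply Real.le_sqrt_of_sq_le
    have e1 : (T^200)^2 = T^400 := by ring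
    rw [e1]; exact P.big
  have hs0 : 0 < √(y:ℝ) := Real.sqrt_pos.2 hy0
  have hqs : ∀ q ∈ PQ, (q:ℝ) ≤ √(y:ℝ) := by
    intro q hq
    apply Real.le_sqrt_of_sq_le
    have h4 : (q:ℝ)^2*1 ≤ (q:ℝ)^2 * T^32 := by gcongr; exact one_le_pow₀ hT1'
    linarith [(hP q hq).2.2.2]
  have hcard : (#PQ:ℝ) ≤ √(y:ℝ) := by
    have : PQ ⊆ Ioc 0 ⌊√(y:ℝ)⌋₊ := by
      intro q hq
      rw [mem_Ioc]
      exact ⟨(hP q hq).1.pos, Nat.le_floor (hqs q hq)⟩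
    have := card_le_card this
    rw [Nat.card_Ioc] at this
    have h3 : (#PQ:ℝ) ≤ (⌊√(y:ℝ)⌋₊:ℝ) := by exact_mod_cast this
    exact h3.trans (Nat.floor_le hs0.le)
  have hyss : √(y:ℝ) * √(y:ℝ) = y := Real.mul_self_sqrt hy0.le
  have hsy : √(y:ℝ) ≤ y := by
    have h1 : 1 ≤ √(y:ℝ) := (one_le_pow₀ hT1').trans hsq
    have := mul_le_mul_of_nonneg_left h1 hs0.le
    linarith
  have hqb : ∀ q ∈ PQ, 0 ≤ Real.log q ∧ Real.log q ≤ T := by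
    intro q hq
    have h1 := (hP q hq).1.one_lt.le
    refine ⟨Real.log_nonneg (by exact_mod_cast h1), hlg q h1 ?_⟩
    have h2 := (hqs q hq).trans hsy
    have h3 : q ≤ y := by exact_mod_cast h2
    have := P.yY; omega
  have hI : ∑ q ∈ PQ, Real.log q * (2 * ((U*U:ℕ) * (2 * T^3 / y))) ≤ 4/T := by
    calc _ ≤ ∑ q ∈ PQ, T * (2 * (T^64 * (2*T^3/y))) := by
          apply sum_le_sum
          intro q hq
          have := hqb q hq
          gcongr
          exact this.2
      _ = #PQ * (T * (2 * (T^64 * (2*T^3/y)))) := by rw [sum_const, nsmul_eq_mul]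
      _ ≤ √(y:ℝ) * (T * (2 * (T^64 * (2*T^3/y)))) := by gcongr
      _ = √(y:ℝ) * (T * (2 * (T^64 * (2*T^3/(√(y:ℝ) * √(y:ℝ)))))) := by rw [hyss]
      _ = 4 * T^68 / √(y:ℝ) := by field_simp; ring
      _ ≤ 4 * T^68 / T^200 := by gcongr
      _ = 4 / T^132 := by field_simp
      _ ≤ 4 / T := by gcongr; exact le_self_pow₀ hT1' (by norm_num)
  calc _ ≤ ∑ q ∈ PQ, (Real.log q * (2 * ((U*U:ℕ) * (2 * T^3 / y))) +
      Real.log q * |∑ m ∈ Ioc 0 Y, ∑ k ∈ Ioc 0 Y, (if y < m*k ∧ m*k ≤ Y then a m * b k * Kq χ q (m*k) else 0)|) := by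
        apply sum_le_sum
        intro q hq
        rw [← mul_add]
        apply mul_le_mul_of_nonneg_left _ (hqb q hq).1
        exact bv_split h P q (hP q hq).1 (hP q hq).2.1 U hU4 (by exact_mod_cast hU3) a b ha hb
    _ ≤ 4/T + 12/T := by rw [sum_add_distrib]; exact add_le_add hI hII
    _ ≤ 1 := by rw [← add_div, div_le_one hT0]; linarith
end FI
end Part13

section Part14
open Matrix Finset
open scoped ArithmeticFunction.vonMangoldt ArithmeticFunction.Moebius ArithmeticFunction.zeta
namespace FI

lemma sum_log_qm1 : ∃ C : ℝ, 0 < C ∧ ∀ a b : ℝ, 1 ≤ a → a ≤ b → ∀ F : Finset ℕ,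
    (∀ q ∈ F, q.Prime ∧ a ≤ q ∧ (q:ℝ) ≤ b) →
    ∑ q ∈ F, Real.log q / ((q:ℝ)-1) ≤ Real.log b - Real.log a + C := by
  obtain ⟨C, hC0, hC⟩ := mertens_primes
  set S := ∑' n : ℕ, Real.log n / (n:ℝ)^2 with hS
  have hS0 : 0 ≤ S := tsum_nonneg (fun n => div_nonneg (Real.log_natCast_nonneg n) (by positivity))
  refine ⟨C + 2 + 2*S, by linarith, ?_⟩
  intro a b ha hab F hF
  have h1 : ∑ q ∈ F, Real.log q / ((q:ℝ)-1) ≤ ∑ q ∈ F, Real.log q / q + 2 * ∑ q ∈ F, Real.log q / (q:ℝ)^2 := by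
    rw [mul_sum, ← sum_add_distrib]
    apply sum_le_sum
    intro q hq
    have h2 : (2:ℝ) ≤ q := by exact_mod_cast (hF q hq).1.two_le
    have hl : 0 ≤ Real.log q := Real.log_natCast_nonneg q
    have e : 1/((q:ℝ)-1) ≤ 1/q + 2*(1/(q:ℝ)^2) := by
      have : 1/(q:ℝ) + 2*(1/(q:ℝ)^2) = (q+2)/(q:ℝ)^2 := by field_simp
      rw [this, div_le_div_iff₀ (by linarith) (by positivity)]
      nlinarith
    calc Real.log q / ((q:ℝ)-1) = Real.log q * (1/((q:ℝ)-1)) := by ring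
      _ ≤ Real.log q * (1/q + 2*(1/(q:ℝ)^2)) := by gcongr
      _ = _ := by ring
  have h2 : ∑ q ∈ F, Real.log q / (q:ℝ)^2 ≤ S :=
    summable_log_div_sq.sum_le_tsum _ (fun n _ => div_nonneg (Real.log_natCast_nonneg n) (by positivity))
  have ha1 : 1 ≤ ⌊a⌋₊ := Nat.le_floor (by simpa using ha)
  have hab' : ⌊a⌋₊ ≤ ⌊b⌋₊ := Nat.floor_le_floor hab
  have h3 : ∑ q ∈ F, Real.log q / q ≤ ∑ q ∈ insert ⌊a⌋₊ ((Ioc ⌊a⌋₊ ⌊b⌋₊).filter Nat.Prime), Real.log q / q := by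
    apply sum_le_sum_of_subset_of_nonneg
    · intro q hq
      obtain ⟨u, v, w⟩ := hF q hq
      have h5 : ⌊a⌋₊ ≤ q := by
        have := Nat.floor_le_floor v
        rwa [Nat.floor_natCast] at this
      have h6 : q ≤ ⌊b⌋₊ := Nat.le_floor w
      rw [mem_insert, mem_filter, mem_Ioc]
      by_cases hh : q = ⌊a⌋₊
      · exact Or.inl hh
      · exact Or.inr ⟨⟨by omega, h6⟩, u⟩
    · intro q _ _; exact div_nonneg (Real.log_natCast_nonneg q) (by positivity)
  rw [sum_insert (by simp)] at h3
  have h4 := (abs_le.1 (hC ⌊a⌋₊ ⌊b⌋₊ ha1 hab')).2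
  have hf0 : (0:ℝ) < ⌊a⌋₊ := by exact_mod_cast ha1
  have h5 : Real.log (⌊a⌋₊:ℝ) / ⌊a⌋₊ ≤ 1 := by
    rw [div_le_one hf0]
    have := Real.log_le_sub_one_of_pos hf0; linarith
  have h6 : Real.log ⌊b⌋₊ ≤ Real.log b := by
    apply Real.log_le_log
    · exact_mod_cast (by omega : 0 < ⌊b⌋₊)
    · exact Nat.floor_le (by linarith)
  have h7 : Real.log a ≤ Real.log ⌊a⌋₊ + 1 := by
    have h8 : a ≤ 2 * ⌊a⌋₊ := by
      have := Nat.lt_floor_add_one a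
      have : (1:ℝ) ≤ ⌊a⌋₊ := by exact_mod_cast ha1
      linarith
    have := Real.log_le_log (by linarith) h8
    rw [Real.log_mul (by norm_num) hf0.ne'] at this
    have := Real.log_two_lt_d9
    linarith
  linarith

lemma bv_ev {D : ℕ} {χ : ℕ → ℤ} (h : SignChar D χ) (κ : ℝ) (hκ : 0 < κ) (hκ1 : κ ≤ 1/40) :
    ∀ᶠ y : ℕ in Filter.atTop, ∀ Y : ℕ, y ≤ Y → (Y:ℝ) ≤ (y:ℝ)^(1+κ/4) → ∀ PQ : Finset ℕ,
    (∀ q ∈ PQ, q.Prime ∧ ¬ q ∣ D ∧ (y:ℝ)^κ ≤ q ∧ (q:ℝ) ≤ (y:ℝ)^(1/2-κ)) →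
    ∑ q ∈ PQ, Real.log q * |∑ n ∈ Ioc y Y, Λ n * (Kq χ q n / n)| ≤ 1 := by
  obtain ⟨C, hC1, hC⟩ := divisor_bound (κ/96) (by positivity)
  filter_upwards [ev_small 10000 (κ/16) (by positivity) 0, ev_small 10 (κ/16) (by positivity) 1,
    ev_small C (κ/32) (by positivity) 0, ev_small D (κ/16) (by positivity) 0, ev_log 1,
    Filter.eventually_ge_atTop 8] with y e1 e2 e3 e4 e5 e6 Y hyY hYy PQ hPQ
  rw [pow_zero, mul_one] at e1 e3 e4
  rw [pow_one] at e2
  have hy8 : (8:ℝ) ≤ y := by exact_mod_cast e6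
  have hy0 : (0:ℝ) < y := by linarith
  have hy1 : (1:ℝ) ≤ y := by linarith
  have hpow : ∀ n : ℕ, ((y:ℝ)^(κ/16))^n = (y:ℝ)^(κ/16*n) := fun n => by
    rw [Real.rpow_mul hy0.le, Real.rpow_natCast]
  have hYy2 : (4*Y:ℝ) ≤ (y:ℝ)^(3:ℝ) := by
    calc (4*Y:ℝ) ≤ y * (y:ℝ)^(1+κ/4) := by gcongr; linarith
      _ = (y:ℝ)^(1+(1+κ/4)) := by rw [Real.rpow_add hy0 1 (1+κ/4), Real.rpow_one]
      _ ≤ (y:ℝ)^(3:ℝ) := by apply Real.rpow_le_rpow_of_exponent_le hy1; linarith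
  have hY8 : (8:ℝ) ≤ Y := hy8.trans (by exact_mod_cast hyY)
  apply bv h (T := (y:ℝ)^(κ/16)) (D := D)
  · refine ⟨e1, hyY, ?_, ?_, ?_, ?_, e4⟩
    · rw [hpow]
      refine hYy.trans_eq ?_
      rw [Real.rpow_add hy0, Real.rpow_one]; congr 2; push_cast; ring
    · have h1 : (4*Y+4:ℝ) ≤ (y:ℝ)^(4:ℝ) := by
        have : (y:ℝ)^(4:ℝ) = y * (y:ℝ)^(3:ℝ) := by
          rw [← Real.rpow_one_add' hy0.le (by norm_num)]; norm_num
        rw [this]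
        have h2 : 8 * (4*Y:ℝ) ≤ y * (y:ℝ)^(3:ℝ) := by gcongr
        linarith
      have h2 := Real.log_le_log (by positivity) h1
      rw [Real.log_rpow hy0] at h2
      linarith
    · intro n hn
      refine (hC n).trans ?_
      have h1 : (n:ℝ) ≤ (y:ℝ)^(3:ℝ) := le_trans (by exact_mod_cast hn) hYy2
      calc C * (n:ℝ)^(κ/96) ≤ (y:ℝ)^(κ/32) * ((y:ℝ)^(3:ℝ))^(κ/96) := by gcongr
        _ = (y:ℝ)^(κ/16) := by
          rw [← Real.rpow_mul hy0.le, ← Real.rpow_add hy0]; congr 1; ring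
    · rw [hpow]
      conv_rhs => rw [← Real.rpow_one (y:ℝ)]
      apply Real.rpow_le_rpow_of_exponent_le hy1; push_cast; linarith
  · intro q hq
    obtain ⟨h1, h2, h3, h4⟩ := hPQ q hq
    refine ⟨h1, h2, ?_, ?_⟩
    · rw [hpow]; refine le_trans (le_of_eq ?_) h3; congr 1; push_cast; ring
    · rw [hpow]
      calc (q:ℝ)^2 * (y:ℝ)^(κ/16*(32:ℕ)) ≤ ((y:ℝ)^(1/2-κ))^2 * (y:ℝ)^(κ/16*(32:ℕ)) := by gcongr
        _ = (y:ℝ)^(1:ℝ) := by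
          rw [← Real.rpow_natCast, ← Real.rpow_mul hy0.le, ← Real.rpow_add hy0]; congr 1; push_cast; ring
        _ = y := Real.rpow_one _

def mm (χ : ℕ → ℤ) (p : ℕ) : ℕ := (sg χ p - 1).natAbs

/-- weighted count of primes with d dividing p - χ(p) -/
noncomputable def Wd (χ : ℕ → ℤ) (y Y d : ℕ) : ℝ :=
  ∑ p ∈ (Ioc y Y).filter (fun p => p.Prime ∧ d ∣ mm χ p), Real.log p / p

lemma cong_iff_mm (χ : ℕ → ℤ) (d p : ℕ) : cong χ d p ↔ d ∣ mm χ p := by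
  unfold cong mm sg; rw [← Int.natCast_dvd]

lemma Wd_nonneg (χ : ℕ → ℤ) (y Y d : ℕ) : 0 ≤ Wd χ y Y d :=
  sum_nonneg (fun p _ => div_nonneg (Real.log_natCast_nonneg p) (by positivity))

lemma Wd_le_K {χ : ℕ → ℤ} (y Y q : ℕ) (hq : q.Prime) :
    Wd χ y Y q ≤ |∑ n ∈ Ioc y Y, Λ n * (Kq χ q n / n)| + 1/((q:ℝ)-1) * ∑ n ∈ Ioc y Y, Λ n / n := by
  have hq2 : (2:ℝ) ≤ q := by exact_mod_cast hq.two_le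
  have hq1 : 0 ≤ 1/((q:ℝ)-1) := div_nonneg zero_le_one (by linarith)
  have h1 : Wd χ y Y q ≤ ∑ n ∈ Ioc y Y, (Λ n * (Kq χ q n / n) + 1/((q:ℝ)-1) * (Λ n / n)) := by
    rw [Wd, sum_filter]
    apply sum_le_sum
    intro n hn
    have hL : 0 ≤ Λ n / n := div_nonneg ArithmeticFunction.vonMangoldt_nonneg (by positivity)
    have e : Λ n * (Kq χ q n / n) + 1/((q:ℝ)-1) * (Λ n / n) = Λ n / n * (Kq χ q n + 1/((q:ℝ)-1)) := by ring
    rw [e, Kq]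
    have h2 : (0:ℝ) ≤ 1/((q:ℝ)-1) - (if ((sg χ n : ℤ) : ZMod q) ≠ 0 then 1/((q:ℝ)-1) else 0) := by
      split_ifs
      · linarith
      · linarith
    by_cases h3 : n.Prime ∧ q ∣ mm χ n
    · rw [if_pos h3, if_pos ((sg_eq_one_iff χ q n).2 h3.2)]
      rw [← ArithmeticFunction.vonMangoldt_apply_prime h3.1]
      have := mul_nonneg hL h2
      linarith
    · rw [if_neg h3]
      apply mul_nonneg hL
      have : (0:ℝ) ≤ (if ((sg χ n : ℤ) : ZMod q) = 1 then 1 else 0) := by split_ifs <;> norm_num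
      linarith
  rw [sum_add_distrib, ← mul_sum] at h1
  exact h1.trans (add_le_add (le_abs_self _) le_rfl)
end FI
end Part14

section Part15
open Matrix Finset
open scoped ArithmeticFunction.vonMangoldt ArithmeticFunction.Moebius ArithmeticFunction.zeta
namespace FI

/-- window condition: log Y is about (1+ε) log y -/
def Win (ε : ℝ) (y Y : ℕ) : Prop := y ≤ Y ∧ |Real.log Y - (1+ε) * Real.log y| ≤ 1

lemma pieceC {D : ℕ} {χ : ℕ → ℤ} (h : SignChar D χ) (ε : ℝ) (hε : 0 < ε) (hε1 : ε ≤ 1/400) :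
    ∃ C : ℝ, 0 ≤ C ∧ ∀ᶠ y : ℕ in Filter.atTop, ∀ Y : ℕ, Win ε y Y → ∀ F : Finset ℕ,
    (∀ q ∈ F, q.Prime ∧ ¬ q ∣ D ∧ (y:ℝ)^(8*ε) ≤ q ∧ (q:ℝ) ≤ (y:ℝ)^(1/2-8*ε)) →
    ∑ q ∈ F, Real.log q * Wd χ y Y q ≤ ε/2 * (Real.log y)^2 + C * Real.log y := by
  obtain ⟨C, hC0, hC⟩ := sum_log_qm1
  refine ⟨5 + 9*C, by linarith, ?_⟩
  filter_upwards [bv_ev h (8*ε) (by linarith) (by linarith), ev_log 1, ev_log (1/ε),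
    Filter.eventually_ge_atTop 1] with y hbv hL1 hLε hy1 Y hW F hF
  obtain ⟨hyY, hlog⟩ := hW
  have hy0 : (0:ℝ) < y := by exact_mod_cast hy1
  have hY0 : (0:ℝ) < Y := by exact_mod_cast hy1.trans hyY
  have hy1' : (1:ℝ) ≤ y := by exact_mod_cast hy1
  set L := Real.log y with hL
  rw [abs_le] at hlog
  rw [div_le_iff₀ hε] at hLε
  have hYy : (Y:ℝ) ≤ (y:ℝ)^(1+8*ε/4) := by
    rw [← Real.log_le_log_iff hY0 (by positivity), Real.log_rpow hy0]
    linarith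
  have h1 := hbv Y hyY hYy F hF
  have hM : ∑ n ∈ Ioc y Y, Λ n / n ≤ ε*L + 8 := by
    have := (abs_le.1 (mertens_L y Y hy1 hyY)).2
    linarith
  have hM0 : 0 ≤ ∑ n ∈ Ioc y Y, Λ n / n :=
    sum_nonneg (fun n _ => div_nonneg ArithmeticFunction.vonMangoldt_nonneg (by positivity))
  have h2 : ∑ q ∈ F, Real.log q / ((q:ℝ)-1) ≤ L/2 + C := by
    have := hC ((y:ℝ)^(8*ε)) ((y:ℝ)^(1/2-8*ε)) (Real.one_le_rpow hy1' (by linarith))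
      (Real.rpow_le_rpow_of_exponent_le hy1' (by linarith)) F (fun q hq => ⟨(hF q hq).1, (hF q hq).2.2⟩)
    rw [Real.log_rpow hy0, Real.log_rpow hy0] at this
    have h3 : 0 ≤ ε * L := by positivity
    linarith
  calc ∑ q ∈ F, Real.log q * Wd χ y Y q
      ≤ ∑ q ∈ F, (Real.log q * |∑ n ∈ Ioc y Y, Λ n * (Kq χ q n / n)| + Real.log q / ((q:ℝ)-1) * ∑ n ∈ Ioc y Y, Λ n / n) := by
        apply sum_le_sum
        intro q hq
        have := mul_le_mul_of_nonneg_left (Wd_le_K (χ := χ) y Y q (hF q hq).1) (Real.log_natCast_nonneg q)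
        refine this.trans_eq ?_
        ring
    _ ≤ 1 + (L/2 + C) * (ε*L+8) := by
        rw [sum_add_distrib, ← sum_mul]
        apply add_le_add h1
        apply mul_le_mul h2 hM hM0 (by positivity)
    _ ≤ ε/2 * L^2 + (5+9*C)*L := by
        have h3 : C * ε * L ≤ C * 1 * L := by gcongr; linarith
        have h4 : C * 1 ≤ C * L := by gcongr
        linarith

lemma pieceBT {D : ℕ} {χ : ℕ → ℤ} (h : SignChar D χ) (ε σ : ℝ) (hε : 0 < ε) (hε1 : ε < 1) (hσ : 0 < σ) (hσ1 : σ < 1) :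
    ∃ C : ℝ, 0 ≤ C ∧ ∀ᶠ y : ℕ in Filter.atTop, ∀ Y : ℕ, Win ε y Y → ∀ s : ℝ, 0 ≤ s → s ≤ σ → ∀ F : Finset ℕ,
    (∀ q ∈ F, q.Prime ∧ ¬ q ∣ D ∧ (y:ℝ)^s ≤ q ∧ (q:ℝ) ≤ (y:ℝ)^σ) →
    ∑ q ∈ F, Real.log q * Wd χ y Y q ≤ (2*(1+ε)^2*(σ-s)/(1-σ)*ε) * (Real.log y)^2 + C * Real.log y := by
  obtain ⟨C, hC0, hC⟩ := sum_log_qm1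
  obtain ⟨A, hA⟩ : ∃ A, A = 2*(1+ε)/(1-σ) := ⟨_, rfl⟩
  have hσ' : 0 < 1 - σ := by linarith
  have hA0 : 0 < A := by rw [hA]; positivity
  refine ⟨C*((1+ε)+1)*(A*ε+A+1) + σ*(A*ε+A+1) + σ*(1+ε)*(A+1), by positivity, ?_⟩
  filter_upwards [bt_signed h σ ε hσ hσ1 hε hε1, ev_log 1, 
    Filter.eventually_ge_atTop 1] with y hbt hL1 hy1 Y hW s hs hsσ F hF
  obtain ⟨hyY, hlog⟩ := hW
  have hy0 : (0:ℝ) < y := by exact_mod_cast hy1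
  have hY0 : (0:ℝ) < Y := by exact_mod_cast hy1.trans hyY
  have hy1' : (1:ℝ) ≤ y := by exact_mod_cast hy1
  have hlogyY : Real.log y ≤ Real.log Y := Real.log_le_log hy0 (by exact_mod_cast hyY)
  obtain ⟨L, hL⟩ : ∃ L, L = Real.log y := ⟨_, rfl⟩
  rw [← hL] at hlog hL1 hlogyY ⊢
  rw [abs_le] at hlog
  have hL0 : 0 < L := by linarith
  have h2 : ∑ q ∈ F, Real.log q / ((q:ℝ)-1) ≤ (σ-s)*L + C := by
    have := hC ((y:ℝ)^s) ((y:ℝ)^σ) (Real.one_le_rpow hy1' hs)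
      (Real.rpow_le_rpow_of_exponent_le hy1' hsσ) F (fun q hq => ⟨(hF q hq).1, (hF q hq).2.2⟩)
    rw [Real.log_rpow hy0, Real.log_rpow hy0] at this
    rw [hL]; linarith
  have hb0 : 0 ≤ ((1+ε)+1/L) * (A*(ε*L+1)+1) := by positivity
  have hq : ∀ q ∈ F, Wd χ y Y q ≤ 1/((q:ℝ)-1) * (((1+ε)+1/L) * (A*(ε*L+1)+1)) := by
    intro q hq
    obtain ⟨q1, q2, q3, q4⟩ := hF q hq
    have hq2 : (2:ℝ) ≤ q := by exact_mod_cast q1.two_le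
    have hqp : 0 ≤ 1/((q:ℝ)-1) := div_nonneg zero_le_one (by linarith)
    have hlq : Real.log q ≤ σ * L := by
      have := Real.log_le_log (by linarith) q4
      rwa [Real.log_rpow hy0, ← hL] at this
    have h3 := hbt Y hyY q q1 q2 q4
    rw [← hL] at h3
    have h4 : Wd χ y Y q ≤ Real.log Y * ∑ p ∈ Ioc y Y with p.Prime ∧ cong χ q p, 1/(p:ℝ) := by
      rw [Wd, mul_sum, filter_congr (fun p _ => by rw [← cong_iff_mm])]
      apply sum_le_sum
      intro p hp
      rw [mem_filter, mem_Ioc] at hp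
      rw [mul_one_div]
      have : Real.log p ≤ Real.log Y := Real.log_le_log (by exact_mod_cast hp.2.1.pos) (by exact_mod_cast hp.1.2)
      gcongr
    have h5 : 2*(1+ε)*(Real.log Y - L)/(L - Real.log q) + 1/L ≤ (A*(ε*L+1)+1)/L := by
      have : 2*(1+ε)*(Real.log Y - L)/(L - Real.log q) ≤ 2*(1+ε)*(ε*L+1)/((1-σ)*L) := by
        apply div_le_div₀ (by positivity) _ (by positivity) (by linarith)
        apply mul_le_mul_of_nonneg_left (by linarith) (by positivity)
      refine (add_le_add this le_rfl).trans_eq ?_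
      rw [hA]; field_simp
    have hlY0 : 0 ≤ Real.log Y := by linarith
    calc Wd χ y Y q ≤ Real.log Y * (1/((q:ℝ)-1) * ((A*(ε*L+1)+1)/L)) := by
          refine h4.trans ?_
          apply mul_le_mul_of_nonneg_left _ hlY0
          exact h3.trans (mul_le_mul_of_nonneg_left h5 hqp)
      _ ≤ ((1+ε)*L+1) * (1/((q:ℝ)-1) * ((A*(ε*L+1)+1)/L)) := by
          apply mul_le_mul_of_nonneg_right (by linarith)
          apply mul_nonneg hqp (by positivity)
      _ = _ := by field_simp
  calc ∑ q ∈ F, Real.log q * Wd χ y Y q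
      ≤ ∑ q ∈ F, Real.log q / ((q:ℝ)-1) * (((1+ε)+1/L) * (A*(ε*L+1)+1)) := by
        apply sum_le_sum
        intro q hqF
        refine (mul_le_mul_of_nonneg_left (hq q hqF) (Real.log_natCast_nonneg q)).trans_eq ?_
        ring
    _ ≤ ((σ-s)*L + C) * (((1+ε)+1/L) * (A*(ε*L+1)+1)) := by
        rw [← sum_mul]
        exact mul_le_mul_of_nonneg_right h2 hb0
    _ ≤ _ := by
        have hi : 1/L ≤ 1 := by rw [div_le_one hL0]; exact hL1
        have hi0 : 0 < 1/L := by positivity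
        have k1 : C * (((1+ε)+1/L) * (A*(ε*L+1)+1)) ≤ C*((1+ε)+1)*(A*ε+A+1) * L := by
          have : A*(ε*L+1)+1 ≤ (A*ε+A+1)*L := by
            have := mul_le_mul_of_nonneg_left hL1 hA0.le
            linarith
          calc C * (((1+ε)+1/L) * (A*(ε*L+1)+1)) ≤ C * (((1+ε)+1) * ((A*ε+A+1)*L)) := by gcongr
            _ = _ := by ring
        have k2 : (σ-s)*L * (1/L * (A*(ε*L+1)+1)) ≤ σ*(A*ε+A+1) * L := by
          have : A*(ε*L+1)+1 ≤ (A*ε+A+1)*L := by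
            have := mul_le_mul_of_nonneg_left hL1 hA0.le
            linarith
          calc (σ-s)*L * (1/L * (A*(ε*L+1)+1)) = (σ-s) * (A*(ε*L+1)+1) := by field_simp
            _ ≤ σ * ((A*ε+A+1)*L) := by gcongr; linarith
            _ = _ := by ring
        have k3 : (σ-s)*L*(1+ε)*(A+1) ≤ σ*(1+ε)*(A+1)*L := by
          have : (σ-s)*(L*(1+ε)*(A+1)) ≤ σ*(L*(1+ε)*(A+1)) := by gcongr; linarith
          linarith
        have k4 : 2*(1+ε)^2*(σ-s)/(1-σ)*ε * L^2 = (σ-s)*L*(1+ε)*A*ε*L := by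
          rw [hA]; field_simp
        rw [k4]
        linarith
end FI
end Part15

section Part16
open Matrix Finset
open scoped ArithmeticFunction.vonMangoldt ArithmeticFunction.Moebius ArithmeticFunction.zeta
namespace FI

lemma sum_mult (d M : ℕ) (hd : 1 ≤ d) (hM : 1 ≤ M) :
    ∑ s ∈ (Ioc 0 M).filter (fun s => d ∣ s), (1:ℝ)/s ≤ (1/d) * (1 + Real.log M) := by
  have h1 : ∑ m ∈ Ioc 0 M, (1:ℝ)/m ≤ 1 + Real.log M := by
    rw [← Ioc_union_Ioc_eq_Ioc (Nat.zero_le 1) hM, sum_union (Ioc_disjoint_Ioc_of_le le_rfl)]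
    have := harmonic_le (le_refl 1) hM
    rw [Nat.cast_one, Real.log_one] at this
    have e : ∑ m ∈ Ioc (0:ℕ) 1, (1:ℝ)/(m:ℝ) = 1 := by
      rw [show Ioc (0:ℕ) 1 = {1} from rfl]; simp
    rw [e]; linarith
  have hd0 : (0:ℝ) < d := by exact_mod_cast hd
  calc ∑ s ∈ (Ioc 0 M).filter (fun s => d ∣ s), (1:ℝ)/s ≤ ∑ s ∈ (Ioc 0 M).image (fun m => d*m), (1:ℝ)/s := by
        apply sum_le_sum_of_subset_of_nonneg
        · intro s hs
          rw [mem_filter, mem_Ioc] at hs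
          obtain ⟨⟨s1, s2⟩, ⟨m, rfl⟩⟩ := hs
          rw [mem_image]
          refine ⟨m, ?_, rfl⟩
          rw [mem_Ioc]
          refine ⟨Nat.pos_of_mul_pos_left s1, le_trans (Nat.le_mul_of_pos_left m hd) s2⟩
        · intro s _ _; positivity
    _ = ∑ m ∈ Ioc 0 M, (1:ℝ)/((d*m:ℕ):ℝ) := by
        apply sum_image
        intro a _ b _ hab
        exact Nat.eq_of_mul_eq_mul_left hd hab
    _ = (1/d) * ∑ m ∈ Ioc 0 M, (1:ℝ)/m := by
        rw [mul_sum]; apply sum_congr rfl; intro m _; push_cast; rw [one_div_mul_one_div]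
    _ ≤ _ := by gcongr

lemma mm_cases {D : ℕ} {χ : ℕ → ℤ} (h : SignChar D χ) (p : ℕ) (hp : p.Prime) (hD : D < p) :
    mm χ p = p - 1 ∨ mm χ p = p + 1 := by
  have h1 : χ p ≠ 0 := by
    rw [h.zero, Nat.Prime.coprime_iff_not_dvd hp]
    intro h2
    have := Nat.le_of_dvd h.pos h2; omega
  have := hp.two_le
  unfold mm sg
  rcases h.val p with h2 | h2 | h2
  · exact absurd h2 h1
  · left; rw [h2]; omega
  · right; rw [h2]; omega

lemma Wd_crude {D : ℕ} {χ : ℕ → ℤ} (h : SignChar D χ) (y Y d : ℕ) (hd : 1 ≤ d) (hy : D ≤ y) (hY : 1 ≤ Y) :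
    Wd χ y Y d ≤ Real.log Y * (4 * ((1/d) * (1 + Real.log ((Y+1:ℕ):ℝ)))) := by
  have hlY : 0 ≤ Real.log Y := Real.log_natCast_nonneg Y
  have h1 : ∀ g : ℕ → ℕ, (∀ p ∈ Ioc y Y, 1 < p → 0 < g p ∧ g p ≤ Y+1 ∧ g p ≤ p+1) →
      (∀ a b, 1 < a → 1 < b → g a = g b → a = b) →
      ∑ p ∈ (Ioc y Y).filter (fun p => p.Prime ∧ d ∣ g p), Real.log p / p ≤
        Real.log Y * (2 * ((1/d) * (1 + Real.log ((Y+1:ℕ):ℝ)))) := by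
    intro g hg hinj
    calc ∑ p ∈ (Ioc y Y).filter (fun p => p.Prime ∧ d ∣ g p), Real.log p / p
        ≤ ∑ p ∈ (Ioc y Y).filter (fun p => p.Prime ∧ d ∣ g p), Real.log Y * (2 * (1/(g p:ℝ))) := by
          apply sum_le_sum
          intro p hp
          rw [mem_filter] at hp
          obtain ⟨g1, g2, g3⟩ := hg p hp.1 hp.2.1.one_lt
          have hp2 := hp.2.1.two_le
          rw [mem_Ioc] at hp
          have hl : Real.log p ≤ Real.log Y := Real.log_le_log (by exact_mod_cast hp.2.1.pos) (by exact_mod_cast hp.1.2)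
          have g4 : (g p:ℝ) ≤ p + 1 := by exact_mod_cast g3
          have p2 : (2:ℝ) ≤ p := by exact_mod_cast hp2
          have g5 : (0:ℝ) < g p := by exact_mod_cast g1
          have : 1/(p:ℝ) ≤ 2 * (1/(g p:ℝ)) := by
            rw [mul_one_div, div_le_div_iff₀ (by linarith) g5]; linarith
          calc Real.log p / p = Real.log p * (1/p) := by ring
            _ ≤ _ := by gcongr
      _ = Real.log Y * (2 * ∑ p ∈ (Ioc y Y).filter (fun p => p.Prime ∧ d ∣ g p), (1:ℝ)/(g p)) := by
          rw [mul_sum, mul_sum]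
      _ = Real.log Y * (2 * ∑ s ∈ ((Ioc y Y).filter (fun p => p.Prime ∧ d ∣ g p)).image g, (1:ℝ)/s) := by
          rw [sum_image]
          intro a ha b hb hab
          simp only [coe_filter] at ha hb
          exact hinj a b ha.2.1.one_lt hb.2.1.one_lt hab
      _ ≤ Real.log Y * (2 * ∑ s ∈ (Ioc 0 (Y+1)).filter (fun s => d ∣ s), (1:ℝ)/s) := by
          apply mul_le_mul_of_nonneg_left _ hlY
          apply mul_le_mul_of_nonneg_left _ (by norm_num)
          apply sum_le_sum_of_subset_of_nonneg
          · intro s hs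
            rw [mem_image] at hs
            obtain ⟨p, hp, rfl⟩ := hs
            rw [mem_filter] at hp
            obtain ⟨g1, g2, g3⟩ := hg p hp.1 hp.2.1.one_lt
            rw [mem_filter, mem_Ioc]
            exact ⟨⟨g1, g2⟩, hp.2.2⟩
          · intro s _ _; positivity
      _ ≤ _ := by
          apply mul_le_mul_of_nonneg_left _ hlY
          apply mul_le_mul_of_nonneg_left _ (by norm_num)
          exact sum_mult d (Y+1) hd (by omega)
  have h2 := h1 (fun p => p - 1) (fun p hp h => by rw [mem_Ioc] at hp; omega) (fun a b _ _ h => by omega)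
  have h3 := h1 (fun p => p + 1) (fun p hp h => by rw [mem_Ioc] at hp; omega) (fun a b _ _ h => by omega)
  have h4 : Wd χ y Y d ≤ ∑ p ∈ (Ioc y Y).filter (fun p => p.Prime ∧ d ∣ p - 1), Real.log p / p +
      ∑ p ∈ (Ioc y Y).filter (fun p => p.Prime ∧ d ∣ p + 1), Real.log p / p := by
    rw [Wd, sum_filter, sum_filter, sum_filter, ← sum_add_distrib]
    apply sum_le_sum
    intro p hp
    rw [mem_Ioc] at hp
    have hn : 0 ≤ Real.log p / p := div_nonneg (Real.log_natCast_nonneg p) (by positivity)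
    by_cases hpp : p.Prime
    · rcases mm_cases h p hpp (by omega) with e | e
      · rw [e]
        have : (0:ℝ) ≤ (if p.Prime ∧ d ∣ p + 1 then Real.log p / p else 0) := by split_ifs <;> [exact hn; exact le_rfl]
        linarith
      · rw [e]
        have : (0:ℝ) ≤ (if p.Prime ∧ d ∣ p - 1 then Real.log p / p else 0) := by split_ifs <;> [exact hn; exact le_rfl]
        linarith
    · simp [hpp]
  linarith

lemma Wd_le_all (χ : ℕ → ℤ) (y Y d : ℕ) : Wd χ y Y d ≤ ∑ p ∈ (Ioc y Y).filter Nat.Prime, Real.log p / p := by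
  apply sum_le_sum_of_subset_of_nonneg
  · intro p hp
    rw [mem_filter] at hp ⊢
    exact ⟨hp.1, hp.2.1⟩
  · intro p _ _; exact div_nonneg (Real.log_natCast_nonneg p) (by positivity)

lemma pieceA {D : ℕ} {χ : ℕ → ℤ} (h : SignChar D χ) (ε : ℝ) (hε : 0 < ε) (hε1 : ε < 1) :
    ∃ C : ℝ, 0 ≤ C ∧ ∀ᶠ y : ℕ in Filter.atTop, ∀ Y : ℕ, Win ε y Y →
    ∑ d ∈ (Ioc 0 (Y+1)).filter (fun d => ¬ d.Prime ∨ d ∣ D), Λ d * Wd χ y Y d ≤ ε^2 * (Real.log y)^2 + C * Real.log y := by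
  obtain ⟨C1, hC10, hC1⟩ := mertens_primes
  have hτ : 0 < ε^2/60 := by positivity
  obtain ⟨S, hS⟩ := summable_iff_vanishing_norm.1 summable_npL (ε^2/60) hτ
  obtain ⟨K, hKS, hKD⟩ : ∃ K : ℕ, (∀ n ∈ S, n ≤ K) ∧ D ≤ K := by
    refine ⟨S.sup id + D, fun n hn => ?_, by omega⟩
    have : id n ≤ S.sup id := le_sup hn
    simp only [id] at this; omega
  have hlK : 0 ≤ Real.log K := Real.log_natCast_nonneg K
  refine ⟨K * Real.log K * (C1+2), by positivity, ?_⟩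
  filter_upwards [ev_log 1, Filter.eventually_ge_atTop (D+1)] with y hL1 hyD Y hW
  obtain ⟨hyY, hlog⟩ := hW
  have hy1 : 1 ≤ y := by omega
  have hy0 : (0:ℝ) < y := by exact_mod_cast hy1
  have hY0 : (0:ℝ) < Y := by exact_mod_cast hy1.trans hyY
  obtain ⟨L, hL⟩ : ∃ L, L = Real.log y := ⟨_, rfl⟩
  rw [← hL] at hlog hL1 ⊢
  rw [abs_le] at hlog
  have hL0 : 0 < L := by linarith
  have hεL : ε * L ≤ 1 * L := by gcongr
  have hlY : Real.log Y ≤ 3*L := by linarith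
  have hlY1 : 1 + Real.log ((Y+1:ℕ):ℝ) ≤ 5*L := by
    have : ((Y+1:ℕ):ℝ) ≤ 2*Y := by
      push_cast
      have : (1:ℝ) ≤ Y := by exact_mod_cast hy1.trans hyY
      linarith
    have := Real.log_le_log (by positivity) this
    rw [Real.log_mul (by norm_num) hY0.ne'] at this
    have := Real.log_two_lt_d9
    linarith
  have hall : ∑ p ∈ (Ioc y Y).filter Nat.Prime, Real.log p / p ≤ (C1+2)*L := by
    have := (abs_le.1 (hC1 y Y hy1 hyY)).2
    have h2 : C1 * 1 ≤ C1 * L := by gcongr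
    linarith
  have hsm : ∑ d ∈ (Ioc 0 (Y+1)).filter (fun d => (¬ d.Prime ∨ d ∣ D) ∧ d ≤ K), Λ d * Wd χ y Y d ≤ K * Real.log K * (C1+2) * L := by
    calc _ ≤ ∑ d ∈ Ioc 0 K, Real.log K * ((C1+2)*L) := by
          refine (sum_le_sum_of_subset_of_nonneg (t := Ioc 0 K) ?_ ?_).trans ?_
          · intro d hd
            rw [mem_filter, mem_Ioc] at hd
            rw [mem_Ioc]; exact ⟨hd.1.1, hd.2.2⟩
          · intro d _ _; exact mul_nonneg ArithmeticFunction.vonMangoldt_nonneg (Wd_nonneg _ _ _ _)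
          · apply sum_le_sum
            intro d hd
            rw [mem_Ioc] at hd
            have l1 : Λ d ≤ Real.log K := ArithmeticFunction.vonMangoldt_le_log.trans
              (Real.log_le_log (by exact_mod_cast hd.1) (by exact_mod_cast hd.2))
            exact mul_le_mul l1 ((Wd_le_all _ _ _ _).trans hall) (Wd_nonneg _ _ _ _) hlK
      _ = _ := by rw [sum_const, Nat.card_Ioc, nsmul_eq_mul, Nat.sub_zero]; ring
  have htl : ∑ d ∈ (Ioc 0 (Y+1)).filter (fun d => (¬ d.Prime ∨ d ∣ D) ∧ ¬ d ≤ K), Λ d * Wd χ y Y d ≤ ε^2 * L^2 := by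
    calc _ ≤ ∑ d ∈ (Ioc 0 (Y+1)).filter (fun d => (¬ d.Prime ∨ d ∣ D) ∧ ¬ d ≤ K), npL d * (60*L^2) := by
          apply sum_le_sum
          intro d hd
          rw [mem_filter, mem_Ioc] at hd
          have hnp : ¬ d.Prime := by
            rcases hd.2.1 with h1 | h1
            · exact h1
            · have := Nat.le_of_dvd h.pos h1; omega
          have hd0 : (0:ℝ) < d := by exact_mod_cast hd.1.1
          rw [npL, if_neg hnp]
          have hw := Wd_crude h y Y d hd.1.1 (by omega) (by omega)
          have : Real.log Y * (4 * ((1/d) * (1 + Real.log ((Y+1:ℕ):ℝ)))) ≤ (3*L) * (4 * ((1/d)*(5*L))) := by gcongr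
          calc Λ d * Wd χ y Y d ≤ Λ d * ((3*L) * (4 * ((1/d)*(5*L)))) :=
                mul_le_mul_of_nonneg_left (hw.trans this) ArithmeticFunction.vonMangoldt_nonneg
            _ = _ := by ring
      _ ≤ ε^2/60 * (60*L^2) := by
          rw [← sum_mul]
          apply mul_le_mul_of_nonneg_right _ (by positivity)
          have := hS ((Ioc 0 (Y+1)).filter (fun d => (¬ d.Prime ∨ d ∣ D) ∧ ¬ d ≤ K)) (by
            rw [disjoint_left]
            intro d hd hdS
            rw [mem_filter] at hd
            exact hd.2.2 (hKS d hdS))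
          exact (le_abs_self _).trans this.le
      _ = _ := by ring
  have e := sum_filter_add_sum_filter_not ((Ioc 0 (Y+1)).filter (fun d => ¬ d.Prime ∨ d ∣ D)) (fun d => d ≤ K) (fun d => Λ d * Wd χ y Y d)
  rw [filter_filter, filter_filter] at e
  rw [← e]
  linarith
end FI
end Part16

section Part17
open Matrix Finset
open scoped ArithmeticFunction.vonMangoldt ArithmeticFunction.Moebius ArithmeticFunction.zeta
namespace FI

open Classical in
lemma cover5 (R : Finset ℕ) (f : ℕ → ℝ) (hf : ∀ d, 0 ≤ f d) (P : Fin 5 → ℕ → Prop)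
    (hP : ∀ d ∈ R, ∃ i, P i d) :
    ∑ d ∈ R, f d ≤ ∑ i, ∑ d ∈ R.filter (P i), f d := by
  have : ∀ i, ∑ d ∈ R.filter (P i), f d = ∑ d ∈ R, if P i d then f d else 0 := fun i => sum_filter _ _
  simp_rw [this]
  rw [sum_comm]
  apply sum_le_sum
  intro d hd
  obtain ⟨i, hi⟩ := hP d hd
  have h1 : (if P i d then f d else 0) ≤ ∑ i, if P i d then f d else 0 :=
    single_le_sum (f := fun i => if P i d then f d else 0) (fun j _ => by
      show 0 ≤ if P j d then f d else 0
      split_ifs <;> [exact hf d; exact le_rfl]) (mem_univ i)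
  rwa [if_pos hi] at h1

open Classical in
/-- primes p for which p - χ(p) has a prime factor exceeding Y^η -/
noncomputable def SE (χ : ℕ → ℤ) (η : ℝ) (y Y : ℕ) : ℝ :=
  ∑ p ∈ (Ioc y Y).filter (fun p => p.Prime ∧ ∃ q : ℕ, q.Prime ∧ (Y:ℝ)^η < q ∧ q ∣ mm χ p), Real.log p / p

lemma T_eq {D : ℕ} {χ : ℕ → ℤ} (h : SignChar D χ) (y Y : ℕ) :
    ∑ p ∈ (Ioc y Y).filter Nat.Prime, Real.log p / p * Real.log (mm χ p) = ∑ d ∈ Ioc 0 (Y+1), Λ d * Wd χ y Y d := by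
  simp_rw [Wd, mul_sum]
  have : ∀ d ∈ Ioc 0 (Y+1), ∑ p ∈ (Ioc y Y).filter (fun p => p.Prime ∧ d ∣ mm χ p), Λ d * (Real.log p / p) =
      ∑ p ∈ (Ioc y Y).filter Nat.Prime, if d ∣ mm χ p then Λ d * (Real.log p / p) else 0 := by
    intro d _
    rw [← filter_filter, sum_filter]
  rw [sum_congr rfl this, sum_comm]
  apply sum_congr rfl
  intro p hp
  rw [mem_filter, mem_Ioc] at hp
  have hne : mm χ p ≠ 0 := h.natAbs_ne p hp.2.two_le
  have hle : mm χ p ≤ p + 1 := h.natAbs_le p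
  rw [← ArithmeticFunction.vonMangoldt_sum (n := mm χ p), mul_sum, ← sum_filter]
  have e : (Ioc 0 (Y+1)).filter (fun d => d ∣ mm χ p) = (mm χ p).divisors := by
    ext d
    rw [mem_filter, mem_Ioc, Nat.mem_divisors]
    constructor
    · intro h1; exact ⟨h1.2, hne⟩
    · intro h1
      have := Nat.le_of_dvd (Nat.pos_of_ne_zero hne) h1.1
      exact ⟨⟨Nat.pos_of_dvd_of_pos h1.1 (Nat.pos_of_ne_zero hne), by omega⟩, h1.1⟩
  rw [e]
  apply sum_congr rfl; intro d _; ring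

lemma pieceE {D : ℕ} {χ : ℕ → ℤ} (h : SignChar D χ) (η : ℝ) (y Y : ℕ) (F : Finset ℕ)
    (hF : ∀ q ∈ F, q.Prime ∧ (Y:ℝ)^η < q) :
    ∑ q ∈ F, Real.log q * Wd χ y Y q ≤ Real.log ((Y+1:ℕ):ℝ) * SE χ η y Y := by
  classical
  simp_rw [Wd, mul_sum]
  have : ∀ d ∈ F, ∑ p ∈ (Ioc y Y).filter (fun p => p.Prime ∧ d ∣ mm χ p), Real.log d * (Real.log p / p) =
      ∑ p ∈ (Ioc y Y).filter Nat.Prime, if d ∣ mm χ p then Real.log d * (Real.log p / p) else 0 := by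
    intro d _
    rw [← filter_filter, sum_filter]
  rw [sum_congr rfl this, sum_comm, SE, ← filter_filter, mul_sum, sum_filter (fun p : ℕ => ∃ q : ℕ, q.Prime ∧ (Y:ℝ)^η < q ∧ q ∣ mm χ p)]
  apply sum_le_sum
  intro p hp
  rw [mem_filter, mem_Ioc] at hp
  have hne : mm χ p ≠ 0 := h.natAbs_ne p hp.2.two_le
  have hle : mm χ p ≤ p + 1 := h.natAbs_le p
  have hn : 0 ≤ Real.log p / p := div_nonneg (Real.log_natCast_nonneg p) (by positivity)
  rw [← sum_filter, ← sum_mul]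
  split_ifs with h1
  · apply mul_le_mul_of_nonneg_right _ hn
    refine (sum_log_primes_dvd (mm χ p) hne _ ?_).trans ?_
    · intro q hq
      rw [mem_filter] at hq
      exact ⟨(hF q hq.1).1, hq.2⟩
    · apply Real.log_le_log
      · exact_mod_cast Nat.pos_of_ne_zero hne
      · exact_mod_cast (by omega : mm χ p ≤ Y+1)
  · rw [filter_false_of_mem]
    · simp
    · intro q hq hd
      exact h1 ⟨q, (hF q hq).1, (hF q hq).2, hd⟩

lemma T_lower {D : ℕ} {χ : ℕ → ℤ} (h : SignChar D χ) (ε : ℝ) :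
    ∃ C : ℝ, 0 ≤ C ∧ ∀ᶠ y : ℕ in Filter.atTop, ∀ Y : ℕ, Win ε y Y →
    ε * (Real.log y)^2 - C * Real.log y ≤ ∑ d ∈ Ioc 0 (Y+1), Λ d * Wd χ y Y d := by
  obtain ⟨C1, hC10, hC1⟩ := mertens_primes
  refine ⟨C1+1, by linarith, ?_⟩
  filter_upwards [ev_log 1, Filter.eventually_ge_atTop (D+1)] with y hL1 hyD Y hW
  obtain ⟨hyY, hlog⟩ := hW
  rw [abs_le] at hlog
  have hy1 : 1 ≤ y := by omega
  rw [← T_eq h]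
  calc ε * (Real.log y)^2 - (C1+1) * Real.log y = (ε * Real.log y - (C1+1)) * Real.log y := by ring
    _ ≤ (∑ p ∈ (Ioc y Y).filter Nat.Prime, Real.log p / p) * Real.log y := by
        apply mul_le_mul_of_nonneg_right _ (by linarith)
        have := (abs_le.1 (hC1 y Y hy1 hyY)).1
        linarith
    _ ≤ _ := by
        rw [sum_mul]
        apply sum_le_sum
        intro p hp
        rw [mem_filter, mem_Ioc] at hp
        apply mul_le_mul_of_nonneg_left _ (div_nonneg (Real.log_natCast_nonneg p) (by positivity))
        apply Real.log_le_log (by exact_mod_cast hy1)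
        rcases mm_cases h p hp.2 (by omega) with e | e <;> rw [e] <;> exact_mod_cast (by omega)

lemma goldfeld0 {D : ℕ} {χ : ℕ → ℤ} (h : SignChar D χ) (ε η σ : ℝ) (hε : 0 < ε) (hε1 : ε ≤ 1/400)
    (hη : 1/2 < η) (hσ : σ = η*(1+2*ε)) (hσ1 : σ < 1) :
    ∃ C : ℝ, 0 ≤ C ∧ ∀ᶠ y : ℕ in Filter.atTop, ∀ Y : ℕ, Win ε y Y →
    ε * (Real.log y)^2 - C * Real.log y ≤
      (ε^2 + 2*(1+ε)^2*(8*ε)/(1-8*ε)*ε + ε/2 + 2*(1+ε)^2*(σ-(1/2-8*ε))/(1-σ)*ε) * (Real.log y)^2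
        + ((1+ε)*Real.log y + 2) * SE χ η y Y := by
  classical
  have hσh : 1/2 < σ := by
    rw [hσ]; have : 0 < η * ε := by positivity
    linarith
  obtain ⟨CA, hCA0, hA⟩ := pieceA h ε hε (by linarith)
  obtain ⟨CB, hCB0, hB⟩ := pieceBT h ε (8*ε) hε (by linarith) (by linarith) (by linarith)
  obtain ⟨CC, hCC0, hC⟩ := pieceC h ε hε hε1
  obtain ⟨CD, hCD0, hD⟩ := pieceBT h ε σ hε (by linarith) (by linarith) hσ1
  obtain ⟨CT, hCT0, hT⟩ := T_lower h ε
  refine ⟨CA + CB + CC + CD + CT, by positivity, ?_⟩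
  filter_upwards [hA, hB, hC, hD, hT, ev_log 1, ev_log (1/ε), Filter.eventually_ge_atTop 1]
    with y hA hB hC hD hT hL1 hLε hy1 Y hW
  have hA := hA Y hW
  have hB := hB Y hW 0 le_rfl (by linarith)
  have hC := hC Y hW
  have hD := hD Y hW (1/2-8*ε) (by linarith) (by linarith)
  have hT := hT Y hW
  obtain ⟨hyY, hlog⟩ := hW
  rw [abs_le] at hlog
  have hy0 : (0:ℝ) < y := by exact_mod_cast hy1
  have hY1 : 1 ≤ Y := hy1.trans hyY
  have hY0 : (0:ℝ) < Y := by exact_mod_cast hY1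
  rw [div_le_iff₀ hε] at hLε
  obtain ⟨P, hPd⟩ : ∃ P : Fin 5 → ℕ → Prop, P = ![fun d => ¬ d.Prime ∨ d ∣ D,
    fun d => d.Prime ∧ ¬ d ∣ D ∧ (y:ℝ)^(0:ℝ) ≤ d ∧ (d:ℝ) ≤ (y:ℝ)^(8*ε),
    fun d => d.Prime ∧ ¬ d ∣ D ∧ (y:ℝ)^(8*ε) ≤ d ∧ (d:ℝ) ≤ (y:ℝ)^(1/2-8*ε),
    fun d => d.Prime ∧ ¬ d ∣ D ∧ (y:ℝ)^(1/2-8*ε) ≤ d ∧ (d:ℝ) ≤ (y:ℝ)^σ,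
    fun d => d.Prime ∧ (Y:ℝ)^η < d] := ⟨_, rfl⟩
  have hYη : (Y:ℝ)^η ≤ (y:ℝ)^σ := by
    rw [← Real.log_le_log_iff (by positivity) (by positivity), Real.log_rpow hy0, Real.log_rpow hY0, hσ, mul_assoc]
    apply mul_le_mul_of_nonneg_left _ (by linarith)
    linarith
  have hcov := cover5 (Ioc 0 (Y+1)) (fun d => Λ d * Wd χ y Y d)
    (fun d => mul_nonneg ArithmeticFunction.vonMangoldt_nonneg (Wd_nonneg _ _ _ _)) P (by
      intro d hd
      by_cases h1 : ¬ d.Prime ∨ d ∣ D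
      · exact ⟨0, by rw [hPd]; exact h1⟩
      · rw [not_or, not_not] at h1
        by_cases h2 : (d:ℝ) ≤ (y:ℝ)^(8*ε)
        · refine ⟨1, ?_⟩
          rw [hPd]
          refine ⟨h1.1, h1.2, ?_, h2⟩
          rw [Real.rpow_zero]; exact_mod_cast h1.1.one_lt.le
        · by_cases h3 : (d:ℝ) ≤ (y:ℝ)^(1/2-8*ε)
          · refine ⟨2, ?_⟩
            rw [hPd]
            exact ⟨h1.1, h1.2, (not_le.1 h2).le, h3⟩
          · by_cases h4 : (d:ℝ) ≤ (y:ℝ)^σ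
            · refine ⟨3, ?_⟩
              rw [hPd]
              exact ⟨h1.1, h1.2, (not_le.1 h3).le, h4⟩
            · refine ⟨4, ?_⟩
              rw [hPd]
              exact ⟨h1.1, lt_of_le_of_lt hYη (not_le.1 h4)⟩)
  rw [Fin.sum_univ_five] at hcov
  have hpr : ∀ F : Finset ℕ, (∀ q ∈ F, q.Prime) → ∑ d ∈ F, Λ d * Wd χ y Y d = ∑ d ∈ F, Real.log d * Wd χ y Y d := by
    intro F hF
    apply sum_congr rfl
    intro q hq
    rw [ArithmeticFunction.vonMangoldt_apply_prime (hF q hq)]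
  have e0 : (Ioc 0 (Y+1)).filter (P 0) = (Ioc 0 (Y+1)).filter (fun d => ¬ d.Prime ∨ d ∣ D) := by
    apply filter_congr; intro d _; rw [hPd]; rfl
  have m1 : ∀ q ∈ (Ioc 0 (Y+1)).filter (P 1), q.Prime ∧ ¬ q ∣ D ∧ (y:ℝ)^(0:ℝ) ≤ q ∧ (q:ℝ) ≤ (y:ℝ)^(8*ε) := by
    intro q hq; rw [mem_filter, hPd] at hq; exact hq.2
  have m2 : ∀ q ∈ (Ioc 0 (Y+1)).filter (P 2), q.Prime ∧ ¬ q ∣ D ∧ (y:ℝ)^(8*ε) ≤ q ∧ (q:ℝ) ≤ (y:ℝ)^(1/2-8*ε) := by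
    intro q hq; rw [mem_filter, hPd] at hq; exact hq.2
  have m3 : ∀ q ∈ (Ioc 0 (Y+1)).filter (P 3), q.Prime ∧ ¬ q ∣ D ∧ (y:ℝ)^(1/2-8*ε) ≤ q ∧ (q:ℝ) ≤ (y:ℝ)^σ := by
    intro q hq; rw [mem_filter, hPd] at hq; exact hq.2
  have m4 : ∀ q ∈ (Ioc 0 (Y+1)).filter (P 4), q.Prime ∧ (Y:ℝ)^η < q := by
    intro q hq; rw [mem_filter, hPd] at hq; exact hq.2
  rw [e0, hpr _ (fun q hq => (m1 q hq).1), hpr _ (fun q hq => (m2 q hq).1), hpr _ (fun q hq => (m3 q hq).1),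
    hpr _ (fun q hq => (m4 q hq).1)] at hcov
  have b1 := hB _ m1
  have b2 := hC _ m2
  have b3 := hD _ m3
  have b4 := pieceE h η y Y _ m4
  rw [sub_zero] at b1
  have hSE : 0 ≤ SE χ η y Y := sum_nonneg (fun p _ => div_nonneg (Real.log_natCast_nonneg p) (by positivity))
  have b5 : Real.log ((Y+1:ℕ):ℝ) ≤ (1+ε)*Real.log y + 2 := by
    have : ((Y+1:ℕ):ℝ) ≤ 2*Y := by
      push_cast
      have : (1:ℝ) ≤ Y := by exact_mod_cast hY1
      linarith
    have := Real.log_le_log (by positivity) this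
    rw [Real.log_mul (by norm_num) hY0.ne'] at this
    have := Real.log_two_lt_d9
    linarith
  have b6 := mul_le_mul_of_nonneg_right b5 hSE
  linarith
end FI
end Part17

section Part18
open Matrix Finset
namespace FI

theorem goldfeld {D : ℕ} {χ : ℕ → ℤ} (h : SignChar D χ) (η δ : ℝ) (hη : 1/2 < η) (hη1 : η < 3/5)
    (hδ0 : 0 < δ) (hδ : δ < (3-5*η)/(2*(1-η))) :
    ∃ ε0 : ℝ, 0 < ε0 ∧ ∀ ε : ℝ, 0 < ε → ε < ε0 → ∀ᶠ y : ℕ in Filter.atTop, ∀ Y : ℕ, Win ε y Y →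
      δ * ε * Real.log y ≤ SE χ η y Y := by
  obtain ⟨G, hG⟩ : ∃ G : ℝ → ℝ, G = fun ε => 1 - (ε + 2*(1+ε)^2*(8*ε)/(1-8*ε) + 1/2 +
    2*(1+ε)^2*(η*(1+2*ε)-(1/2-8*ε))/(1-η*(1+2*ε))) - δ*(1+ε) := ⟨_, rfl⟩
  have hne : 1 - η ≠ 0 := by linarith
  have hcont : ContinuousAt G 0 := by
    rw [hG]
    have h1 : ContinuousAt (fun ε : ℝ => 2*(1+ε)^2*(8*ε)/(1-8*ε)) 0 := by
      apply ContinuousAt.div (by fun_prop) (by fun_prop)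
      norm_num
    have h2 : ContinuousAt (fun ε : ℝ => 2*(1+ε)^2*(η*(1+2*ε)-(1/2-8*ε))/(1-η*(1+2*ε))) 0 := by
      apply ContinuousAt.div (by fun_prop) (by fun_prop)
      simpa using hne
    fun_prop
  have hG0 : 0 < G 0 := by
    have : G 0 = (3-5*η)/(2*(1-η)) - δ := by
      rw [hG]; simp only [mul_zero, add_zero, mul_one, sub_zero, zero_div, one_pow, zero_add]; field_simp; ring
    rw [this]; linarith
  have hev := hcont.eventually (lt_mem_nhds hG0)
  rw [Metric.eventually_nhds_iff] at hev
  obtain ⟨r, hr0, hr⟩ := hev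
  refine ⟨min r (1/400), by positivity, ?_⟩
  intro ε hε hεr
  have hGε : 0 < G ε := hr (by
    rw [Real.dist_eq, sub_zero, abs_of_pos hε]
    exact lt_of_lt_of_le hεr (min_le_left _ _))
  have hε4 : ε ≤ 1/400 := hεr.le.trans (min_le_right _ _)
  have hσ1 : η*(1+2*ε) < 1 := by
    have : η * ε ≤ 1 * ε := by gcongr; linarith
    linarith
  obtain ⟨C, hC0, hC⟩ := goldfeld0 h ε η _ hε hε4 hη rfl hσ1
  filter_upwards [hC, ev_log 1, ev_log ((C+2*δ*ε+1)/(ε*G ε))] with y hy hL1 hL2 Y hW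
  have hy := hy Y hW
  by_contra hlt
  rw [not_le] at hlt
  obtain ⟨L, hL⟩ : ∃ L, L = Real.log y := ⟨_, rfl⟩
  rw [← hL] at hy hL1 hL2 hlt
  have hεG : 0 < ε * G ε := by positivity
  rw [div_le_iff₀ hεG] at hL2
  have hL0 : 0 < L := by linarith
  have k1 : ((1+ε)*L + 2) * SE χ η y Y ≤ ((1+ε)*L + 2) * (δ*ε*L) := by gcongr
  have k2 : ε * G ε * L^2 = ε * L^2 - (ε^2 + 2*(1+ε)^2*(8*ε)/(1-8*ε)*ε + ε/2 +
    2*(1+ε)^2*(η*(1+2*ε)-(1/2-8*ε))/(1-η*(1+2*ε))*ε) * L^2 - (1+ε)*δ*ε*L^2 := by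
    rw [hG]; ring
  have k3 : ε * G ε * L^2 ≤ (C + 2*δ*ε) * L := by
    rw [k2]; linarith
  have k4 : (C+2*δ*ε+1) * L ≤ (L*(ε*G ε)) * L := by gcongr
  have k5 : (L*(ε*G ε)) * L = ε * G ε * L^2 := by ring
  linarith
end FI
end Part18

section Part19
open Matrix Finset
namespace FI

noncomputable def chi (Δ : ℤ) (n : ℕ) : ℤ := if n = 0 then 0 else jacobiSym (4*Δ) n

lemma chi_signChar (Δ : ℤ) (hΔ : 0 < Δ) : SignChar (16*Δ.natAbs) (chi Δ) := by
  have hpos : 0 < Δ.natAbs := Int.natAbs_pos.2 hΔ.ne'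
  have hzero : ∀ a, chi Δ a ≠ 0 ↔ a.Coprime (16*Δ.natAbs) := by
    intro a
    unfold chi
    split_ifs with h0
    · subst h0
      simp only [ne_eq, not_true_eq_false, false_iff, Nat.coprime_zero_left]
      omega
    · have : NeZero a := ⟨h0⟩
      rw [ne_eq, jacobiSym.eq_zero_iff_not_coprime, not_not]
      rw [Int.gcd, Int.natAbs_mul, Int.natAbs_natCast]
      change Nat.gcd (4 * Δ.natAbs) a = 1 ↔ _
      rw [← Nat.coprime_iff_gcd_eq_one, Nat.coprime_comm, Nat.coprime_mul_iff_right, Nat.coprime_mul_iff_right]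
      have e1 : a.Coprime 4 ↔ a.Coprime 2 := by
        rw [show 4 = 2^2 from rfl, Nat.coprime_pow_right_iff (by norm_num)]
      have e2 : a.Coprime 16 ↔ a.Coprime 2 := by
        rw [show 16 = 2^4 from rfl, Nat.coprime_pow_right_iff (by norm_num)]
      rw [e1, e2]
  refine ⟨by omega, ?_, ?_, ?_, hzero⟩
  · intro a b
    unfold chi
    by_cases ha : a = 0
    · simp [ha]
    by_cases hb : b = 0
    · simp [hb]
    rw [if_neg (mul_ne_zero ha hb), if_neg ha, if_neg hb]
    exact jacobiSym.mul_right' _ ha hb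
  · intro a
    unfold chi
    split_ifs
    · left; rfl
    · exact jacobiSym.trichotomy _ _
  · intro a
    rcases Nat.even_or_odd a with he | ho
    · have h2 : ∀ b : ℕ, Even b → chi Δ b = 0 := by
        intro b hb
        by_contra hne
        have h1 := (hzero b).1 hne
        have h2 : 2 ∣ Nat.gcd b (16*Δ.natAbs) := Nat.dvd_gcd hb.two_dvd ⟨8*Δ.natAbs, by ring⟩
        rw [h1] at h2
        omega
      rw [h2 a he, h2]
      rw [Nat.even_iff] at he ⊢
      rw [Nat.mod_mod_of_dvd _ ⟨8*Δ.natAbs, by ring⟩]; exact he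
    · have ho2 : Odd (a % (16*Δ.natAbs)) := by
        rw [Nat.odd_iff] at ho ⊢
        rw [Nat.mod_mod_of_dvd _ ⟨8*Δ.natAbs, by ring⟩]; exact ho
      unfold chi
      rw [if_neg ho2.pos.ne', if_neg ho.pos.ne', jacobiSym.mod_right (4*Δ) ho]
      congr 2
      rw [Int.natAbs_mul]; change _ = 4 * (4 * Δ.natAbs); ring

section ord
variable (A : Matrix (Fin 2) (Fin 2) ℤ)

lemma CH (hA : A.det = 1) : A * A = A.trace • A - 1 := by
  rw [Matrix.det_fin_two] at hA
  ext i j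
  fin_cases i <;> fin_cases j <;> simp [-zsmul_eq_mul, Matrix.mul_apply, Fin.sum_univ_two, Matrix.trace_fin_two, Matrix.smul_apply, smul_eq_mul] <;> linarith

noncomputable def Mp (p : ℕ) : Matrix (Fin 2) (Fin 2) (ZMod p) := A.map (Int.castRingHom (ZMod p))

lemma Mp_pow (p k : ℕ) : (Mp A p)^k = (A^k).map (Int.castRingHom (ZMod p)) := by
  unfold Mp
  rw [← RingHom.mapMatrix_apply, ← RingHom.mapMatrix_apply, map_pow]

lemma Mp_pow_eq_one (p k : ℕ) : (Mp A p)^k = 1 ↔ ∀ i j, (p:ℤ) ∣ (A^k - 1) i j := by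
  rw [Mp_pow, ← Matrix.ext_iff]
  apply forall_congr'; intro i
  apply forall_congr'; intro j
  rw [← ZMod.intCast_zmod_eq_zero_iff_dvd, Matrix.sub_apply, Int.cast_sub, sub_eq_zero, Matrix.map_apply]
  rw [Matrix.one_apply, Matrix.one_apply]
  constructor
  · intro h; rw [eq_intCast] at h; rw [h]; split_ifs <;> simp
  · intro h; rw [eq_intCast, h]; split_ifs <;> simp

lemma frob (hA : A.det = 1) (htr : 2 < |A.trace|) (p : ℕ) (hp : p.Prime) (hpD : ¬ p ∣ 16*(A.trace^2-4).natAbs) :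
    (Mp A p)^(mm (chi (A.trace^2-4)) p) = 1 := by
  have : Fact p.Prime := ⟨hp⟩
  obtain ⟨M, hM⟩ : ∃ M, M = Mp A p := ⟨_, rfl⟩
  obtain ⟨t, ht⟩ : ∃ t : ZMod p, t = (A.trace : ZMod p) := ⟨_, rfl⟩
  have hCH : M * M = t • M - 1 := by
    have := congrArg (fun X : Matrix (Fin 2) (Fin 2) ℤ => (Int.castRingHom (ZMod p)).mapMatrix X) (CH A hA)
    simp only [map_mul, map_sub, map_one] at this
    have e : (Int.castRingHom (ZMod p)).mapMatrix (A.trace • A) = t • M := by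
      ext i j; simp [-zsmul_eq_mul, hM, ht, Mp, Matrix.smul_apply, smul_eq_mul]
    rw [e] at this
    rw [hM]; rw [hM] at this; exact this
  have hp2 : p ≠ 2 := by
    rintro rfl; exact hpD ⟨8*(A.trace^2-4).natAbs, by ring⟩
  have h2 : (2 : ZMod p) ≠ 0 := by
    intro h0
    have : ((2:ℕ) : ZMod p) = 0 := by exact_mod_cast h0
    rw [ZMod.natCast_eq_zero_iff] at this
    exact hp2 ((Nat.prime_dvd_prime_iff_eq hp Nat.prime_two).1 this)
  have hΔ : ((A.trace^2-4 : ℤ) : ZMod p) ≠ 0 := by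
    rw [ne_eq, ZMod.intCast_zmod_eq_zero_iff_dvd, Int.natCast_dvd]
    intro h0; exact hpD (h0.mul_left _)
  have hchi : ((chi (A.trace^2-4) p : ℤ) : ZMod p) = (t^2-4)^(p/2) := by
    rw [chi, if_neg hp.ne_zero, ← jacobiSym.legendreSym.to_jacobiSym, legendreSym.eq_pow]
    push_cast
    rw [← ht, mul_pow]
    have : (4:ZMod p)^(p/2) = 1 := by
      rw [show (4:ZMod p) = 2^2 by norm_num, ← pow_mul, Nat.two_mul_odd_div_two (hp.eq_two_or_odd.resolve_left hp2)]
      exact ZMod.pow_card_sub_one_eq_one h2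
    rw [this, one_mul]
  obtain ⟨Bm, hB⟩ : ∃ Bm : Matrix (Fin 2) (Fin 2) (ZMod p), Bm = (2:ZMod p) • M - t • 1 := ⟨_, rfl⟩
  have hB2 : Bm^2 = (t^2-4) • (1 : Matrix (Fin 2) (Fin 2) (ZMod p)) := by
    rw [hB, pow_two, sub_mul, mul_sub, mul_sub]
    simp only [smul_mul_assoc, mul_smul_comm, mul_one, one_mul, hCH, smul_sub, smul_smul, sub_smul]
    module
  have hBp : Bm^p = (2:ZMod p) • M^p - t • 1 := by
    have hc : Commute ((2:ZMod p) • M) (t • (1 : Matrix (Fin 2) (Fin 2) (ZMod p))) := by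
      simp [commute_iff_eq]
      rw [smul_comm]
    rw [hB, sub_pow_char_of_commute p hc, smul_pow, smul_pow, one_pow, ZMod.pow_card, ZMod.pow_card]
  have hBp2 : Bm^p = ((chi (A.trace^2-4) p : ℤ) : ZMod p) • Bm := by
    have hodd := Nat.two_mul_odd_div_two (hp.eq_two_or_odd.resolve_left hp2)
    have : p = 2*(p/2) + 1 := by have := hp.two_le; omega
    have e : Bm^p = Bm^(2*(p/2)+1) := congrArg (fun n => Bm^n) this
    rw [e]
    rw [pow_succ, pow_mul, hB2, hchi, smul_pow, one_pow, smul_mul_assoc, one_mul]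
  rw [hBp] at hBp2
  have hinv : M * (t • 1 - M) = 1 := by
    rw [mul_sub, hCH]; simp
  have hcancel : ∀ X Y : Matrix (Fin 2) (Fin 2) (ZMod p), (2:ZMod p) • X = (2:ZMod p) • Y → X = Y :=
    fun X Y h => smul_right_injective _ h2 h
  rw [← hM]
  have hval := (chi_signChar (A.trace^2-4) (by
    have : (2:ℤ)^2 < |A.trace|^2 := by gcongr
    rw [sq_abs] at this; linarith)).val p
  have hp1 := hp.two_le
  rcases hval with h0 | h0 | h0
  · exfalso
    rw [h0] at hchi
    push_cast at hchi
    have : (t^2-4 : ZMod p) ≠ 0 := by rw [ht]; exact_mod_cast hΔ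
    exact pow_ne_zero _ this hchi.symm
  · have e : mm (chi (A.trace^2-4)) p = p - 1 := by unfold mm sg; rw [h0]; omega
    rw [e]
    rw [h0, Int.cast_one, one_smul, hB] at hBp2
    have h3 : M^p = M := hcancel _ _ (sub_left_injective hBp2)
    have h4 : M^(p-1) * M = M := by rw [← pow_succ, Nat.sub_add_cancel (by omega)]; exact h3
    have := congrArg (· * (t • 1 - M)) h4
    simp only [mul_assoc, hinv, mul_one] at this
    exact this
  · have e : mm (chi (A.trace^2-4)) p = p + 1 := by unfold mm sg; rw [h0]; omega
    rw [e]
    rw [h0, hB] at hBp2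
    have h3 : M^p = t • 1 - M := by
      apply hcancel
      have : (2:ZMod p) • M^p = t • (1 : Matrix (Fin 2) (Fin 2) (ZMod p)) + ((2:ZMod p) • M^p - t • 1) := by abel
      rw [this, hBp2]
      push_cast
      module
    rw [pow_succ', h3, hinv]
end ord
end FI
end Part19

section Part20
open Matrix Finset
namespace FI

/-- Lucas sequence attached to the trace. -/
def lu (t : ℤ) : ℕ → ℤ
  | 0 => 0
  | 1 => 1
  | (k+2) => t * lu t (k+1) - lu t k

lemma lu_succ (t : ℤ) (k : ℕ) : lu t (k+2) = t * lu t (k+1) - lu t k := by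
  simp only [lu]

lemma lu_growth (t : ℤ) (ht : 2 < |t|) (k : ℕ) : |lu t k| + 1 ≤ |lu t (k+1)| := by
  induction k with
  | zero => simp [lu]
  | succ k ih =>
    rw [lu_succ]
    have h1 : |t * lu t (k+1)| - |lu t k| ≤ |t * lu t (k+1) - lu t k| := abs_sub_abs_le_abs_sub _ _
    rw [abs_mul] at h1
    have h2 : 3 * |lu t (k+1)| ≤ |t| * |lu t (k+1)| := by
      apply mul_le_mul_of_nonneg_right (by omega) (abs_nonneg _)
    have := abs_nonneg (lu t k)
    linarith

lemma lu_le (t : ℤ) (ht : 2 < |t|) (k : ℕ) : |lu t (k+1)| ≤ (|t|+1)^k := by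
  induction k with
  | zero => simp [lu]
  | succ k ih =>
    rw [lu_succ]
    have h1 : |t * lu t (k+1) - lu t k| ≤ |t * lu t (k+1)| + |lu t k| := abs_sub _ _
    rw [abs_mul] at h1
    have h2 := lu_growth t ht k
    have h3 : (|t|+1) * |lu t (k+1)| ≤ (|t|+1) * (|t|+1)^k :=
      mul_le_mul_of_nonneg_left ih (by positivity)
    rw [pow_succ']
    linarith

lemma lu_ne (t : ℤ) (ht : 2 < |t|) (k : ℕ) (hk : 0 < k) : lu t k ≠ 0 := by
  obtain ⟨j, rfl⟩ : ∃ j, k = j+1 := ⟨k-1, by omega⟩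
  have := lu_growth t ht j
  have h2 := abs_nonneg (lu t j)
  intro h0
  rw [h0] at this
  simp at this
  linarith

variable (A : Matrix (Fin 2) (Fin 2) ℤ)

lemma pow_lu (hA : A.det = 1) (k : ℕ) : A^(k+1) = lu A.trace (k+1) • A - lu A.trace k • (1 : Matrix (Fin 2) (Fin 2) ℤ) := by
  induction k with
  | zero => simp [lu]
  | succ k ih =>
    rw [pow_succ, ih, sub_mul, smul_mul_assoc, smul_mul_assoc, one_mul, CH A hA, lu_succ]
    module

lemma dvd_lu (hA : A.det = 1) (p : ℕ) (hp : p.Prime) (hpD : ¬ p ∣ 16*(A.trace^2-4).natAbs) (k : ℕ) (hk : 0 < k)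
    (h : ∀ i j, (p:ℤ) ∣ (A^k-1) i j) : (p:ℤ) ∣ lu A.trace k := by
  obtain ⟨j, rfl⟩ : ∃ j, k = j+1 := ⟨k-1, by omega⟩
  by_contra hn
  rw [pow_lu A hA] at h
  have h00 := h 0 0
  have h01 := h 0 1
  have h10 := h 1 0
  have h11 := h 1 1
  simp only [Matrix.sub_apply, Matrix.smul_apply, smul_eq_mul, Matrix.one_apply] at h00 h01 h10 h11
  simp at h01 h10
  have hpp : Prime (p:ℤ) := Nat.prime_iff_prime_int.1 hp
  have b := (hpp.dvd_or_dvd h01).resolve_left hn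
  have c := (hpp.dvd_or_dvd h10).resolve_left hn
  have hd := dvd_sub h00 h11
  have hd2 : (p:ℤ) ∣ lu A.trace (j+1) * (A 0 0 - A 1 1) := by
    obtain ⟨m, hm⟩ := hd
    simp only [if_true] at hm
    exact ⟨m, by linear_combination hm⟩
  have d := (hpp.dvd_or_dvd hd2).resolve_left hn
  have : A.trace^2 - 4 = (A 0 0 - A 1 1)^2 + 4 * A 0 1 * A 1 0 := by
    rw [Matrix.det_fin_two] at hA
    rw [Matrix.trace_fin_two]
    linear_combination 4*hA
  apply hpD
  apply Dvd.dvd.mul_left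
  rw [← Int.natCast_dvd, this]
  exact dvd_add (d.pow (by norm_num)) (c.mul_left _)

lemma mm_ne (hA : A.det = 1) (htr : 2 < |A.trace|) (p : ℕ) (hp : p.Prime) (hpD : ¬ p ∣ 16*(A.trace^2-4).natAbs)
    (hp4 : 16*(A.trace^2-4).natAbs < p) : 0 < mm (chi (A.trace^2-4)) p ∧ mm (chi (A.trace^2-4)) p ≤ 2*p := by
  have hΔ : 0 < A.trace^2-4 := by
    have : (2:ℤ)^2 < |A.trace|^2 := by gcongr
    rw [sq_abs] at this; linarith
  have := hp.two_le
  rcases mm_cases (chi_signChar _ hΔ) p hp hp4 with h | h <;> rw [h] <;> omega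

/-- order facts -/
lemma matOrd_facts (hA : A.det = 1) (htr : 2 < |A.trace|) (p : ℕ) (hp : p.Prime) (hpD : ¬ p ∣ 16*(A.trace^2-4).natAbs)
    (hp4 : 16*(A.trace^2-4).natAbs < p) :
    0 < matOrd A p ∧ (∀ i j, (p:ℤ) ∣ (A^(matOrd A p)-1) i j) ∧ matOrd A p ∣ mm (chi (A.trace^2-4)) p := by
  have hf := frob A hA htr p hp hpD
  have hm := (mm_ne A hA htr p hp hpD hp4).1
  have hne : {k | 0 < k ∧ ∀ i j, (p : ℤ) ∣ (A ^ k - 1) i j}.Nonempty :=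
    ⟨_, hm, (Mp_pow_eq_one A p _).1 hf⟩
  have h1 := Nat.sInf_mem hne
  refine ⟨h1.1, h1.2, ?_⟩
  have h2 : (Mp A p)^(matOrd A p) = 1 := (Mp_pow_eq_one A p _).2 h1.2
  have h3 : orderOf (Mp A p) ∣ matOrd A p := orderOf_dvd_of_pow_eq_one h2
  have h4 : orderOf (Mp A p) ∣ mm (chi (A.trace^2-4)) p := orderOf_dvd_of_pow_eq_one hf
  have h5 : 0 < orderOf (Mp A p) := Nat.pos_of_dvd_of_pos h4 hm
  have h6 : matOrd A p ≤ orderOf (Mp A p) :=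
    Nat.sInf_le ⟨h5, (Mp_pow_eq_one A p _).1 (pow_orderOf_eq_one _)⟩
  have h7 := Nat.le_of_dvd h1.1 h3
  rw [le_antisymm h6 h7]; exact h4

lemma good_or_small (hA : A.det = 1) (htr : 2 < |A.trace|) (η : ℝ) (hη : 0 < η) (p Y : ℕ) (hp : p.Prime)
    (hpY : p ≤ Y)
    (hp4 : 16*(A.trace^2-4).natAbs < p) (q : ℕ) (hq : q.Prime) (hqY : (Y:ℝ)^η < q) (hqm : q ∣ mm (chi (A.trace^2-4)) p) :
    GoodPrime A η p ∨ ∃ k ∈ Ioc 0 ⌊2*(Y:ℝ)^(1-η)⌋₊, p ∣ (lu A.trace k).natAbs := by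
  have hpos : 0 < 16*(A.trace^2-4).natAbs := by
    have : (2:ℤ)^2 < |A.trace|^2 := by gcongr
    rw [sq_abs] at this; omega
  have hpD : ¬ p ∣ 16*(A.trace^2-4).natAbs := fun h => by
    have := Nat.le_of_dvd hpos h; omega
  obtain ⟨h1, h2, h3⟩ := matOrd_facts A hA htr p hp hpD hp4
  obtain ⟨h4, h5⟩ := mm_ne A hA htr p hp hpD hp4
  by_cases hqo : q ∣ matOrd A p
  · left
    refine ⟨?_, ?_⟩
    · intro h; apply hpD
      rw [Int.natAbs_mul] at h
      have : 16*(A.trace^2-4).natAbs = 4 * ((4:ℤ).natAbs * (A.trace^2-4).natAbs) := by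
        change _ = 4 * (4 * _); ring
      rw [this]; exact h.mul_left _
    · have e1 : (p:ℝ)^η ≤ (Y:ℝ)^η := Real.rpow_le_rpow (by positivity) (by exact_mod_cast hpY) hη.le
      have e2 : (q:ℝ) ≤ matOrd A p := by exact_mod_cast Nat.le_of_dvd h1 hqo
      linarith
  · right
    have hc : Nat.Coprime q (matOrd A p) := (Nat.Prime.coprime_iff_not_dvd hq).2 hqo
    have hle := Nat.le_of_dvd h4 (hc.mul_dvd_of_dvd_of_dvd hqm h3)
    refine ⟨matOrd A p, ?_, ?_⟩
    · rw [mem_Ioc]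
      refine ⟨h1, Nat.le_floor ?_⟩
      have hY : 0 < (Y:ℝ) := by exact_mod_cast (lt_of_lt_of_le hp.pos hpY)
      have e1 : (q:ℝ) * matOrd A p ≤ 2 * Y := by exact_mod_cast (by omega : q * matOrd A p ≤ 2*Y)
      have e2 : (Y:ℝ)^η * matOrd A p ≤ 2 * Y := le_trans (mul_le_mul_of_nonneg_right hqY.le (by positivity)) e1
      have e3 : (Y:ℝ)^(1-η) * (Y:ℝ)^η = Y := by
        rw [← Real.rpow_add hY]; simp
      have e4 : 0 < (Y:ℝ)^η := Real.rpow_pos_of_pos hY _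
      rw [← mul_le_mul_iff_right₀ e4]
      calc _ ≤ 2*(Y:ℝ) := e2
        _ = _ := by linear_combination (-2)*e3
    · rw [← Int.natCast_dvd]
      exact dvd_lu A hA p hp hpD _ h1 h2
end FI
end Part20

section Part21
open Matrix Finset
namespace FI

variable (A : Matrix (Fin 2) (Fin 2) ℤ)

lemma small_ord_sum (htr : 2 < |A.trace|) (K : ℕ) (S : Finset ℕ)
    (hS : ∀ p ∈ S, p.Prime ∧ ∃ k ∈ Ioc 0 K, p ∣ (lu A.trace k).natAbs) :
    ∑ p ∈ S, Real.log p ≤ (K:ℝ)^2 * Real.log ((|A.trace|+1 : ℤ)) := by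
  classical
  have hbase : (1:ℝ) ≤ ((|A.trace|+1 : ℤ):ℝ) := by exact_mod_cast (by omega : (1:ℤ) ≤ |A.trace|+1)
  have hlog := Real.log_nonneg hbase
  have hlogp : ∀ p : ℕ, 0 ≤ Real.log p := fun p => Real.log_natCast_nonneg p
  calc ∑ p ∈ S, Real.log p ≤ ∑ p ∈ S, ∑ k ∈ Ioc 0 K, if p ∣ (lu A.trace k).natAbs then Real.log p else 0 := by
        apply sum_le_sum
        intro p hp
        obtain ⟨_, k, hk, hd⟩ := hS p hp
        calc Real.log p = if p ∣ (lu A.trace k).natAbs then Real.log p else 0 := by rw [if_pos hd]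
          _ ≤ _ := single_le_sum (f := fun k => if p ∣ (lu A.trace k).natAbs then Real.log p else 0)
            (fun k _ => by split_ifs; exacts [hlogp p, le_rfl]) hk
    _ = ∑ k ∈ Ioc 0 K, ∑ p ∈ S.filter (fun p => p ∣ (lu A.trace k).natAbs), Real.log p := by
        rw [sum_comm]; simp_rw [sum_filter]
    _ ≤ ∑ k ∈ Ioc 0 K, K * Real.log ((|A.trace|+1 : ℤ)) := by
        apply sum_le_sum
        intro k hk
        rw [mem_Ioc] at hk
        have hne := lu_ne A.trace htr k hk.1
        refine (sum_log_primes_dvd _ (Int.natAbs_ne_zero.2 hne) _ ?_).trans ?_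
        · intro q hq; rw [mem_filter] at hq; exact ⟨(hS q hq.1).1, hq.2⟩
        obtain ⟨j, rfl⟩ : ∃ j, k = j+1 := ⟨k-1, by omega⟩
        have h1 := lu_le A.trace htr j
        have h2 : (((lu A.trace (j+1)).natAbs : ℕ) : ℝ) ≤ (((|A.trace|+1 : ℤ)):ℝ)^j := by
          rw [Nat.cast_natAbs]
          exact_mod_cast h1
        have h3 : (0:ℝ) < ((lu A.trace (j+1)).natAbs : ℕ) := by
          exact_mod_cast Int.natAbs_pos.2 hne
        refine (Real.log_le_log h3 h2).trans ?_
        rw [Real.log_pow]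
        apply mul_le_mul_of_nonneg_right _ hlog
        exact_mod_cast (by omega : j ≤ K)
    _ = _ := by rw [sum_const, Nat.card_Ioc, nsmul_eq_mul, Nat.sub_zero]; ring

open Classical in
/-- log-weighted sum over good primes -/
noncomputable def SG (η : ℝ) (y Y : ℕ) : ℝ :=
  ∑ p ∈ (Ioc y Y).filter (fun p => p.Prime ∧ GoodPrime A η p), Real.log p / p

lemma SE_le (hA : A.det = 1) (htr : 2 < |A.trace|) (η : ℝ) (hη : 0 < η) (y Y : ℕ)
    (hy : 16*(A.trace^2-4).natAbs ≤ y) (hy0 : 0 < y) :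
    SE (chi (A.trace^2-4)) η y Y ≤ SG A η y Y + (2*(Y:ℝ)^(1-η))^2 * Real.log ((|A.trace|+1 : ℤ)) / y := by
  classical
  obtain ⟨K, hK⟩ : ∃ K, K = ⌊2*(Y:ℝ)^(1-η)⌋₊ := ⟨_, rfl⟩
  obtain ⟨B, hB⟩ : ∃ B, B = (Ioc y Y).filter (fun p => p.Prime ∧ ∃ k ∈ Ioc 0 K, p ∣ (lu A.trace k).natAbs) := ⟨_, rfl⟩
  have hlogp : ∀ p : ℕ, 0 ≤ Real.log p / p := fun p => div_nonneg (Real.log_natCast_nonneg p) (by positivity)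
  have hy' : (0:ℝ) < y := by exact_mod_cast hy0
  have h1 : SE (chi (A.trace^2-4)) η y Y ≤ SG A η y Y + ∑ p ∈ B, Real.log p / p := by
    unfold SE SG
    refine le_trans (sum_le_sum_of_subset_of_nonneg (t := (Ioc y Y).filter (fun p => p.Prime ∧ GoodPrime A η p) ∪ B) ?_ (fun p _ _ => hlogp p)) ?_
    · intro p hp
      rw [mem_filter, mem_Ioc] at hp
      obtain ⟨⟨hyp, hpY⟩, hpp, q, hq, hqY, hqm⟩ := hp
      rw [mem_union, hB, mem_filter, mem_filter, mem_Ioc]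
      rcases good_or_small A hA htr η hη p Y hpp hpY (by omega) q hq hqY hqm with h | h
      · left; exact ⟨⟨hyp, hpY⟩, hpp, h⟩
      · right; rw [hK]; exact ⟨⟨hyp, hpY⟩, hpp, h⟩
    · rw [← sum_union_inter]
      have : 0 ≤ ∑ p ∈ (Ioc y Y).filter (fun p => p.Prime ∧ GoodPrime A η p) ∩ B, Real.log p / p := sum_nonneg fun p _ => hlogp p
      linarith
  have h2 : ∑ p ∈ B, Real.log p / p ≤ (∑ p ∈ B, Real.log p) / y := by
    rw [sum_div]
    apply sum_le_sum
    intro p hp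
    rw [hB, mem_filter, mem_Ioc] at hp
    apply div_le_div_of_nonneg_left (Real.log_natCast_nonneg p) hy'
    exact_mod_cast hp.1.1.le
  have h3 := small_ord_sum A htr K B (fun p hp => by rw [hB, mem_filter] at hp; exact hp.2)
  have h4 : (K:ℝ) ≤ 2*(Y:ℝ)^(1-η) := by rw [hK]; exact Nat.floor_le (by positivity)
  have hbase : (1:ℝ) ≤ ((|A.trace|+1 : ℤ):ℝ) := by exact_mod_cast (by omega : (1:ℤ) ≤ |A.trace|+1)
  have h5 : (K:ℝ)^2 * Real.log ((|A.trace|+1 : ℤ)) ≤ (2*(Y:ℝ)^(1-η))^2 * Real.log ((|A.trace|+1 : ℤ)) :=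
    mul_le_mul_of_nonneg_right (pow_le_pow_left₀ (by positivity) h4 2) (Real.log_nonneg hbase)
  have h6 := div_le_div_of_nonneg_right (h3.trans h5) hy'.le
  linarith

theorem good_sum (hA : A.det = 1) (htr : 2 < |A.trace|) (η δ : ℝ) (hη : 1/2 < η) (hη1 : η < 3/5)
    (hδ0 : 0 < δ) (hδ : δ < (3-5*η)/(2*(1-η))) :
    ∃ ε0 : ℝ, 0 < ε0 ∧ ∀ ε : ℝ, 0 < ε → ε < ε0 → ∀ᶠ y : ℕ in Filter.atTop, ∀ Y : ℕ, Win ε y Y →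
      δ * ε * Real.log y - 1 ≤ SG A η y Y := by
  have hΔ : 0 < A.trace^2-4 := by
    have : (2:ℤ)^2 < |A.trace|^2 := by gcongr
    rw [sq_abs] at this; linarith
  obtain ⟨ε0, hε0, hg⟩ := goldfeld (chi_signChar _ hΔ) η δ hη hη1 hδ0 hδ
  refine ⟨min ε0 ((2*η-1)/2), lt_min hε0 (by linarith), ?_⟩
  intro ε hε hlt
  have hl1 := lt_of_lt_of_le hlt (min_le_left _ _)
  have hl2 := lt_of_lt_of_le hlt (min_le_right _ _)
  obtain ⟨c, hc⟩ : ∃ c, c = Real.log ((|A.trace|+1 : ℤ)) := ⟨_, rfl⟩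
  have hc0 : 0 < c := by
    rw [hc]; apply Real.log_pos; exact_mod_cast (by omega : (1:ℤ) < |A.trace|+1)
  have hlogt : Filter.Tendsto (fun y : ℕ => Real.log y) Filter.atTop Filter.atTop :=
    Real.tendsto_log_atTop.comp tendsto_natCast_atTop_atTop
  filter_upwards [hg ε hε hl1, Filter.eventually_ge_atTop (16*(A.trace^2-4).natAbs), Filter.eventually_gt_atTop 0,
    hlogt.eventually_ge_atTop ((Real.log (4*c) + 1) * (2/(2*η-1))), hlogt.eventually_ge_atTop 0] with y h1 h2 h3 h4 hL0 Y hW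
  have h5 := h1 Y hW
  have h6 := SE_le A hA htr η (by linarith) y Y h2 h3
  suffices (2*(Y:ℝ)^(1-η))^2 * Real.log ((|A.trace|+1 : ℤ)) / y ≤ 1 by linarith
  have hy' : (0:ℝ) < y := by exact_mod_cast h3
  have hY' : (0:ℝ) < Y := by exact_mod_cast (lt_of_lt_of_le h3 hW.1)
  rw [div_le_one hy', ← hc]
  have e : (2*(Y:ℝ)^(1-η))^2 * c = (4*c) * Y^(2*(1-η)) := by
    rw [mul_pow, ← Real.rpow_natCast ((Y:ℝ)^(1-η)), ← Real.rpow_mul hY'.le]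
    push_cast
    rw [mul_comm (1-η) 2]; ring
  rw [e]
  have hpw : 0 < (Y:ℝ)^(2*(1-η)) := Real.rpow_pos_of_pos hY' _
  rw [← Real.log_le_log_iff (by positivity) hy', Real.log_mul (by positivity) hpw.ne', Real.log_rpow hY']
  have hW2 := (abs_le.1 hW.2).2
  obtain ⟨L, hL⟩ : ∃ L, L = Real.log y := ⟨_, rfl⟩
  rw [← hL] at h4 hL0 hW2 ⊢
  have h7 : Real.log (4*c) + 1 ≤ L * ((2*η-1)/2) := by
    have : 0 < 2*η-1 := by linarith
    rw [mul_div_assoc', div_le_iff₀ this] at h4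
    linarith
  have h8 : 2*(1-η)*Real.log Y ≤ 2*(1-η)*((1+ε)*L+1) := mul_le_mul_of_nonneg_left (by linarith) (by linarith)
  have h9 : 2*(1-η)*((1+ε)*L+1) ≤ 2*(1-η)*L + ε*L + 1 := by
    have : 2*(1-η)*(ε*L+1) ≤ 1*(ε*L+1) := mul_le_mul_of_nonneg_right (by linarith) (by positivity)
    linarith
  have h10 : ε*L ≤ (2*η-1)/2*L := mul_le_mul_of_nonneg_right hl2.le hL0
  linarith
end FI
end Part21

section Part22
open Matrix Finset
namespace FI

/-- chunk endpoints -/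
noncomputable def yy (ε : ℝ) (j : ℕ) : ℕ := ⌊Real.exp ((1+ε)^j)⌋₊

lemma yy_log (ε : ℝ) (hε : 0 < ε) (j : ℕ) :
    1 ≤ yy ε j ∧ Real.log (yy ε j) ≤ (1+ε)^j ∧ (1+ε)^j - Real.log 2 ≤ Real.log (yy ε j) := by
  have h1 : 1 ≤ (1+ε)^j := one_le_pow₀ (by linarith)
  have h2 : 2 ≤ Real.exp ((1+ε)^j) := by
    have := Real.add_one_le_exp ((1+ε)^j); linarith
  have h3 : 1 ≤ yy ε j := Nat.le_floor (by push_cast; linarith)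
  have h4 : (0:ℝ) < yy ε j := by exact_mod_cast h3
  refine ⟨h3, ?_, ?_⟩
  · rw [Real.log_le_iff_le_exp h4]
    exact Nat.floor_le (by positivity)
  · rw [Real.le_log_iff_exp_le h4, Real.exp_sub, Real.exp_log (by norm_num)]
    have := Nat.lt_floor_add_one (Real.exp ((1+ε)^j))
    change _ < (yy ε j : ℝ) + 1 at this
    linarith

lemma yy_lt (ε : ℝ) (j p : ℕ) (h : yy ε j < p) : Real.exp ((1+ε)^j) < p := by
  unfold yy at h
  exact (Nat.floor_lt (by positivity)).1 h

lemma yy_mono (ε : ℝ) (hε : 0 < ε) : Monotone (yy ε) := by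
  intro i j hij
  apply Nat.floor_le_floor
  apply Real.exp_le_exp.2
  exact pow_le_pow_right₀ (by linarith) hij

lemma yy_win (ε : ℝ) (hε : 0 < ε) (hε1 : ε ≤ 2/5) (j : ℕ) : Win ε (yy ε j) (yy ε (j+1)) := by
  refine ⟨yy_mono ε hε (Nat.le_succ j), ?_⟩
  obtain ⟨_, h1, h2⟩ := yy_log ε hε j
  obtain ⟨_, h3, h4⟩ := yy_log ε hε (j+1)
  rw [pow_succ] at h3 h4
  have := Real.log_two_lt_d9
  have h0 := Real.log_two_gt_d9
  rw [abs_le]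
  constructor
  · have := mul_le_mul_of_nonneg_left h1 (by linarith : 0 ≤ 1+ε)
    linarith
  · have := mul_le_mul_of_nonneg_left h2 (by linarith : 0 ≤ 1+ε)
    have h5 : (1+ε)*Real.log 2 ≤ (7/5)*Real.log 2 := mul_le_mul_of_nonneg_right (by linarith) (by linarith)
    linarith

lemma yy_tendsto (ε : ℝ) (hε : 0 < ε) : Filter.Tendsto (yy ε) Filter.atTop Filter.atTop := by
  unfold yy
  exact tendsto_nat_floor_atTop.comp (Real.tendsto_exp_atTop.comp (tendsto_pow_atTop_atTop_of_one_lt (by linarith)))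

open Classical in
lemma sumS (G : ℕ → Prop) (δ ε : ℝ) (hδ0 : 0 < δ) (hδ1 : δ < 1) (hε : 0 < ε) (hε1 : ε ≤ 2/5)
    (hG : ∀ᶠ y : ℕ in Filter.atTop, ∀ Y : ℕ, Win ε y Y →
      δ * ε * Real.log y - 1 ≤ ∑ p ∈ (Ioc y Y).filter (fun p => p.Prime ∧ G p), Real.log p / p) :
    ∃ K : ℝ, ∀ n j0 : ℕ, ∀ Z : ℝ, Z ≤ Real.exp ((1+ε)^j0) →
      ∑ p ∈ (Ioc 0 (yy ε n)).filter (fun p => p.Prime ∧ (G p → (p:ℝ) ≤ Z)), 1/(p:ℝ) ≤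
        K + ε*(1-δ)*n + ε*δ*j0 := by
  obtain ⟨C, hC, hM⟩ := mertens_primes
  obtain ⟨J, hJ⟩ := Filter.eventually_atTop.1 ((yy_tendsto ε hε).eventually hG)
  obtain ⟨r, hr⟩ : ∃ r, r = 1+ε := ⟨_, rfl⟩
  obtain ⟨K0, hK0⟩ : ∃ K0 : ℝ, K0 = ∑ p ∈ Ioc 0 (yy ε J), 1/(p:ℝ) := ⟨_, rfl⟩
  obtain ⟨C', hC'⟩ : ∃ C', C' = C + 4 := ⟨_, rfl⟩
  have hr1 : 1 < r := by linarith
  have hq0 : 0 ≤ r⁻¹ := by positivity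
  have hq1 : r⁻¹ < 1 := inv_lt_one_of_one_lt₀ hr1
  refine ⟨K0 + C' * (1-r⁻¹)⁻¹, ?_⟩
  intro n j0 Z hZ
  have key : ∀ n, J ≤ n → ∑ p ∈ (Ioc 0 (yy ε n)).filter (fun p => p.Prime ∧ (G p → (p:ℝ) ≤ Z)), 1/(p:ℝ) ≤
      K0 + C' * ∑ i ∈ range n, r⁻¹^i + ε*(1-δ)*n + ε*δ*(min n j0 : ℕ) := by
    intro n hn
    induction n, hn using Nat.le_induction with
    | base =>
      have h1 : ∑ p ∈ (Ioc 0 (yy ε J)).filter (fun p => p.Prime ∧ (G p → (p:ℝ) ≤ Z)), 1/(p:ℝ) ≤ K0 := by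
        rw [hK0]
        exact sum_le_sum_of_subset_of_nonneg (filter_subset _ _) (fun p _ _ => by positivity)
      have h2 : 0 ≤ C' * ∑ i ∈ range J, r⁻¹^i := by
        apply mul_nonneg (by linarith); exact sum_nonneg fun i _ => by positivity
      have h3 : 0 ≤ ε*(1-δ)*J := mul_nonneg (mul_nonneg hε.le (by linarith)) (by positivity)
      have h4 : 0 ≤ ε*δ*(min J j0 : ℕ) := by positivity
      linarith
    | succ n hn ih =>
      have hrn : 0 < r^n := by positivity
      obtain ⟨hy1, hy2, hy3⟩ := yy_log ε hε n
      obtain ⟨hY1, hY2, hY3⟩ := yy_log ε hε (n+1)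
      have hwin := yy_win ε hε hε1 n
      have hgood := hJ n hn _ hwin
      have hmert := (abs_le.1 (hM (yy ε n) (yy ε (n+1)) hy1 hwin.1)).2
      rw [← hr] at hy2 hy3 hY2 hY3
      rw [pow_succ] at hY2 hY3
      obtain ⟨y, hy⟩ : ∃ y, y = yy ε n := ⟨_, rfl⟩
      obtain ⟨Y, hY⟩ : ∃ Y, Y = yy ε (n+1) := ⟨_, rfl⟩
      have hlt : ∀ p ∈ Ioc y Y, r^n ≤ Real.log p ∧ Real.exp (r^n) < p := by
        intro p hp
        rw [mem_Ioc] at hp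
        have := yy_lt ε n p (by rw [← hy]; exact hp.1)
        rw [← hr] at this
        have hp0 : (0:ℝ) < p := lt_trans (Real.exp_pos _) this
        exact ⟨(Real.le_log_iff_exp_le hp0).2 this.le, this⟩
      rw [← hy] at ih hy1 hy2 hy3 hwin hgood hmert
      rw [← hY] at hY1 hY2 hY3 hwin hgood hmert ⊢
      have hlog2 := Real.log_two_lt_d9
      have hsplit : ∑ p ∈ (Ioc 0 Y).filter (fun p => p.Prime ∧ (G p → (p:ℝ) ≤ Z)), 1/(p:ℝ) =
          ∑ p ∈ (Ioc 0 y).filter (fun p => p.Prime ∧ (G p → (p:ℝ) ≤ Z)), 1/(p:ℝ) +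
          ∑ p ∈ (Ioc y Y).filter (fun p => p.Prime ∧ (G p → (p:ℝ) ≤ Z)), 1/(p:ℝ) := by
        rw [← Ioc_union_Ioc_eq_Ioc (Nat.zero_le y) hwin.1, filter_union, sum_union]
        apply disjoint_filter_filter
        rw [Finset.disjoint_left]
        intro p h1 h2
        rw [mem_Ioc] at h1 h2; omega
      have hw : ∀ T : Finset ℕ, T ⊆ Ioc y Y → ∑ p ∈ T, 1/(p:ℝ) ≤ (∑ p ∈ T, Real.log p/p) / r^n := by
        intro T hT
        rw [sum_div]
        apply sum_le_sum
        intro p hp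
        have h1 := (hlt p (hT hp)).1
        rw [div_div, mul_comm (p:ℝ), ← div_div]
        apply div_le_div_of_nonneg_right _ (by positivity)
        rw [le_div_iff₀ hrn]; linarith
      have hall : ∑ p ∈ (Ioc y Y).filter Nat.Prime, Real.log p / p ≤ ε * r^n + C + 1 := by
        have : r^n * r = r^n + ε*r^n := by rw [hr]; ring
        linarith
      have hpos : ∀ p : ℕ, 0 ≤ Real.log p/p := fun p => div_nonneg (Real.log_natCast_nonneg p) (by positivity)
      have hcast : ((n+1:ℕ):ℝ) = n+1 := by push_cast; ring
      have hgeom : ∑ i ∈ range (n+1), r⁻¹^i = ∑ i ∈ range n, r⁻¹^i + (r^n)⁻¹ := by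
        rw [sum_range_succ, inv_pow]
      have hdivs : ∀ a b : ℝ, b ≤ C' → (a*r^n + b)/r^n ≤ a + C'*(r^n)⁻¹ := by
        intro a b hb
        rw [add_div, mul_div_assoc, div_self hrn.ne', mul_one, div_eq_mul_inv]
        have := mul_le_mul_of_nonneg_right hb (inv_nonneg.2 hrn.le)
        linarith
      rw [hsplit, hgeom, hcast]
      rcases lt_or_ge n j0 with hnj | hnj
      · have h1 : ∑ p ∈ (Ioc y Y).filter (fun p => p.Prime ∧ (G p → (p:ℝ) ≤ Z)), 1/(p:ℝ) ≤ ε + C' * (r^n)⁻¹ := by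
          refine (hw _ (filter_subset _ _)).trans (le_trans (div_le_div_of_nonneg_right ?_ hrn.le) (hdivs ε (C+1) (by linarith)))
          refine le_trans (sum_le_sum_of_subset_of_nonneg ?_ (fun p _ _ => hpos p)) (hall.trans (by linarith))
          intro p hp; rw [mem_filter] at hp ⊢; exact ⟨hp.1, hp.2.1⟩
        have h2 : ((min (n+1) j0 : ℕ):ℝ) = (min n j0 : ℕ) + 1 := by
          rw [min_eq_left hnj.le, min_eq_left (by omega)]; push_cast; ring
        rw [h2]
        linarith
      · have h1 : ∑ p ∈ (Ioc y Y).filter (fun p => p.Prime ∧ (G p → (p:ℝ) ≤ Z)), 1/(p:ℝ) ≤ ε*(1-δ) + C' * (r^n)⁻¹ := by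
          refine (hw _ (filter_subset _ _)).trans (le_trans (div_le_div_of_nonneg_right ?_ hrn.le) (hdivs (ε*(1-δ)) C' le_rfl))
          have hle : ∑ p ∈ (Ioc y Y).filter (fun p => p.Prime ∧ (G p → (p:ℝ) ≤ Z)), Real.log p/p +
              ∑ p ∈ (Ioc y Y).filter (fun p => p.Prime ∧ G p), Real.log p / p ≤ ∑ p ∈ (Ioc y Y).filter Nat.Prime, Real.log p / p := by
            rw [← sum_union]
            · refine sum_le_sum_of_subset_of_nonneg ?_ (fun p _ _ => hpos p)
              intro p hp; rw [mem_union, mem_filter, mem_filter] at hp; rw [mem_filter]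
              rcases hp with hp | hp <;> exact ⟨hp.1, hp.2.1⟩
            · rw [Finset.disjoint_left]
              intro p h1 h2
              rw [mem_filter] at h1 h2
              have h3 := h1.2.2 h2.2.2
              have h4 := (hlt p h1.1).2
              have h5 : Real.exp (r^j0) ≤ Real.exp (r^n) := Real.exp_le_exp.2 (pow_le_pow_right₀ hr1.le hnj)
              rw [← hr] at hZ
              linarith
          have h6 : δ*ε*(r^n - Real.log 2) ≤ δ*ε*Real.log y := mul_le_mul_of_nonneg_left hy3 (by positivity)
          have h7 : δ*ε*Real.log 2 ≤ 1 := by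
            have h71 : δ*ε ≤ 1*1 := mul_le_mul hδ1.le (by linarith) hε.le (by norm_num)
            have h72 : 0 ≤ Real.log 2 := by have := Real.log_two_gt_d9; linarith
            have := mul_le_mul_of_nonneg_right h71 h72
            linarith
          linarith
        have h2 : ((min (n+1) j0 : ℕ):ℝ) = (min n j0 : ℕ) := by
          rw [min_eq_right hnj, min_eq_right (by omega)]
        rw [h2]
        linarith
  have hgs : ∀ n, ∑ i ∈ range n, r⁻¹^i ≤ (1-r⁻¹)⁻¹ := by
    intro n
    rw [← tsum_geometric_of_lt_one hq0 hq1]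
    exact (summable_geometric_of_lt_one hq0 hq1).sum_le_tsum _ (fun i _ => by positivity)
  have hC'0 : 0 ≤ C' := by linarith
  have hed : 0 ≤ ε*(1-δ) := mul_nonneg hε.le (by linarith)
  rcases le_total J n with h | h
  · have h1 := key n h
    have h2 := mul_le_mul_of_nonneg_left (hgs n) hC'0
    have h3 : ε*δ*(min n j0 : ℕ) ≤ ε*δ*j0 := by
      apply mul_le_mul_of_nonneg_left _ (by positivity)
      exact_mod_cast min_le_right _ _
    linarith
  · have h1 : ∑ p ∈ (Ioc 0 (yy ε n)).filter (fun p => p.Prime ∧ (G p → (p:ℝ) ≤ Z)), 1/(p:ℝ) ≤ K0 := by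
      rw [hK0]
      refine sum_le_sum_of_subset_of_nonneg ?_ (fun p _ _ => by positivity)
      refine (filter_subset _ _).trans ?_
      exact Ioc_subset_Ioc_right (yy_mono ε hε h)
    have h2 : 0 ≤ C' * (1-r⁻¹)⁻¹ := mul_nonneg hC'0 (inv_nonneg.2 (by linarith))
    have h3 : 0 ≤ ε*(1-δ)*n := mul_nonneg hed (by positivity)
    have h4 : 0 ≤ ε*δ*j0 := by positivity
    linarith
end FI
end Part22

section Part23
open Matrix Finset
open scoped ArithmeticFunction.vonMangoldt
namespace FI

lemma goodPart_mono (A : Matrix (Fin 2) (Fin 2) ℤ) (η : ℝ) (m n : ℕ) (hn : n ≠ 0) (h : m ∣ n) :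
    goodPart A η m ≤ goodPart A η n := by
  classical
  unfold goodPart
  have hm : m ≠ 0 := ne_zero_of_dvd_ne_zero hn h
  calc ∏ p ∈ m.primeFactors.filter (GoodPrime A η), p ^ (m.factorization p)
      ≤ ∏ p ∈ m.primeFactors.filter (GoodPrime A η), p ^ (n.factorization p) := by
        apply prod_le_prod' 
        intro p hp
        rw [mem_filter, Nat.mem_primeFactors] at hp
        exact Nat.pow_le_pow_right hp.1.1.pos ((Nat.factorization_le_iff_dvd hm hn).2 h p)
    _ ≤ _ := by
        apply prod_le_prod_of_subset_of_one_le'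
        · exact filter_subset_filter _ (Nat.primeFactors_mono h hn)
        · intro p hp _
          rw [mem_filter, Nat.mem_primeFactors] at hp
          exact Nat.one_le_pow _ _ hp.1.1.pos

lemma good_le_goodPart (A : Matrix (Fin 2) (Fin 2) ℤ) (η : ℝ) (p n : ℕ) (hn : n ≠ 0) (hp : p ∈ n.primeFactors)
    (hg : GoodPrime A η p) : p ≤ goodPart A η n := by
  classical
  unfold goodPart
  have hpp := Nat.prime_of_mem_primeFactors hp
  have h1 : p ≤ p ^ (n.factorization p) := by
    apply Nat.le_self_pow
    exact (Nat.Prime.factorization_pos_of_dvd hpp hn (Nat.dvd_of_mem_primeFactors hp)).ne'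
  refine h1.trans ?_
  apply single_le_prod' (f := fun p => p ^ (n.factorization p)) _ (mem_filter.2 ⟨hp, hg⟩)
  intro q hq
  rw [mem_filter, Nat.mem_primeFactors] at hq
  exact Nat.one_le_pow _ _ hq.1.1.pos

/-- divisor-closed sets -/
lemma card_log_le (X : ℕ) (H : Finset ℕ) (hH : H ⊆ Ioc 0 X) (hdc : ∀ n ∈ H, ∀ m, m ∣ n → m ∈ H) :
    (H.card : ℝ) * Real.log X ≤ 7 * X * ∑ m ∈ H, (1:ℝ)/m := by
  classical
  rcases Finset.eq_empty_or_nonempty H with h0 | ⟨n0, hn0⟩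
  · simp [h0]
  have h1H : 1 ∈ H := hdc n0 hn0 1 (one_dvd _)
  have hs1 : (1:ℝ) ≤ ∑ m ∈ H, (1:ℝ)/m := by
    have := single_le_sum (f := fun m : ℕ => (1:ℝ)/m) (fun i _ => by positivity) h1H
    simpa using this
  have hA : ∑ n ∈ H, Real.log n ≤ 6 * X * ∑ m ∈ H, (1:ℝ)/m := by
    have e1 : ∀ n ∈ H, Real.log n ≤ ∑ m ∈ H, ∑ d ∈ Ioc 0 (X/m), if d * m = n then Λ d else 0 := by
      intro n hn
      have hnX := mem_Ioc.1 (hH hn)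
      rw [← ArithmeticFunction.vonMangoldt_sum (n := n), ← Nat.sum_div_divisors]
      have : n.divisors ⊆ H := by
        intro m hm; exact hdc n hn m (Nat.dvd_of_mem_divisors hm)
      refine le_trans ?_ (sum_le_sum_of_subset_of_nonneg this (fun i _ _ => sum_nonneg fun d _ => by
        split_ifs; exacts [ArithmeticFunction.vonMangoldt_nonneg, le_rfl]))
      apply sum_le_sum
      intro m hm
      have hmn := Nat.dvd_of_mem_divisors hm
      have hm0 : 0 < m := Nat.pos_of_dvd_of_pos hmn hnX.1
      have hmem : n/m ∈ Ioc 0 (X/m) := mem_Ioc.2 ⟨Nat.div_pos (Nat.le_of_dvd hnX.1 hmn) hm0, Nat.div_le_div_right hnX.2⟩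
      calc Λ (n/m) = if (n/m) * m = n then Λ (n/m) else 0 := by rw [if_pos (Nat.div_mul_cancel hmn)]
        _ ≤ _ := single_le_sum (f := fun d => if d * m = n then Λ d else 0) (fun d _ => by
            split_ifs; exacts [ArithmeticFunction.vonMangoldt_nonneg, le_rfl]) hmem
    calc ∑ n ∈ H, Real.log n ≤ ∑ n ∈ H, ∑ m ∈ H, ∑ d ∈ Ioc 0 (X/m), (if d * m = n then Λ d else 0) := sum_le_sum e1
      _ = ∑ m ∈ H, ∑ d ∈ Ioc 0 (X/m), ∑ n ∈ H, (if d * m = n then Λ d else 0) := by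
          rw [sum_comm]; apply sum_congr rfl; intro m _; rw [sum_comm]
      _ ≤ ∑ m ∈ H, ∑ d ∈ Ioc 0 (X/m), Λ d := by
          apply sum_le_sum; intro m _; apply sum_le_sum; intro d _
          rw [sum_ite_eq]
          split_ifs
          exacts [le_rfl, ArithmeticFunction.vonMangoldt_nonneg]
      _ ≤ ∑ m ∈ H, 6 * ((X:ℝ) * (1/m)) := by
          apply sum_le_sum; intro m _
          refine (psi_nat_le _).trans ?_
          apply mul_le_mul_of_nonneg_left _ (by norm_num)
          rw [mul_one_div]
          exact Nat.cast_div_le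
      _ = _ := by rw [mul_sum]; apply sum_congr rfl; intro m _; ring
  have hB : ∑ n ∈ H, (Real.log X - Real.log n) ≤ X := by
    calc ∑ n ∈ H, (Real.log X - Real.log n) ≤ ∑ n ∈ Ioc 0 X, (Real.log X - Real.log n) := by
          apply sum_le_sum_of_subset_of_nonneg hH
          intro n hn _
          rw [mem_Ioc] at hn
          rw [sub_nonneg]
          exact Real.log_le_log (by exact_mod_cast hn.1) (by exact_mod_cast hn.2)
      _ = X * Real.log X - ∑ n ∈ Ioc 0 X, Real.log n := by rw [sum_sub_distrib, sum_const, Nat.card_Ioc]; simp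
      _ ≤ X := by have := le_sum_log X; linarith
  rw [sum_sub_distrib, sum_const, nsmul_eq_mul] at hB
  have : (X:ℝ) * 1 ≤ X * ∑ m ∈ H, (1:ℝ)/m := mul_le_mul_of_nonneg_left hs1 (by positivity)
  linarith

lemma sum_tele (X : ℕ) : ∑ n ∈ Ioc 1 X, (1:ℝ)/(n*(n-1)) ≤ 1 := by
  have : ∀ X : ℕ, ∑ n ∈ Ioc 1 (X+1), (1:ℝ)/(n*(n-1)) = 1 - 1/((X:ℝ)+1) := by
    intro X
    induction X with
    | zero => simp
    | succ X ih =>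
      rw [sum_Ioc_succ_top (by omega), ih]
      push_cast
      have h1 : (X:ℝ)+1 ≠ 0 := by positivity
      have h2 : (X:ℝ)+1+1 ≠ 0 := by positivity
      have h3 : (X:ℝ)+1+1-1 ≠ 0 := by rw [add_sub_cancel_right]; exact h1
      field_simp
      ring
  rcases X with _ | X
  · simp
  · rw [this]
    have : 0 ≤ 1/((X:ℝ)+1) := by positivity
    linarith

lemma prod_le_exp (X : ℕ) (S : Finset ℕ) (hS : ∀ p ∈ S, p.Prime ∧ p ≤ X) :
    ∏ p ∈ S, (1 - 1/(p:ℝ))⁻¹ ≤ Real.exp (1 + ∑ p ∈ S, 1/(p:ℝ)) := by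
  have h1 : ∏ p ∈ S, (1 - 1/(p:ℝ))⁻¹ ≤ ∏ p ∈ S, Real.exp (1/((p:ℝ)*(p-1)) + 1/p) := by
    apply prod_le_prod
    · intro p hp
      have : (2:ℝ) ≤ p := by exact_mod_cast (hS p hp).1.two_le
      rw [inv_nonneg, sub_nonneg, div_le_one (by linarith)]; linarith
    · intro p hp
      have : (2:ℝ) ≤ p := by exact_mod_cast (hS p hp).1.two_le
      have h0 : (p:ℝ) ≠ 0 := by linarith
      have h1 : (p:ℝ) - 1 ≠ 0 := by linarith
      have e : (1 - 1/(p:ℝ))⁻¹ = (1/((p:ℝ)*(p-1)) + 1/p) + 1 := by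
        have : 1 - 1/(p:ℝ) = (p-1)/p := by field_simp
        rw [this, inv_div]
        field_simp
        ring
      rw [e]
      exact Real.add_one_le_exp _
  refine h1.trans ?_
  rw [← Real.exp_sum, Real.exp_le_exp, sum_add_distrib]
  have : ∑ p ∈ S, 1/((p:ℝ)*(p-1)) ≤ ∑ p ∈ Ioc 1 X, (1:ℝ)/(p*(p-1)) := by
    apply sum_le_sum_of_subset_of_nonneg
    · intro p hp
      rw [mem_Ioc]; exact ⟨(hS p hp).1.one_lt, (hS p hp).2⟩
    · intro p hp _
      rw [mem_Ioc] at hp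
      have : (1:ℝ) < p := by exact_mod_cast hp.1
      have : 0 < (p:ℝ) - 1 := by linarith
      positivity
  have := sum_tele X
  linarith

open Classical in
lemma count_le (A : Matrix (Fin 2) (Fin 2) ℤ) (η Z : ℝ) (X : ℕ) :
    (((Ioc 0 X).filter (fun n => (goodPart A η n : ℝ) ≤ Z)).card : ℝ) * Real.log X ≤
      7 * X * Real.exp (1 + ∑ p ∈ (Ioc 0 X).filter (fun p => p.Prime ∧ (GoodPrime A η p → (p:ℝ) ≤ Z)), 1/(p:ℝ)) := by
  refine (card_log_le X _ (filter_subset _ _) ?_).trans ?_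
  · intro n hn m hmn
    rw [mem_filter, mem_Ioc] at hn ⊢
    have hn0 : n ≠ 0 := by omega
    refine ⟨⟨Nat.pos_of_dvd_of_pos hmn hn.1.1, (Nat.le_of_dvd hn.1.1 hmn).trans hn.1.2⟩, ?_⟩
    refine le_trans ?_ hn.2
    exact_mod_cast goodPart_mono A η m n hn0 hmn
  · apply mul_le_mul_of_nonneg_left _ (by positivity)
    refine (sum_inv_le_prod ((Ioc 0 X).filter (fun p => p.Prime ∧ (GoodPrime A η p → (p:ℝ) ≤ Z))) _ ?_ ?_).trans (prod_le_exp X _ ?_)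
    · intro p hp; rw [mem_filter] at hp; exact hp.2.1
    · intro m hm
      rw [mem_filter, mem_Ioc] at hm
      have hm0 : m ≠ 0 := by omega
      refine ⟨hm0, ?_⟩
      intro p hp
      rw [mem_filter, mem_Ioc]
      have hpp := Nat.prime_of_mem_primeFactors hp
      refine ⟨⟨hpp.pos, (Nat.le_of_dvd hm.1.1 (Nat.dvd_of_mem_primeFactors hp)).trans hm.1.2⟩, hpp, ?_⟩
      intro hg
      refine le_trans ?_ hm.2
      exact_mod_cast good_le_goodPart A η p m hm0 hp hg
    · intro p hp; rw [mem_filter, mem_Ioc] at hp; exact ⟨hp.2.1, hp.1.2⟩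
end FI
end Part23

section Part24
open Matrix Finset
namespace FI

lemma ceil_pow (r ℓ : ℝ) (hr : 1 < r) : Real.exp ℓ ≤ r^(⌈ℓ/Real.log r⌉₊) := by
  have hl : 0 < Real.log r := Real.log_pos hr
  have h1 := Nat.le_ceil (ℓ/Real.log r)
  rw [div_le_iff₀ hl] at h1
  calc Real.exp ℓ ≤ Real.exp (⌈ℓ/Real.log r⌉₊ * Real.log r) := Real.exp_le_exp.2 h1
    _ = _ := by rw [Real.exp_nat_mul, Real.exp_log (by linarith)]

theorem main_bound (A : Matrix (Fin 2) (Fin 2) ℤ) (hA : A.det = 1) (htr : 2 < |A.trace|)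
    (η : ℝ) (hη₁ : 1 / 2 < η) (hη₂ : η < 3 / 5) (γ : ℝ) (hγ : γ = (3 - 5 * η) / (2 * (1 - η))) :
    ∃ C : ℝ, 0 < C ∧ ∃ x₀ : ℝ, ∀ x : ℝ, x₀ ≤ x →
      ({N : ℕ | 1 ≤ N ∧ (N : ℝ) ≤ x ∧ (goodPart A η N : ℝ) ≤ Real.exp (Real.log x ^ (γ / 2))}.ncard : ℝ) ≤
        C * x / Real.log x ^ (γ / 2) := by
  classical
  have h1η : 0 < 2 * (1-η) := by linarith
  have hγ0 : 0 < γ := by rw [hγ]; apply div_pos <;> linarith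
  have hγ1 : γ < 1 := by rw [hγ, div_lt_one h1η]; linarith
  obtain ⟨δ, hδ0, hδγ, hδ2⟩ : ∃ δ, 0 < δ ∧ δ < γ ∧ γ < δ*(2-γ) := by
    have h2 : γ / (2-γ) < γ := by
      rw [div_lt_iff₀ (by linarith)]
      have : γ * 1 < γ * (2-γ) := mul_lt_mul_of_pos_left (by linarith) hγ0
      linarith
    obtain ⟨δ, h3, h4⟩ := exists_between h2
    refine ⟨δ, lt_trans (div_pos hγ0 (by linarith)) h3, h4, ?_⟩
    rwa [div_lt_iff₀ (by linarith)] at h3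
  obtain ⟨ε0, hε0, hg⟩ := good_sum A hA htr η δ hη₁ hη₂ hδ0 (by rw [← hγ]; exact hδγ)
  obtain ⟨a, ha⟩ : ∃ a, a = 1 - δ + δ*(γ/2) := ⟨_, rfl⟩
  have hab : a < 1 - γ/2 := by rw [ha]; linarith
  have ha0 : 0 ≤ a := by
    have : 0 ≤ δ*(γ/2) := by positivity
    rw [ha]; linarith
  obtain ⟨ε, hε, hεm⟩ := exists_between (lt_min (lt_min hε0 (by norm_num : (0:ℝ) < 2/5)) (by linarith : 0 < 1-γ/2-a))
  have hl1 : ε < ε0 := lt_of_lt_of_le hεm ((min_le_left _ _).trans (min_le_left _ _))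
  have hl2 : ε < 2/5 := lt_of_lt_of_le hεm ((min_le_left _ _).trans (min_le_right _ _))
  have hl3 : ε < 1-γ/2-a := lt_of_lt_of_le hεm (min_le_right _ _)
  obtain ⟨K, hK⟩ := sumS (GoodPrime A η) δ ε hδ0 (by linarith) hε hl2.le (hg ε hε hl1)
  refine ⟨14 * Real.exp (1 + K + ε), by positivity, Real.exp (Real.exp 1), ?_⟩
  intro x hx
  have hx0 : 0 < x := lt_of_lt_of_le (Real.exp_pos _) hx
  obtain ⟨L, hL⟩ : ∃ L, L = Real.log x := ⟨_, rfl⟩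
  have hLe : Real.exp 1 ≤ L := by rw [hL, Real.le_log_iff_exp_le hx0]; exact hx
  have he := Real.add_one_le_exp (1:ℝ)
  have hL2 : 2 ≤ L := by linarith
  have hL0 : 0 < L := by linarith
  obtain ⟨ℓ, hℓ⟩ : ∃ ℓ, ℓ = Real.log L := ⟨_, rfl⟩
  have hℓ1 : 1 ≤ ℓ := by rw [hℓ, Real.le_log_iff_exp_le hL0]; exact hLe
  have hexpℓ : Real.exp ℓ = L := by rw [hℓ, Real.exp_log hL0]
  rw [← hL]
  obtain ⟨X, hX⟩ : ∃ X, X = ⌊x⌋₊ := ⟨_, rfl⟩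
  obtain ⟨Z, hZ⟩ : ∃ Z, Z = Real.exp (L^(γ/2)) := ⟨_, rfl⟩
  have hset : {N : ℕ | 1 ≤ N ∧ (N : ℝ) ≤ x ∧ (goodPart A η N : ℝ) ≤ Real.exp (L ^ (γ / 2))} =
      ((Ioc 0 X).filter (fun n => (goodPart A η n : ℝ) ≤ Z) : Finset ℕ) := by
    ext N
    rw [mem_coe, mem_filter, mem_Ioc, hX, Nat.le_floor_iff hx0.le, hZ, Set.mem_ofPred_eq, and_assoc, Nat.lt_iff_add_one_le]
  rw [hset, Set.ncard_coe_finset]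
  have hcount := count_le A η Z X
  obtain ⟨c, hc⟩ : ∃ c : ℝ, c = ((Ioc 0 X).filter (fun n => (goodPart A η n : ℝ) ≤ Z)).card := ⟨_, rfl⟩
  have hc0 : 0 ≤ c := by rw [hc]; positivity
  rw [← hc] at hcount ⊢
  -- the sum over primes
  obtain ⟨lr, hlr⟩ : ∃ lr, lr = Real.log (1+ε) := ⟨_, rfl⟩
  have hlr0 : 0 < lr := by rw [hlr]; exact Real.log_pos (by linarith)
  have hlrε : ε / lr ≤ 1 + ε := by
    have h := Real.one_sub_inv_le_log_of_pos (by linarith : 0 < 1+ε)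
    rw [← hlr] at h
    rw [div_le_iff₀ hlr0]
    have h2 := mul_le_mul_of_nonneg_left h (by linarith : 0 ≤ 1+ε)
    rw [mul_sub, mul_inv_cancel₀ (by linarith)] at h2
    linarith
  obtain ⟨n, hn⟩ : ∃ n, n = ⌈ℓ/lr⌉₊ := ⟨_, rfl⟩
  obtain ⟨j0, hj0⟩ : ∃ j0, j0 = ⌈((γ/2)*ℓ)/lr⌉₊ := ⟨_, rfl⟩
  have hn1 : (n:ℝ) ≤ ℓ/lr + 1 := by
    rw [hn]; exact (Nat.ceil_lt_add_one (by positivity)).le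
  have hj1 : (j0:ℝ) ≤ (γ/2)*ℓ/lr + 1 := by
    rw [hj0]; exact (Nat.ceil_lt_add_one (by positivity)).le
  have hnpow : L ≤ (1+ε)^n := by
    rw [← hexpℓ, hn, hlr]; exact ceil_pow _ _ (by linarith)
  have hjpow : L^(γ/2) ≤ (1+ε)^j0 := by
    rw [Real.rpow_def_of_pos hL0, ← hℓ, hj0, hlr, mul_comm ℓ]; exact ceil_pow _ _ (by linarith)
  have hXy : X ≤ yy ε n := by
    rw [hX]
    apply Nat.floor_le_floor
    rw [← Real.log_le_iff_le_exp hx0, ← hL]; exact hnpow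
  have hsum := hK n j0 Z (by rw [hZ]; exact Real.exp_le_exp.2 hjpow)
  have hsub : ∑ p ∈ (Ioc 0 X).filter (fun p => p.Prime ∧ (GoodPrime A η p → (p:ℝ) ≤ Z)), 1/(p:ℝ) ≤
      ∑ p ∈ (Ioc 0 (yy ε n)).filter (fun p => p.Prime ∧ (GoodPrime A η p → (p:ℝ) ≤ Z)), 1/(p:ℝ) := by
    apply sum_le_sum_of_subset_of_nonneg
    · exact filter_subset_filter _ (Ioc_subset_Ioc_right hXy)
    · intro p _ _; positivity
  have hδ1 : 0 ≤ 1 - δ := by linarith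
  have hb1 := mul_le_mul_of_nonneg_left hn1 (mul_nonneg hε.le hδ1)
  have hb2 := mul_le_mul_of_nonneg_left hj1 (mul_nonneg hε.le hδ0.le)
  have hb3 : ε*(1-δ)*(ℓ/lr+1) + ε*δ*((γ/2)*ℓ/lr+1) = ε + (ε/lr)*(a*ℓ) := by
    rw [ha]; field_simp; ring
  have hb4 := mul_le_mul_of_nonneg_right hlrε (mul_nonneg ha0 (by linarith : 0 ≤ ℓ))
  have hb5 : (1+ε)*(a*ℓ) ≤ (1-γ/2)*ℓ := by
    rw [← mul_assoc]
    apply mul_le_mul_of_nonneg_right _ (by linarith)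
    have : ε*a ≤ ε*1 := mul_le_mul_of_nonneg_left (by linarith) hε.le
    linarith
  have hfin : ∑ p ∈ (Ioc 0 X).filter (fun p => p.Prime ∧ (GoodPrime A η p → (p:ℝ) ≤ Z)), 1/(p:ℝ) ≤ K + ε + (1-γ/2)*ℓ := by
    linarith
  have hexp : Real.exp (1 + ∑ p ∈ (Ioc 0 X).filter (fun p => p.Prime ∧ (GoodPrime A η p → (p:ℝ) ≤ Z)), 1/(p:ℝ)) ≤
      Real.exp (1+K+ε) * (L / L^(γ/2)) := by
    have e1 : L / L^(γ/2) = Real.exp ((1-γ/2)*ℓ) := by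
      rw [hℓ, mul_comm, ← Real.rpow_def_of_pos hL0, Real.rpow_sub hL0, Real.rpow_one]
    rw [e1, ← Real.exp_add]
    apply Real.exp_le_exp.2
    linarith
  have hx1 : 1 ≤ x := by
    have : 0 ≤ Real.exp 1 := (Real.exp_pos _).le
    have h3 := Real.add_one_le_exp (Real.exp 1)
    linarith
  have hXle : (X:ℝ) ≤ x := by rw [hX]; exact Nat.floor_le hx0.le
  have hXge : x/2 ≤ X := by
    have h1 := Nat.lt_floor_add_one x
    rw [← hX] at h1
    have h2 : (1:ℝ) ≤ X := by
      rw [hX]; exact_mod_cast Nat.le_floor (by push_cast; exact hx1)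
    linarith
  have hlogX : L/2 ≤ Real.log X := by
    have h1 := Real.log_le_log (by linarith) hXge
    rw [Real.log_div hx0.ne' (by norm_num), ← hL] at h1
    have := Real.log_two_lt_d9
    linarith
  have hLg : 0 < L^(γ/2) := Real.rpow_pos_of_pos hL0 _
  have hstep : c * (L/2) ≤ 7 * x * (Real.exp (1+K+ε) * (L / L^(γ/2))) := by
    calc c * (L/2) ≤ c * Real.log X := mul_le_mul_of_nonneg_left hlogX hc0
      _ ≤ _ := hcount
      _ ≤ _ := mul_le_mul (mul_le_mul_of_nonneg_left hXle (by norm_num)) hexp (Real.exp_pos _).le (by linarith)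
  have hL2' : 0 < L/2 := by linarith
  rw [← mul_le_mul_iff_left₀ hL2']
  refine hstep.trans (le_of_eq ?_)
  field_simp
  ring
end FI
end Part24

/-- With `γ = (3-5η)/(2(1-η))`, for all large `x` the number of `N ≤ x` with
`N_G ≤ exp((log x)^{γ/2})` is `O(x / (log x)^{γ/2})`. -/
theorem few_integers_with_small_good_part
    (A : Matrix (Fin 2) (Fin 2) ℤ) (hA : A.det = 1) (htr : 2 < |A.trace|)
    (η : ℝ) (hη₁ : 1 / 2 < η) (hη₂ : η < 3 / 5) :
    ∃ C : ℝ, 0 < C ∧ ∃ x₀ : ℝ, ∀ x : ℝ, x₀ ≤ x →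
      ({N : ℕ | 1 ≤ N ∧ (N : ℝ) ≤ x ∧
          (goodPart A η N : ℝ) ≤
            Real.exp (Real.log x ^ ((3 - 5 * η) / (2 * (1 - η)) / 2))}.ncard : ℝ) ≤
        C * x / Real.log x ^ ((3 - 5 * η) / (2 * (1 - η)) / 2) := by
  exact FI.main_bound A hA htr η hη₁ hη₂ _ rfl
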